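/- There exists a universal constant c such that for every n, every m₁, m₂, r, and every (Q_o,m₁,m₂)-set 𝒬̃ ⊆ ℂ[x₁,…,xₙ], the dimension of the ℂ-linear span of 𝒬̃ is at most c. -/

import Mathlib

open MvPolynomial

/-- `rankS Q` is the minimal `r` such that `Q = ∑_{i=1}^r a_i · b_i` for linear forms
`a_i, b_i`. -/
noncomputable def rankS {σ : Type*} (Q : MvPolynomial σ ℂ) : ℕ :=
  sInf {r : ℕ | ∃ a b : Fin r → MvPolynomial σ ℂ,
    (∀ i, (a i).IsHomogeneous 1) ∧ (∀ i, (b i).IsHomogeneous 1) ∧ Q = ∑ i, a i * b i}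

/-- The family of all polynomials of a `(Q_o,m₁,m₂)`-set: `Q_o`, the `Q_j`'s, the `P_i`'s
and the squares `ℓ_t²`. -/
noncomputable def QoFam {n m₁ m₂ r : ℕ} (Qo : MvPolynomial (Fin n) ℂ)
    (Qs : Fin m₁ → MvPolynomial (Fin n) ℂ) (Ps : Fin m₂ → MvPolynomial (Fin n) ℂ)
    (ls : Fin r → MvPolynomial (Fin n) ℂ) :
    Unit ⊕ Fin m₁ ⊕ Fin m₂ ⊕ Fin r → MvPolynomial (Fin n) ℂ :=
  Sum.elim (fun _ => Qo) (Sum.elim Qs (Sum.elim Ps fun t => ls t ^ 2))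

/-- `𝒬̃ = {Q_o} ∪ {Q_j} ∪ {P_i} ∪ {ℓ_t²}` is a `(Q_o,m₁,m₂)`-set (Definition 4.4 of the
paper). -/
def IsQoSet {n : ℕ} (m₁ m₂ r : ℕ) (Qo : MvPolynomial (Fin n) ℂ)
    (Qs : Fin m₁ → MvPolynomial (Fin n) ℂ) (Ps : Fin m₂ → MvPolynomial (Fin n) ℂ)
    (ls : Fin r → MvPolynomial (Fin n) ℂ) : Prop :=
  -- the members of 𝒬₁ and 𝒬₂ are irreducible homogeneous quadratics, the ℓ_t are linear
  (Qo.IsHomogeneous 2 ∧ Irreducible Qo) ∧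
  (∀ j, (Qs j).IsHomogeneous 2 ∧ Irreducible (Qs j)) ∧
  (∀ i, (Ps i).IsHomogeneous 2 ∧ Irreducible (Ps i)) ∧
  (∀ t, (ls t).IsHomogeneous 1) ∧
  -- (1) pairwise linear independence and the vanishing (radical-membership) condition
  (∀ i j, i ≠ j →
    LinearIndependent ℂ ![QoFam Qo Qs Ps ls i, QoFam Qo Qs Ps ls j]) ∧
  (∀ i j, i ≠ j →
    (∏ k ∈ (Finset.univ.erase i).erase j, QoFam Qo Qs Ps ls k) ∈
      (Ideal.span {QoFam Qo Qs Ps ls i, QoFam Qo Qs Ps ls j}).radical) ∧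
  -- (2)
  (5 * m₂ + 2 < m₁) ∧
  -- (3)
  (∀ j, ∃ a b : MvPolynomial (Fin n) ℂ,
    a.IsHomogeneous 1 ∧ b.IsHomogeneous 1 ∧ Qs j = Qo + a * b) ∧
  -- (4)
  (∀ i, ∀ α β : ℂ, ¬(α = 0 ∧ β = 0) → 2 ≤ rankS (α • Ps i + β • Qo)) ∧
  -- (5)
  Set.ncard {i : Unit ⊕ Fin m₁ ⊕ Fin m₂ |
    ∃ c d : MvPolynomial (Fin n) ℂ, c.IsHomogeneous 1 ∧ d.IsHomogeneous 1 ∧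
      Sum.elim (fun _ => Qo) (Sum.elim Qs Ps) i ∈ Ideal.span {c, d} ∧
      Qo ∈ Ideal.span {c, d}} ≤ m₂

open Module

open Finset in
/-- Matrices with small Frobenius norm have few eigenvectors of eigenvalue `-1`. -/
lemma finrank_le_of_neg_eigenspace {ι : Type*} [Fintype ι] (E : ι → EuclideanSpace ℂ ι)
    (X : Submodule ℂ (EuclideanSpace ℂ ι))
    (hX : ∀ x ∈ X, ∀ i, inner ℂ (E i) x = -x i) :
    (Module.finrank ℂ X : ℝ) ≤ ∑ i, ‖E i‖ ^ 2 := by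
  classical
  set b := stdOrthonormalBasis ℂ X
  have ho : Orthonormal ℂ (fun k => (b k : EuclideanSpace ℂ ι)) :=
    b.orthonormal.comp_linearIsometry X.subtypeₗᵢ
  have h1 : ∀ k, ∑ i, ‖inner ℂ (E i) (b k : EuclideanSpace ℂ ι)‖ ^ 2 = 1 := by
    intro k
    have : ‖(b k : EuclideanSpace ℂ ι)‖ = 1 := ho.1 k
    rw [EuclideanSpace.norm_eq, Real.sqrt_eq_one] at this
    rw [← this]
    refine sum_congr rfl fun i _ => ?_
    rw [hX _ (b k).2, norm_neg]
  calc (Module.finrank ℂ X : ℝ) = ∑ k, ∑ i, ‖inner ℂ (E i) (b k : EuclideanSpace ℂ ι)‖ ^ 2 := by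
        simp [h1]
    _ = ∑ i, ∑ k, ‖inner ℂ (b k : EuclideanSpace ℂ ι) (E i)‖ ^ 2 := by
        rw [sum_comm]
        simp_rw [norm_inner_symm]
    _ ≤ ∑ i, ‖E i‖ ^ 2 := by
        refine sum_le_sum fun i _ => ?_
        exact ho.sum_inner_products_le (E i) (s := univ)

open Finset in
/-- A balanced weighted system of vectors supported on triples has a scaling for which all the
columns have the same weighted norm. -/
lemma exists_balanced_scaling {ι : Type*} [Fintype ι] [DecidableEq ι] [Nonempty ι]
    (w : ι → ι → ι → ℝ) (p : ι → ι → ι → ι → ℝ)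
    (hw0 : ∀ i j k, 0 ≤ w i j k) (hp0 : ∀ i j k l, 0 ≤ p i j k l)
    (hp : ∀ i j k, 0 < p i j k i ∧ 0 < p i j k j ∧ 0 < p i j k k)
    (hdiag : ∀ i k, w i i k = 0)
    (hsum : ∀ i j, i ≠ j → ∑ k, w i j k = 1)
    (hs1 : ∀ i j k, w i j k = w j i k) (hs2 : ∀ i j k, w i j k = w i k j) :
    ∃ u : ι → ℝ, ∀ l, ∑ i, ∑ j, ∑ k, w i j k *
      (p i j k l * Real.exp (u l) / ∑ l', p i j k l' * Real.exp (u l')) =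
        (Fintype.card ι : ℝ) - 1 := by
  obtain ⟨i₀⟩ := ‹Nonempty ι›
  set t : ℝ := (Fintype.card ι : ℝ) - 1 with ht
  set Z : ι → ι → ι → (ι → ℝ) → ℝ := fun i j k u => ∑ l, p i j k l * Real.exp (u l) with hZ
  set Ψ : (ι → ℝ) → ℝ := fun u =>
    (∑ i, ∑ j, ∑ k, w i j k * Real.log (Z i j k u)) - t * ∑ l, u l with hΨ
  have hterm : ∀ i j k l u, p i j k l * Real.exp (u l) ≤ Z i j k u := by
    intro i j k l u
    exact single_le_sum (f := fun l => p i j k l * Real.exp (u l))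
      (fun l _ => mul_nonneg (hp0 i j k l) (Real.exp_pos _).le) (mem_univ l)
  have hZpos : ∀ i j k u, 0 < Z i j k u := fun i j k u =>
    lt_of_lt_of_le (mul_pos (hp i j k).1 (Real.exp_pos _)) (hterm i j k i u)
  have hw2 : ∀ i, ∑ j, ∑ k, w i j k = t := by
    intro i
    have : ∀ j, ∑ k, w i j k = if i = j then 0 else 1 := by
      intro j
      split_ifs with h
      · subst h; simp [hdiag]
      · exact hsum i j h
    simp_rw [this]
    have := Finset.card_erase_of_mem (mem_univ i)
    simp only [sum_ite, sum_const_zero, zero_add, sum_const, nsmul_eq_mul, mul_one]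
    rw [filter_ne, ht, card_erase_of_mem (mem_univ i), card_univ,
      Nat.cast_sub (Fintype.card_pos_iff.2 ⟨i⟩)]
    simp
  have hm1 : ∀ f : ι → ℝ, ∑ i, ∑ j, ∑ k, w i j k * f i = t * ∑ i, f i := by
    intro f
    simp_rw [← sum_mul, hw2, mul_sum]
  have hm2 : ∀ f : ι → ℝ, ∑ i, ∑ j, ∑ k, w i j k * f j = t * ∑ i, f i := by
    intro f
    rw [sum_comm, ← hm1]
    refine sum_congr rfl fun i _ => sum_congr rfl fun j _ => sum_congr rfl fun k _ => ?_
    rw [hs1]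
  have hm3 : ∀ f : ι → ℝ, ∑ i, ∑ j, ∑ k, w i j k * f k = t * ∑ i, f i := by
    intro f
    rw [← hm2]
    refine sum_congr rfl fun i _ => ?_
    rw [sum_comm]
    refine sum_congr rfl fun j _ => sum_congr rfl fun k _ => ?_
    rw [hs2]
  -- lower bound
  set c : ι → ι → ι → ℝ := fun i j k =>
    min (Real.log (p i j k i)) (min (Real.log (p i j k j)) (Real.log (p i j k k))) with hc
  have hlog : ∀ i j k u, c i j k + ((u i + u j + u k) / 3 + |u i - u j| / 3) ≤
      Real.log (Z i j k u) := by
    intro i j k u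
    have key : ∀ l, 0 < p i j k l → Real.log (p i j k l) + u l ≤ Real.log (Z i j k u) := by
      intro l hl
      rw [← Real.log_exp (u l), ← Real.log_mul hl.ne' (Real.exp_pos _).ne']
      exact Real.log_le_log (mul_pos hl (Real.exp_pos _)) (hterm i j k l u)
    have h1 := key i (hp i j k).1
    have h2 := key j (hp i j k).2.1
    have h3 := key k (hp i j k).2.2
    have c1 : c i j k ≤ Real.log (p i j k i) := min_le_left _ _
    have c2 : c i j k ≤ Real.log (p i j k j) := (min_le_right _ _).trans (min_le_left _ _)
    have c3 : c i j k ≤ Real.log (p i j k k) := (min_le_right _ _).trans (min_le_right _ _)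
    rcases abs_cases (u i - u j) with ⟨h, _⟩ | ⟨h, _⟩ <;> rw [h] <;> linarith
  set C : ℝ := ∑ i, ∑ j, ∑ k, w i j k * c i j k with hC
  have hlow : ∀ u, C + (∑ i, ∑ j, |u i - u j|) / 3 ≤ Ψ u := by
    intro u
    have h1 : ∑ i, ∑ j, ∑ k, w i j k * (c i j k + ((u i + u j + u k) / 3 + |u i - u j| / 3)) ≤
        ∑ i, ∑ j, ∑ k, w i j k * Real.log (Z i j k u) :=
      sum_le_sum fun i _ => sum_le_sum fun j _ => sum_le_sum fun k _ =>
        mul_le_mul_of_nonneg_left (hlog i j k u) (hw0 i j k)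
    have h2 : ∑ i, ∑ j, ∑ k, w i j k * |u i - u j| = ∑ i, ∑ j, |u i - u j| := by
      refine sum_congr rfl fun i _ => sum_congr rfl fun j _ => ?_
      rw [← sum_mul]
      by_cases h : i = j
      · subst h; simp
      · rw [hsum i j h, one_mul]
    have h3 : ∑ i, ∑ j, ∑ k, w i j k * (c i j k + ((u i + u j + u k) / 3 + |u i - u j| / 3)) =
        C + ((∑ i, ∑ j, ∑ k, w i j k * u i) / 3 + (∑ i, ∑ j, ∑ k, w i j k * u j) / 3 +
          (∑ i, ∑ j, ∑ k, w i j k * u k) / 3) + (∑ i, ∑ j, ∑ k, w i j k * |u i - u j|) / 3 := by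
      simp only [hC, sum_div, ← sum_add_distrib]
      refine sum_congr rfl fun i _ => sum_congr rfl fun j _ => sum_congr rfl fun k _ => ?_
      ring
    rw [h3, h2, hm1, hm2, hm3] at h1
    simp only [hΨ]
    linarith
  have htrans : ∀ u s, Ψ (fun l => u l + s) = Ψ u := by
    intro u s
    have h1 : ∀ i j k, Real.log (Z i j k fun l => u l + s) = Real.log (Z i j k u) + s := by
      intro i j k
      have : (Z i j k fun l => u l + s) = Z i j k u * Real.exp s := by
        simp only [hZ, sum_mul]
        refine sum_congr rfl fun l _ => ?_
        rw [Real.exp_add]; ring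
      rw [this, Real.log_mul (hZpos _ _ _ _).ne' (Real.exp_pos _).ne', Real.log_exp]
    have h2 := hm1 (fun _ => s)
    simp only [hΨ, h1, mul_add, sum_add_distrib]
    rw [h2]; ring
  have hcont : Continuous Ψ := by
    refine Continuous.sub ?_ (by fun_prop)
    refine continuous_finsetSum _ fun i _ => continuous_finsetSum _ fun j _ =>
      continuous_finsetSum _ fun k _ => continuous_const.mul ?_
    refine Continuous.log ?_ (fun u => (hZpos i j k u).ne')
    simp only [hZ]
    fun_prop
  -- a global minimizer
  set R : ℝ := 3 * (Ψ 0 - C) with hR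
  have hR0 : 0 ≤ R := by
    have := hlow 0
    simp at this
    linarith
  set S : Set (ι → ℝ) := {u | u i₀ = 0} ∩ Set.Icc (fun _ => -R) (fun _ => R) with hS
  have hScomp : IsCompact S :=
    isCompact_Icc.inter_left (isClosed_eq (continuous_apply i₀) continuous_const)
  have h0S : (0 : ι → ℝ) ∈ S :=
    ⟨rfl, fun _ => by simpa using hR0, fun _ => by simpa using hR0⟩
  obtain ⟨u, huS, humin⟩ := hScomp.exists_isMinOn ⟨0, h0S⟩ hcont.continuousOn
  have hglob : ∀ x, Ψ u ≤ Ψ x := by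
    intro x
    rw [← htrans x (-(x i₀))]
    set y : ι → ℝ := fun l => x l + -x i₀ with hy
    by_cases hyS : y ∈ S
    · exact humin hyS
    · have hy0 : y i₀ = 0 := by simp [hy]
      have : ∃ j, R < |y j| := by
        by_contra! h
        exact hyS ⟨hy0, fun j => (abs_le.1 (h j)).1, fun j => (abs_le.1 (h j)).2⟩
      obtain ⟨j, hj⟩ := this
      have h1 : |y i₀ - y j| ≤ ∑ i, ∑ j, |y i - y j| := by
        refine le_trans (single_le_sum (f := fun j => |y i₀ - y j|) (fun _ _ => abs_nonneg _)
          (mem_univ j)) ?_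
        exact single_le_sum (f := fun i => ∑ j, |y i - y j|)
          (fun _ _ => sum_nonneg fun _ _ => abs_nonneg _) (mem_univ i₀)
      rw [hy0, zero_sub, abs_neg] at h1
      have h2 := hlow y
      have h3 : Ψ u ≤ Ψ 0 := humin h0S
      linarith
  refine ⟨u, fun l => ?_⟩
  set line : ℝ → ι → ℝ := fun s => Function.update u l (u l + s) with hline
  have hline0 : line 0 = u := by simp [hline]
  have hlined : ∀ m, HasDerivAt (fun s => line s m) (if m = l then 1 else 0) 0 := by
    intro m
    by_cases h : m = l
    · subst h
      simpa [hline] using (hasDerivAt_id (0 : ℝ)).const_add (u m)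
    · simpa [hline, h] using hasDerivAt_const (0 : ℝ) (u m)
  have hZd : ∀ i j k, HasDerivAt (fun s => Z i j k (line s)) (p i j k l * Real.exp (u l)) 0 := by
    intro i j k
    have : HasDerivAt (fun s => ∑ m, p i j k m * Real.exp (line s m))
        (∑ m, p i j k m * (Real.exp (line 0 m) * (if m = l then 1 else 0))) 0 :=
      HasDerivAt.fun_sum fun m _ => ((hlined m).exp).const_mul _
    rw [hline0] at this
    simpa using this
  have hΨd : HasDerivAt (fun s => Ψ (line s))
      ((∑ i, ∑ j, ∑ k, w i j k * (p i j k l * Real.exp (u l) / Z i j k u)) - t * 1) 0 := by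
    refine HasDerivAt.fun_sub ?_ (HasDerivAt.const_mul _ ?_)
    · refine HasDerivAt.fun_sum fun i _ => HasDerivAt.fun_sum fun j _ => HasDerivAt.fun_sum
        fun k _ => HasDerivAt.const_mul _ ?_
      have := (hZd i j k).log (hZpos i j k _).ne'
      rwa [hline0] at this
    · have : HasDerivAt (fun s => ∑ m, line s m) (∑ m, if m = l then (1 : ℝ) else 0) 0 :=
        HasDerivAt.fun_sum fun m _ => hlined m
      simpa using this
  have hmin : IsLocalMin (fun s => Ψ (line s)) 0 :=
    Filter.Eventually.of_forall fun s => by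
      simp only [hline0]; exact hglob _
  have := hmin.hasDerivAt_eq_zero hΨd
  linarith

open Finset in
lemma sum_triples_through_pair {ι : Type*} [Fintype ι] [DecidableEq ι] (w : ι → ι → ι → ℝ)
    (hsum : ∀ i j, i ≠ j → ∑ k, w i j k = 1)
    (hs1 : ∀ i j k, w i j k = w j i k) (hs2 : ∀ i j k, w i j k = w i k j) {i l : ι}
    (hil : i ≠ l) :
    ∑ x, ∑ y, ∑ z, w x y z *
      (((if x = i then 1 else 0) + (if y = i then 1 else 0) + (if z = i then 1 else 0)) *
      ((if x = l then 1 else 0) + (if y = l then 1 else 0) + (if z = l then 1 else 0))) = 6 := by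
  have e : ∀ x y z, w x y z *
      (((if x = i then 1 else 0) + (if y = i then 1 else 0) + (if z = i then 1 else 0)) *
      ((if x = l then 1 else 0) + (if y = l then 1 else 0) + (if z = l then 1 else 0))) =
      w x y z * ((if x = i then 1 else 0) * (if y = l then 1 else 0)) +
      w x y z * ((if x = l then 1 else 0) * (if y = i then 1 else 0)) +
      w x y z * ((if x = i then 1 else 0) * (if z = l then 1 else 0)) +
      w x y z * ((if x = l then 1 else 0) * (if z = i then 1 else 0)) +
      w x y z * ((if y = i then 1 else 0) * (if z = l then 1 else 0)) +
      w x y z * ((if y = l then 1 else 0) * (if z = i then 1 else 0)) := by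
    intro x y z
    have h : ∀ t : ι, (if t = i then (1 : ℝ) else 0) * (if t = l then 1 else 0) = 0 := by
      intro t
      split_ifs with h1 h2
      · exact absurd (h1.symm.trans h2) hil
      all_goals simp
    linear_combination w x y z * (h x + h y + h z)
  simp_rw [e, sum_add_distrib]
  have t1 : ∀ i l, i ≠ l → ∑ x, ∑ y, ∑ z, w x y z *
      ((if x = i then 1 else 0) * (if y = l then 1 else 0)) = 1 := by
    intro i l hil
    simp [hsum i l hil]
  have t2 : ∀ i l, i ≠ l → ∑ x, ∑ y, ∑ z, w x y z *
      ((if x = i then 1 else 0) * (if z = l then 1 else 0)) = 1 := by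
    intro i l hil
    simp only [mul_ite, mul_one, mul_zero, sum_ite_eq', mem_univ, if_true]
    simp [← hs2 i l, hsum i l hil]
  have t3 : ∀ i l, i ≠ l → ∑ x, ∑ y, ∑ z, w x y z *
      ((if y = i then 1 else 0) * (if z = l then 1 else 0)) = 1 := by
    intro i l hil
    simp only [mul_ite, mul_one, mul_zero, sum_ite_eq', mem_univ, if_true]
    simp_rw [hs1 _ i l, ← hs2 i l]
    exact hsum i l hil
  rw [t1 i l hil, t1 l i hil.symm, t2 i l hil, t2 l i hil.symm, t3 i l hil, t3 l i hil.symm]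
  norm_num

set_option maxHeartbeats 400000 in
open Finset in
/-- Rank bound for weighted systems of dependencies supported on triples. -/
lemma finrank_span_le_of_triples {ι W : Type*} [Fintype ι] [DecidableEq ι]
    [AddCommGroup W] [Module ℂ W] (v : ι → W) (hcard : 2 ≤ Fintype.card ι)
    (w : ι → ι → ι → ℝ) (a : ι → ι → ι → ι → ℂ)
    (hw0 : ∀ i j k, 0 ≤ w i j k)
    (ha : ∀ i j k, a i j k i ≠ 0 ∧ a i j k j ≠ 0 ∧ a i j k k ≠ 0)
    (hdist : ∀ i j k, w i j k ≠ 0 → i ≠ j ∧ j ≠ k ∧ i ≠ k)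
    (hsupp : ∀ i j k l, w i j k ≠ 0 → l ≠ i → l ≠ j → l ≠ k → a i j k l = 0)
    (hdep : ∀ i j k, w i j k ≠ 0 → ∑ l, a i j k l • v l = 0)
    (hsum : ∀ i j, i ≠ j → ∑ k, w i j k = 1)
    (hs1 : ∀ i j k, w i j k = w j i k) (hs2 : ∀ i j k, w i j k = w i k j) :
    Module.finrank ℂ (Submodule.span ℂ (Set.range v)) ≤ 12 := by
  have hne : Nonempty ι := Fintype.card_pos_iff.1 (by omega)
  have hdiag : ∀ i k, w i i k = 0 := fun i k => by
    by_contra h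
    exact (hdist i i k h).1 rfl
  have hdiag2 : ∀ i k, w i k k = 0 := fun i k => by
    by_contra h
    exact (hdist i k k h).2.1 rfl
  have hdiag3 : ∀ i k, w i k i = 0 := fun i k => by
    by_contra h
    exact (hdist i k i h).2.2 rfl
  obtain ⟨u, hu⟩ := exists_balanced_scaling w (fun i j k l => ‖a i j k l‖ ^ 2) hw0
    (fun i j k l => by positivity)
    (fun i j k => ⟨by have := (ha i j k).1; positivity, by have := (ha i j k).2.1; positivity,
      by have := (ha i j k).2.2; positivity⟩) hdiag hsum hs1 hs2
  set N : ℝ := (Fintype.card ι : ℝ) - 1 with hN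
  have hN1 : 1 ≤ N := by
    have : (2 : ℝ) ≤ Fintype.card ι := by exact_mod_cast hcard
    linarith
  set Z : ι × ι × ι → ℝ := fun T => ∑ l, ‖a T.1 T.2.1 T.2.2 l‖ ^ 2 * Real.exp (u l) with hZ
  have hZpos : ∀ T, 0 < Z T := by
    intro T
    refine lt_of_lt_of_le ?_ (single_le_sum
      (f := fun l => ‖a T.1 T.2.1 T.2.2 l‖ ^ 2 * Real.exp (u l))
      (fun l _ => by positivity) (mem_univ T.1))
    have := (ha T.1 T.2.1 T.2.2).1
    positivity
  set ω : ι × ι × ι → ℝ := fun T => w T.1 T.2.1 T.2.2 with hω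
  have hω0 : ∀ T, 0 ≤ ω T := fun T => hw0 _ _ _
  set b : ι × ι × ι → ι → ℂ := fun T l =>
    a T.1 T.2.1 T.2.2 l * ((Real.exp (u l / 2) / √(Z T) : ℝ) : ℂ) with hb
  set q : ι × ι × ι → ι → ℝ := fun T l => ‖b T l‖ ^ 2 with hq
  have hq' : ∀ T l, q T l = ‖a T.1 T.2.1 T.2.2 l‖ ^ 2 * Real.exp (u l) / Z T := by
    intro T l
    simp only [hq, hb, norm_mul, Complex.norm_real, Real.norm_eq_abs, mul_pow, sq_abs, div_pow]
    rw [Real.sq_sqrt (hZpos T).le, ← Real.exp_nat_mul]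
    norm_num
    rw [mul_div_cancel₀ _ (two_ne_zero)]
    ring
  have hqsum : ∀ T, ∑ l, q T l = 1 := by
    intro T
    simp_rw [hq', ← sum_div]
    exact div_self (hZpos T).ne'
  have hqcol : ∀ l, ∑ T, ω T * q T l = N := by
    intro l
    rw [← hu l]
    simp_rw [Fintype.sum_prod_type, hq']
    rfl
  set M : ι → ι → ℂ := fun i l => ∑ T, (ω T : ℂ) * (star (b T i) * b T l) with hM
  have hMdiag : ∀ i, M i i = (N : ℂ) := by
    intro i
    rw [← hqcol i]
    push_cast
    refine sum_congr rfl fun T _ => ?_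
    congr 1
    have := Complex.conj_mul' (b T i)
    simpa [hq] using this
  -- the number of triples through two points
  set χ : ι × ι × ι → ι → ℝ := fun T l =>
    (if T.1 = l then 1 else 0) + (if T.2.1 = l then 1 else 0) + (if T.2.2 = l then 1 else 0)
    with hχ
  have hpair : ∀ i l, i ≠ l → ∑ T, ω T * (χ T i * χ T l) = 6 := by
    intro i l hil
    simp_rw [Fintype.sum_prod_type, hω, hχ]
    exact sum_triples_through_pair w hsum hs1 hs2 hil
  have hMoff : ∀ i l, i ≠ l → ‖M i l‖ ^ 2 ≤ 6 * ∑ T, ω T * (q T i * q T l) := by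
    intro i l hil
    have h1 : ‖M i l‖ ≤ ∑ T, ω T * (‖b T i‖ * ‖b T l‖) := by
      refine (norm_sum_le _ _).trans (sum_le_sum fun T _ => ?_)
      simp [abs_of_nonneg (hω0 T)]
    rw [← hpair i l hil]
    refine (pow_le_pow_left₀ (norm_nonneg _) h1 2).trans ?_
    refine sum_sq_le_sum_mul_sum_of_sq_le_mul _ (fun T _ => ?_) (fun T _ => ?_)
      (fun T _ => le_of_eq ?_)
    · refine mul_nonneg (hω0 T) (mul_nonneg ?_ ?_) <;> simp only [hχ] <;> positivity
    · exact mul_nonneg (hω0 T) (by simp only [hq]; positivity)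
    · obtain ⟨x, y, z⟩ := T
      by_cases h : w x y z = 0
      · simp [hω, h]
      · obtain ⟨h1, h2, h3⟩ := hdist x y z h
        have key : ∀ l, q (x, y, z) l = 0 ∧ χ (x, y, z) l = 0 ∨ χ (x, y, z) l = 1 := by
          intro l
          by_cases hx : x = l
          · right; subst hx; simp [hχ, h1.symm, h3.symm]
          by_cases hy : y = l
          · right; subst hy; simp [hχ, hx, h2.symm]
          by_cases hz : z = l
          · right; subst hz; simp [hχ, hx, hy]
          left
          refine ⟨?_, by simp [hχ, hx, hy, hz]⟩
          rw [hq', hsupp x y z l h (Ne.symm hx) (Ne.symm hy) (Ne.symm hz)]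
          simp
        have e : (ω (x, y, z) * (‖b (x, y, z) i‖ * ‖b (x, y, z) l‖)) ^ 2 =
            ω (x, y, z) ^ 2 * (q (x, y, z) i * q (x, y, z) l) := by simp only [hq]; ring
        rw [e]
        rcases key i with ⟨h5, h6⟩ | h6
        · rw [h5, h6]; ring
        rcases key l with ⟨h7, h8⟩ | h8
        · rw [h7, h8]; ring
        rw [h6, h8]; ring
  set E : ι → EuclideanSpace ℂ ι := fun i =>
    WithLp.toLp 2 (fun l => if i = l then 0 else star (M i l) / N) with hE
  have hEnorm : ∑ i, ‖E i‖ ^ 2 ≤ 12 := by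
    have h1 : ∀ i, ‖E i‖ ^ 2 ≤ ∑ l, 6 * (∑ T, ω T * (q T i * q T l)) / N ^ 2 := by
      intro i
      rw [EuclideanSpace.norm_sq_eq]
      refine sum_le_sum fun l _ => ?_
      simp only [hE]
      split_ifs with h
      · rw [norm_zero, zero_pow two_ne_zero]
        have : 0 ≤ ∑ T, ω T * (q T i * q T l) :=
          sum_nonneg fun T _ => mul_nonneg (hω0 T) (by simp only [hq]; positivity)
        positivity
      · rw [norm_div, div_pow, norm_star, Complex.norm_real, Real.norm_eq_abs, sq_abs]
        gcongr
        exact hMoff i l h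
    have hωsum : ∑ T, ω T = (N + 1) * N := by
      have : ∑ l, ∑ T, ω T * q T l = ∑ T, ω T := by
        rw [sum_comm]
        refine sum_congr rfl fun T _ => ?_
        rw [← mul_sum, hqsum, mul_one]
      rw [← this]
      simp_rw [hqcol]
      simp only [sum_const, card_univ, nsmul_eq_mul, hN]
      ring
    have h2 : ∑ i, ∑ l, 6 * (∑ T, ω T * (q T i * q T l)) / N ^ 2 = 6 * ((N + 1) * N) / N ^ 2 := by
      rw [← hωsum]
      simp_rw [← sum_div, ← mul_sum]
      congr 2
      simp_rw [sum_comm (s := (univ : Finset ι)) (t := (univ : Finset (ι × ι × ι)))]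
      refine sum_congr rfl fun T _ => ?_
      simp_rw [← mul_sum, hqsum, mul_one, hqsum, mul_one]
    refine (sum_le_sum fun i _ => h1 i).trans ?_
    rw [h2, div_le_iff₀ (by positivity)]
    nlinarith
  set S := Submodule.span ℂ (Set.range v)
  have hvS : ∀ l, v l ∈ S := fun l => Submodule.subset_span ⟨l, rfl⟩
  let Φ : Module.Dual ℂ S →ₗ[ℂ] EuclideanSpace ℂ ι :=
    { toFun := fun φ => WithLp.toLp 2 fun l => φ ⟨v l, hvS l⟩ * (Real.exp (-(u l / 2)) : ℝ)
      map_add' := fun φ ψ => by ext l; simp [add_mul]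
      map_smul' := fun c φ => by ext l; simp [mul_assoc] }
  have hΦ : Function.Injective Φ := by
    rw [injective_iff_map_eq_zero]
    intro φ hφ
    have h1 : ∀ l, φ ⟨v l, hvS l⟩ = 0 := by
      intro l
      have := congrArg (fun x : EuclideanSpace ℂ ι => x l) hφ
      simpa [Φ] using this
    ext ⟨x, hx⟩
    induction hx using Submodule.span_induction with
    | mem x hx => obtain ⟨l, rfl⟩ := hx; exact h1 l
    | zero => exact φ.map_zero
    | add x y hx hy h h' =>
      rw [LinearMap.zero_apply] at h h' ⊢
      have := φ.map_add ⟨x, hx⟩ ⟨y, hy⟩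
      rw [h, h', add_zero] at this
      exact this
    | smul c x hx h =>
      rw [LinearMap.zero_apply] at h ⊢
      have := φ.map_smul c ⟨x, hx⟩
      rw [h, smul_zero] at this
      exact this
  have : FiniteDimensional ℂ S := FiniteDimensional.span_of_finite ℂ (Set.finite_range v)
  have hfin : Module.finrank ℂ (LinearMap.range Φ) = Module.finrank ℂ S := by
    rw [LinearMap.finrank_range_of_inj hΦ, Subspace.dual_finrank_eq]
  have hX := finrank_le_of_neg_eigenspace E (LinearMap.range Φ) (by
    rintro _ ⟨φ, rfl⟩ i
    have hMx : ∑ l, M i l * Φ φ l = 0 := by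
      simp only [hM, sum_mul]
      rw [sum_comm]
      refine sum_eq_zero fun T _ => ?_
      by_cases h : ω T = 0
      · simp [h]
      have h2 : ∑ l, b T l * Φ φ l = 0 := by
        have h3 : φ (∑ l, a T.1 T.2.1 T.2.2 l • ⟨v l, hvS l⟩) = 0 := by
          rw [← φ.map_zero]
          congr 1
          apply Subtype.ext
          have := hdep T.1 T.2.1 T.2.2 h
          simpa using this
        rw [map_sum] at h3
        have h4 : ∑ l, b T l * Φ φ l =
            (∑ l, φ (a T.1 T.2.1 T.2.2 l • ⟨v l, hvS l⟩)) * ((√(Z T) : ℝ) : ℂ)⁻¹ := by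
          rw [sum_mul]
          refine sum_congr rfl fun l _ => ?_
          simp only [hb, Φ, LinearMap.coe_mk, AddHom.coe_mk, map_smul, smul_eq_mul]
          have h5 : ((Real.exp (u l / 2) / √(Z T) : ℝ) : ℂ) * (Real.exp (-(u l / 2)) : ℝ) =
              ((√(Z T) : ℝ) : ℂ)⁻¹ := by
            rw [← Complex.ofReal_mul, ← Complex.ofReal_inv, div_mul_eq_mul_div, ← Real.exp_add]
            simp
          rw [← h5]; ring
        rw [h4, h3, zero_mul]
      have h6 : ∑ l, (ω T : ℂ) * (star (b T i) * b T l) * Φ φ l =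
          (ω T : ℂ) * star (b T i) * ∑ l, b T l * Φ φ l := by
        rw [mul_sum]
        exact sum_congr rfl fun l _ => by ring
      rw [h6, h2, mul_zero]
    have hNC : (N : ℂ) ≠ 0 := by
      have : N ≠ 0 := by linarith
      exact_mod_cast this
    have e1 : inner ℂ (E i) (Φ φ) = (∑ l, if i = l then 0 else M i l * Φ φ l) / N := by
      rw [PiLp.inner_apply, sum_div]
      refine sum_congr rfl fun l _ => ?_
      simp only [hE]
      split_ifs with h
      · simp
      · simp [mul_div_assoc, mul_comm]
    have e2 : (∑ l, if i = l then 0 else M i l * Φ φ l) = -(N * Φ φ i) := by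
      have : ∑ l, M i l * Φ φ l = (∑ l, if i = l then 0 else M i l * Φ φ l) + N * Φ φ i := by
        rw [← hMdiag i]
        have : M i i * Φ φ i = ∑ l, if i = l then M i l * Φ φ l else 0 := by simp
        rw [this, ← sum_add_distrib]
        refine sum_congr rfl fun l _ => ?_
        split_ifs <;> simp
      rw [hMx] at this
      linear_combination -this
    rw [e1, e2]
    field_simp)
  rw [hfin] at hX
  exact_mod_cast hX.trans hEnorm

open Finset in
/-- Complex Sylvester–Gallai for pairwise independent vectors. -/
lemma finrank_span_le_of_sylvesterGallai_pairwise {ι W : Type*} [Fintype ι]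
    [AddCommGroup W] [Module ℂ W] (v : ι → W)
    (hv : ∀ i j, i ≠ j → LinearIndependent ℂ ![v i, v j])
    (hSG : ∀ i j, i ≠ j → ∃ k, k ≠ i ∧ k ≠ j ∧ v k ∈ Submodule.span ℂ {v i, v j}) :
    Module.finrank ℂ (Submodule.span ℂ (Set.range v)) ≤ 12 := by
  classical
  by_cases hcard : 2 ≤ Fintype.card ι
  swap
  · have := finrank_range_le_card (R := ℂ) v
    unfold Set.finrank at this
    omega
  have hind : ∀ i j, i ≠ j → ∀ s t : ℂ, s • v i + t • v j = 0 → s = 0 ∧ t = 0 :=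
    fun i j h => LinearIndependent.pair_iff.1 (hv i j h)
  let Coll : ι → ι → ι → Prop := fun i j k =>
    i ≠ j ∧ j ≠ k ∧ i ≠ k ∧ v k ∈ Submodule.span ℂ {v i, v j}
  have hcoef : ∀ i j k, Coll i j k → ∃ α β : ℂ, α ≠ 0 ∧ β ≠ 0 ∧ α • v i + β • v j = v k := by
    rintro i j k ⟨hij, hjk, hik, hk⟩
    obtain ⟨α, β, h⟩ := Submodule.mem_span_pair.1 hk
    refine ⟨α, β, ?_, ?_, h⟩
    · rintro rfl
      have := hind j k hjk β (-1) (by rw [← h]; module)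
      exact one_ne_zero (neg_eq_zero.1 this.2)
    · rintro rfl
      have := hind i k hik α (-1) (by rw [← h]; module)
      exact one_ne_zero (neg_eq_zero.1 this.2)
  have hspan1 : ∀ i j, Submodule.span ℂ {v i, v j} = Submodule.span ℂ {v j, v i} := fun i j => by
    rw [Set.pair_comm]
  have hspan2 : ∀ i j k, Coll i j k →
      Submodule.span ℂ {v i, v j} = Submodule.span ℂ {v i, v k} := by
    intro i j k h
    obtain ⟨α, β, hα, hβ, e⟩ := hcoef i j k h
    apply le_antisymm
    · rw [Submodule.span_le, Set.insert_subset_iff, Set.singleton_subset_iff]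
      refine ⟨Submodule.subset_span (by simp), Submodule.mem_span_pair.2 ⟨-β⁻¹ * α, β⁻¹, ?_⟩⟩
      rw [← e, smul_add, smul_smul, smul_smul, inv_mul_cancel₀ hβ]
      module
    · rw [Submodule.span_le, Set.insert_subset_iff, Set.singleton_subset_iff]
      exact ⟨Submodule.subset_span (by simp), h.2.2.2⟩
  have hC1 : ∀ i j k, Coll i j k → Coll j i k := fun i j k h =>
    ⟨h.1.symm, h.2.2.1, h.2.1, by rw [hspan1]; exact h.2.2.2⟩
  have hC2 : ∀ i j k, Coll i j k → Coll i k j := fun i j k h =>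
    ⟨h.2.2.1, h.2.1.symm, h.1, by
      rw [← hspan2 i j k h]; exact Submodule.subset_span (by simp)⟩
  let r : ι → ι → ℕ := fun i j => #{l | v l ∈ Submodule.span ℂ {v i, v j}} - 2
  have hr : ∀ i j, i ≠ j → #{k | Coll i j k} = r i j ∧ 0 < r i j := by
    intro i j hij
    have e : univ.filter (fun l => v l ∈ Submodule.span ℂ {v i, v j}) =
        insert i (insert j (univ.filter fun k => Coll i j k)) := by
      ext l
      simp only [mem_filter_univ, mem_insert, Coll]
      constructor
      · intro h
        by_cases h1 : l = i
        · exact Or.inl h1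
        by_cases h2 : l = j
        · exact Or.inr (Or.inl h2)
        exact Or.inr (Or.inr ⟨hij, Ne.symm h2, Ne.symm h1, h⟩)
      · rintro (rfl | rfl | h)
        · exact Submodule.subset_span (by simp)
        · exact Submodule.subset_span (by simp)
        · exact h.2.2.2
    have h1 : #{k | Coll i j k} = r i j := by
      simp only [r, e]
      rw [card_insert_of_notMem, card_insert_of_notMem]
      · omega
      · simp [Coll]
      · simp [Coll, hij]
    refine ⟨h1, ?_⟩
    rw [← h1, card_pos]
    obtain ⟨k, hk1, hk2, hk⟩ := hSG i j hij
    exact ⟨k, by simp [Coll, hij, hk1.symm, hk2.symm, hk]⟩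
  let w : ι → ι → ι → ℝ := fun i j k => if Coll i j k then (r i j : ℝ)⁻¹ else 0
  have hwC : ∀ i j k, w i j k ≠ 0 → Coll i j k := fun i j k h => by
    by_contra hc
    exact h (if_neg hc)
  choose α β hα hβ hαβ using hcoef
  let a : ι → ι → ι → ι → ℂ := fun i j k l =>
    if h : Coll i j k then
      if l = i then α i j k h else if l = j then β i j k h else if l = k then -1 else 0
    else 1
  refine finrank_span_le_of_triples v hcard w a ?_ ?_ ?_ ?_ ?_ ?_ ?_ ?_
  · intro i j k
    simp only [w]
    split_ifs <;> positivity
  · intro i j k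
    by_cases h : Coll i j k
    · have h1 := h.1.symm
      have h2 := h.2.1.symm
      have h3 := h.2.2.1.symm
      simp [a, h, h1, h2, h3, hα, hβ]
    · simp [a, h]
  · intro i j k h
    exact ⟨(hwC i j k h).1, (hwC i j k h).2.1, (hwC i j k h).2.2.1⟩
  · intro i j k l h h1 h2 h3
    simp [a, hwC i j k h, h1, h2, h3]
  · intro i j k h
    have hc := hwC i j k h
    have e : ∀ l, a i j k l • v l = (if l = i then α i j k hc • v i else 0) +
        (if l = j then β i j k hc • v j else 0) + (if l = k then - v k else 0) := by
      intro l
      have h1 := hc.1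
      have h2 := hc.2.1
      have h3 := hc.2.2.1
      have h1' := hc.1.symm
      have h2' := hc.2.1.symm
      have h3' := hc.2.2.1.symm
      by_cases e1 : l = i
      · subst e1; simp [a, hc, h1, h3]
      by_cases e2 : l = j
      · subst e2; simp [a, hc, h1', h2]
      by_cases e3 : l = k
      · subst e3; simp [a, hc, h2', h3']
      simp [a, hc, e1, e2, e3]
    simp_rw [e, sum_add_distrib]
    simp [hαβ]
  · intro i j hij
    have h := hr i j hij
    simp only [w]
    rw [← sum_filter, sum_const, nsmul_eq_mul, h.1]
    exact mul_inv_cancel₀ (by exact_mod_cast h.2.ne')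
  · intro i j k
    have h1 : Coll i j k ↔ Coll j i k := ⟨hC1 i j k, hC1 j i k⟩
    have h2 : r i j = r j i := by simp only [r, hspan1 i j]
    simp only [w, h1, h2]
  · intro i j k
    have h1 : Coll i j k ↔ Coll i k j := ⟨hC2 i j k, hC2 i k j⟩
    by_cases h : Coll i j k
    · have h2 : r i j = r i k := by simp only [r, hspan2 i j k h]
      simp only [w, h1, h2]
    · simp [w, h, (not_congr h1).1 h]

/-- Complex Sylvester–Gallai theorem: a finite family of nonzero vectors, in which the plane
spanned by any two non-parallel members contains a member parallel to neither of them, spans a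
space of bounded dimension. -/
theorem finrank_span_le_of_sylvesterGallai {ι W : Type*} [Finite ι]
    [AddCommGroup W] [Module ℂ W] (v : ι → W) (h0 : ∀ i, v i ≠ 0)
    (hSG : ∀ i j, Submodule.span ℂ {v i} ≠ Submodule.span ℂ {v j} →
      ∃ k, Submodule.span ℂ {v k} ≠ Submodule.span ℂ {v i} ∧
        Submodule.span ℂ {v k} ≠ Submodule.span ℂ {v j} ∧ v k ∈ Submodule.span ℂ {v i, v j}) :
    Module.finrank ℂ (Submodule.span ℂ (Set.range v)) ≤ 12 := by
  classical
  let L : Set (Submodule ℂ W) := Set.range fun i => Submodule.span ℂ {v i}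
  have : Finite L := Set.finite_range _
  have := Fintype.ofFinite L
  choose g hg using fun q : L => q.2
  have hg' : ∀ q : L, Submodule.span ℂ {v (g q)} = q := fun q => hg q
  have hind : ∀ i j, Submodule.span ℂ {v i} ≠ Submodule.span ℂ {v j} →
      LinearIndependent ℂ ![v i, v j] := by
    intro i j hij
    rw [LinearIndependent.pair_iff' (h0 i)]
    rintro s hs'
    apply hij
    have hs : s ≠ 0 := by
      rintro rfl
      exact h0 j (by simpa using hs'.symm)
    rw [← hs', Submodule.span_singleton_smul_eq (IsUnit.mk0 s hs)]
  have hmain := finrank_span_le_of_sylvesterGallai_pairwise (fun q : L => v (g q))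
    (fun q q' h => hind _ _ (by rw [hg', hg']; exact fun h' => h (Subtype.ext h')))
    (by
      intro q q' h
      obtain ⟨k, h1, h2, h3⟩ := hSG (g q) (g q')
        (by rw [hg', hg']; exact fun h' => h (Subtype.ext h'))
      refine ⟨⟨_, k, rfl⟩, ?_, ?_, ?_⟩
      · rintro rfl; exact h1 (by rw [hg'])
      · rintro rfl; exact h2 (by rw [hg'])
      · have : v (g ⟨_, k, rfl⟩) ∈ Submodule.span ℂ {v k} := by
          have := hg' ⟨_, k, rfl⟩
          simp only at this
          rw [← this]
          exact Submodule.mem_span_singleton_self _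
        exact (Submodule.span_le.2 (by simpa using h3) :
          Submodule.span ℂ {v k} ≤ Submodule.span ℂ {v (g q), v (g q')}) this)
  have := FiniteDimensional.span_of_finite ℂ (Set.finite_range fun q : L => v (g q))
  refine le_trans (Submodule.finrank_mono ?_) hmain
  rw [Submodule.span_le]
  rintro _ ⟨i, rfl⟩
  have h1 : v i ∈ Submodule.span ℂ {v (g ⟨_, i, rfl⟩)} := by
    rw [hg']
    exact Submodule.mem_span_singleton_self _
  exact Submodule.span_mono (by rintro _ rfl; exact ⟨_, rfl⟩) h1

section QuadraticBasics

variable {V : Type*} [AddCommGroup V] [Module ℂ V]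

/-- A quadratic form that is a product of two linear forms. -/
def IsProdForm (Q : QuadraticForm ℂ V) : Prop :=
  ∃ a b : Dual ℂ V, ∀ p, Q p = a p * b p

/-- The radical of a quadratic form. -/
def qrad (Q : QuadraticForm ℂ V) : Submodule ℂ V := LinearMap.ker Q.polarBilin

lemma qform_add (Q : QuadraticForm ℂ V) (x y : V) :
    Q (x + y) = Q x + Q y + Q.polarBilin x y := by
  rw [QuadraticMap.polarBilin_apply_apply, QuadraticMap.polar]
  ring

lemma polarBilin_self (Q : QuadraticForm ℂ V) (x : V) : Q.polarBilin x x = 2 * Q x := by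
  rw [QuadraticMap.polarBilin_apply_apply, QuadraticMap.polar_self]
  simp

lemma polarBilin_comm (Q : QuadraticForm ℂ V) (x y : V) :
    Q.polarBilin x y = Q.polarBilin y x := by
  simp only [QuadraticMap.polarBilin_apply_apply]
  exact QuadraticMap.polar_comm Q x y

lemma qform_smul (Q : QuadraticForm ℂ V) (t : ℂ) (x : V) : Q (t • x) = t ^ 2 * Q x := by
  rw [QuadraticMap.map_smul, smul_eq_mul, sq]

lemma polarBilin_eq_of_eq_sum {ι : Type*} [Fintype ι] {Q : QuadraticForm ℂ V}
    {e f : ι → Dual ℂ V} (h : ∀ p, Q p = ∑ i, e i p * f i p) (x y : V) :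
    Q.polarBilin x y = ∑ i, (e i x * f i y + e i y * f i x) := by
  rw [QuadraticMap.polarBilin_apply_apply, QuadraticMap.polar, h, h, h]
  rw [← Finset.sum_sub_distrib, ← Finset.sum_sub_distrib]
  refine Finset.sum_congr rfl fun i _ => ?_
  simp only [map_add]
  ring

lemma polarBilin_eq_of_eq_mul_add_mul {Q : QuadraticForm ℂ V} {a b c d : Dual ℂ V}
    (h : ∀ p, Q p = a p * b p + c p * d p) (x y : V) :
    Q.polarBilin x y = a x * b y + a y * b x + (c x * d y + c y * d x) := by
  rw [QuadraticMap.polarBilin_apply_apply, QuadraticMap.polar, h, h, h]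
  simp only [map_add]
  ring

lemma mem_qrad {Q : QuadraticForm ℂ V} {v : V} : v ∈ qrad Q ↔ ∀ w, Q.polarBilin v w = 0 := by
  rw [qrad, LinearMap.mem_ker]
  exact ⟨fun h w => by rw [h]; rfl, fun h => LinearMap.ext h⟩

lemma qform_eq_zero_of_mem_qrad {Q : QuadraticForm ℂ V} {v : V} (h : v ∈ qrad Q) : Q v = 0 := by
  have := mem_qrad.1 h v
  rw [polarBilin_self] at this
  simpa using this

lemma qform_add_of_mem_qrad {Q : QuadraticForm ℂ V} {v : V} (h : v ∈ qrad Q) (p : V) :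
    Q (p + v) = Q p := by
  rw [qform_add, qform_eq_zero_of_mem_qrad h, polarBilin_comm, mem_qrad.1 h]
  ring

lemma mem_qrad_of_forall_add {Q : QuadraticForm ℂ V} {v : V} (h : ∀ p, Q (p + v) = Q p) :
    v ∈ qrad Q := by
  rw [mem_qrad]
  intro w
  have h1 := h w
  have h2 := h 0
  rw [qform_add] at h1
  rw [zero_add, QuadraticMap.map_zero] at h2
  rw [polarBilin_comm]
  linear_combination h1 - h2

/-- A quadratic form vanishing on the common kernel of some linear forms lies in the ideal
generated by them. -/
lemma exists_eq_sum_of_vanish {ι : Type*} [Fintype ι] (Q : QuadraticForm ℂ V)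
    (e : ι → Dual ℂ V) (h : ∀ p, (∀ i, e i p = 0) → Q p = 0) :
    ∃ f : ι → Dual ℂ V, ∀ p, Q p = ∑ i, e i p * f i p := by
  classical
  obtain ⟨g, hg⟩ : ∃ g : (ι → ℂ) →ₗ[ℂ] V, ∀ p, LinearMap.pi e (g (LinearMap.pi e p)) =
      LinearMap.pi e p := by
    obtain ⟨s, hs⟩ := (LinearMap.pi e).rangeRestrict.exists_rightInverse_of_surjective
      (LinearMap.range_rangeRestrict _)
    obtain ⟨s', hs'⟩ := LinearMap.exists_extend s
    refine ⟨s', fun p => ?_⟩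
    have h1 : s' (LinearMap.pi e p) = s ((LinearMap.pi e).rangeRestrict p) := by
      rw [← hs']; rfl
    have h2 := LinearMap.congr_fun hs ((LinearMap.pi e).rangeRestrict p)
    rw [h1]
    exact congrArg Subtype.val h2
  set P : V →ₗ[ℂ] V := g ∘ₗ LinearMap.pi e with hP
  refine ⟨fun i => (Q.polarBilin (g (Pi.single i 1))) ∘ₗ (LinearMap.id - (2⁻¹ : ℂ) • P),
    fun p => ?_⟩
  have hker : Q (p - P p) = 0 := by
    apply h
    intro i
    have := congrFun (hg p) i
    simp only [LinearMap.pi_apply] at this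
    simp only [map_sub, hP, LinearMap.comp_apply]
    rw [this, sub_self]
  have hPp : ∀ x, Q.polarBilin (P p) x = ∑ i, e i p * Q.polarBilin (g (Pi.single i 1)) x := by
    intro x
    have : P p = ∑ i, e i p • g (Pi.single i 1) := by
      simp only [hP, LinearMap.comp_apply, ← map_smul, ← map_sum]
      congr 1
      ext j
      simp [Finset.sum_apply, Pi.single_apply]
    rw [this]
    simp
  have h1 := qform_add Q (p - P p) (P p)
  rw [sub_add_cancel, hker, map_sub, LinearMap.sub_apply, polarBilin_comm Q p,
    polarBilin_self] at h1
  have h2 := polarBilin_self Q (P p)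
  have h3 : ∑ i, e i p * ((Q.polarBilin (g (Pi.single i 1))) ∘ₗ
      (LinearMap.id - (2⁻¹ : ℂ) • P)) p =
        Q.polarBilin (P p) p - 2⁻¹ * Q.polarBilin (P p) (P p) := by
    rw [hPp p, hPp (P p), Finset.mul_sum, ← Finset.sum_sub_distrib]
    refine Finset.sum_congr rfl fun i _ => ?_
    simp
    ring
  rw [h3, h2, h1]
  ring

lemma exists_eq_mul_of_vanish (Q : QuadraticForm ℂ V) (l : Dual ℂ V)
    (h : ∀ p, l p = 0 → Q p = 0) : ∃ m : Dual ℂ V, ∀ p, Q p = l p * m p := by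
  obtain ⟨f, hf⟩ := exists_eq_sum_of_vanish Q (fun _ : Unit => l) (fun p hp => h p (hp ()))
  exact ⟨f (), fun p => by rw [hf p]; simp⟩

lemma exists_eq_mul_add_mul_of_vanish (Q : QuadraticForm ℂ V) (c d : Dual ℂ V)
    (h : ∀ p, c p = 0 → d p = 0 → Q p = 0) :
    ∃ e f : Dual ℂ V, ∀ p, Q p = c p * e p + d p * f p := by
  obtain ⟨f, hf⟩ := exists_eq_sum_of_vanish Q ![c, d] (fun p hp => h p (hp 0) (hp 1))
  exact ⟨f 0, f 1, fun p => by rw [hf p]; simp [Fin.sum_univ_two]⟩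

lemma qform_eq_zero_on_of_mul_eq_zero {Q : QuadraticForm ℂ V} {S : Submodule ℂ V}
    {f : Dual ℂ V} (h : ∀ p ∈ S, f p * Q p = 0) {u : V} (hu : u ∈ S) (hfu : f u ≠ 0) :
    ∀ p ∈ S, Q p = 0 := by
  intro p hp
  by_cases hfp : f p = 0
  · have hQu : Q u = 0 := (mul_eq_zero.1 (h u hu)).resolve_left hfu
    have h1 : Q (p + u) = 0 := (mul_eq_zero.1 (h _ (S.add_mem hp hu))).resolve_left
      (by simp [hfp, hfu])
    have h2 : Q (p + (-1 : ℂ) • u) = 0 :=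
      (mul_eq_zero.1 (h _ (S.add_mem hp (S.smul_mem _ hu)))).resolve_left (by simp [hfp, hfu])
    rw [qform_add] at h1 h2
    rw [qform_smul, map_smul, smul_eq_mul] at h2
    linear_combination (h1 + h2) / 2 - hQu
  · exact (mul_eq_zero.1 (h p hp)).resolve_left hfp

lemma dual_eq_zero_on_of_mul_eq_zero {S : Submodule ℂ V} {f g : Dual ℂ V}
    (h : ∀ p ∈ S, f p * g p = 0) : (∀ p ∈ S, f p = 0) ∨ ∀ p ∈ S, g p = 0 := by
  by_contra! hc
  obtain ⟨⟨u, hu, hfu⟩, w, hw, hgw⟩ := hc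
  have h1 : g u = 0 := (mul_eq_zero.1 (h u hu)).resolve_left hfu
  have h2 : f w = 0 := (mul_eq_zero.1 (h w hw)).resolve_right hgw
  have h3 := h _ (S.add_mem hu hw)
  simp [h1, h2, hfu, hgw] at h3

/-- Two linear forms are either dependent on a subspace, or have dual vectors in it. -/
lemma dependent_or_exists_dual (S : Submodule ℂ V) (c d : Dual ℂ V) :
    (∃ e : Dual ℂ V, ∀ p ∈ S, e p = 0 → c p = 0 ∧ d p = 0) ∨
    ∃ x ∈ S, ∃ y ∈ S, c x = 1 ∧ d x = 0 ∧ c y = 0 ∧ d y = 1 := by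
  by_cases h1 : ∀ p ∈ S, c p = 0 → d p = 0
  · exact Or.inl ⟨c, fun p hp h => ⟨h, h1 p hp h⟩⟩
  by_cases h2 : ∀ p ∈ S, d p = 0 → c p = 0
  · exact Or.inl ⟨d, fun p hp h => ⟨h2 p hp h, h⟩⟩
  push Not at h1 h2
  obtain ⟨y, hy, hcy, hdy⟩ := h1
  obtain ⟨x, hx, hdx, hcx⟩ := h2
  exact Or.inr ⟨(c x)⁻¹ • x, S.smul_mem _ hx, (d y)⁻¹ • y, S.smul_mem _ hy, by simp [hcx],
    by simp [hdx], by simp [hcy], by simp [hdy]⟩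

lemma exists_binary_factorization (α β γ : ℂ) :
    ∃ a b c d : ℂ, ∀ x y : ℂ, α * x ^ 2 + β * (x * y) + γ * y ^ 2 =
      (a * x + b * y) * (c * x + d * y) := by
  by_cases hα : α = 0
  · exact ⟨0, 1, β, γ, fun x y => by rw [hα]; ring⟩
  obtain ⟨δ, hδ⟩ := IsAlgClosed.exists_pow_nat_eq (β ^ 2 - 4 * α * γ) (n := 2) (by norm_num)
  refine ⟨α, (β - δ) / 2, 1, (β + δ) / (2 * α), fun x y => ?_⟩
  field_simp
  linear_combination y ^ 2 * hδ

lemma qform_pair (Q : QuadraticForm ℂ V) (u w : V) (x y : ℂ) :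
    Q (x • u + y • w) = Q u * x ^ 2 + Q.polarBilin u w * (x * y) + Q w * y ^ 2 := by
  rw [qform_add, qform_smul, qform_smul]
  simp only [map_smul, LinearMap.smul_apply, smul_eq_mul]
  ring

lemma exists_isotropic_pair (Q : QuadraticForm ℂ V) (u w : V) :
    ∃ x y : ℂ, (x ≠ 0 ∨ y ≠ 0) ∧ Q (x • u + y • w) = 0 := by
  obtain ⟨a, b, c, d, h⟩ := exists_binary_factorization (Q u) (Q.polarBilin u w) (Q w)
  simp_rw [qform_pair, h]
  by_cases ha : a = 0
  · by_cases hb : b = 0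
    · exact ⟨1, 0, by simp, by simp [ha, hb]⟩
    · exact ⟨b, -a, by simp [hb], by ring⟩
  · exact ⟨b, -a, by simp [ha], by ring⟩

/-- If `ab + cd` is not a product, its radical is contained in the common kernel of
`a, b, c, d`. -/
lemma apply_eq_zero_of_mem_qrad {F : QuadraticForm ℂ V} (hF : ¬ IsProdForm F)
    {a b c d : Dual ℂ V} (h : ∀ p, F p = a p * b p + c p * d p) {v : V} (hv : v ∈ qrad F) :
    a v = 0 ∧ b v = 0 ∧ c v = 0 ∧ d v = 0 := by
  have key : ∀ a b c d : Dual ℂ V, (∀ p, F p = a p * b p + c p * d p) → a v = 0 := by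
    intro a b c d h
    by_contra ha
    apply hF
    have h0 : a v * b v + c v * d v = 0 := by rw [← h, qform_eq_zero_of_mem_qrad hv]
    refine ⟨(a v)⁻¹ • (a v • c - c v • a), (a v)⁻¹ • (a v • d - d v • a), fun p => ?_⟩
    have h1 := mem_qrad.1 hv p
    rw [polarBilin_eq_of_eq_mul_add_mul h] at h1
    rw [h]
    simp only [LinearMap.smul_apply, LinearMap.sub_apply, smul_eq_mul]
    field_simp
    linear_combination (a v) * (a p) * h1 - (a p) ^ 2 * h0
  refine ⟨key a b c d h, key b a c d fun p => ?_, key c d a b fun p => ?_, key d c a b fun p => ?_⟩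
  all_goals rw [h]; ring

lemma mul_eq_mul_of_polar_eq {K : Submodule ℂ V} {c d c' d' : Dual ℂ V} {x y : V} (hx : x ∈ K)
    (hy : y ∈ K) (hcx : c x = 1) (hdx : d x = 0) (hcy : c y = 0) (hdy : d y = 1)
    (h : ∀ v ∈ K, ∀ p, c v * d p + c p * d v = c' v * d' p + c' p * d' v) (p : V) :
    c p * d p = c' p * d' p := by
  have h1 := h x hx p
  have h2 := h y hy p
  have h3 := h x hx x
  have h4 := h y hy y
  have h5 := h x hx y
  rw [hcx, hdx] at h1 h3 h5
  rw [hcy, hdy] at h2 h4 h5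
  have h3' : c' x * d' x = 0 := by linear_combination -h3 / 2
  rcases mul_eq_zero.1 h3' with h0 | h0
  · rw [h0] at h1 h5
    have h6 : c' y * d' x = 1 := by linear_combination -h5
    have h7 : d' y = 0 := by
      have : c' y * d' y = 0 := by linear_combination -h4 / 2
      rcases mul_eq_zero.1 this with h | h
      · rw [h] at h6; simp at h6
      · exact h
    rw [h7] at h2
    have e1 : d p = c' p * d' x := by linear_combination h1
    have e2 : c p = c' y * d' p := by linear_combination h2
    rw [e1, e2]
    linear_combination c' p * d' p * h6
  · rw [h0] at h1 h5
    have h6 : c' x * d' y = 1 := by linear_combination -h5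
    have h7 : c' y = 0 := by
      have : c' y * d' y = 0 := by linear_combination -h4 / 2
      rcases mul_eq_zero.1 this with h | h
      · exact h
      · rw [h] at h6; simp at h6
    rw [h7] at h2
    have e1 : d p = c' x * d' p := by linear_combination h1
    have e2 : c p = c' p * d' y := by linear_combination h2
    rw [e1, e2]
    linear_combination c' p * d' p * h6

end QuadraticBasics

section Codim

variable {V : Type*} [AddCommGroup V] [Module ℂ V] [FiniteDimensional ℂ V]

/-- The codimension of a subspace. -/
noncomputable def codim (S : Submodule ℂ V) : ℕ := finrank ℂ (V ⧸ S)

lemma codim_add_finrank (S : Submodule ℂ V) : codim S + finrank ℂ S = finrank ℂ V :=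
  S.finrank_quotient_add_finrank

lemma codim_anti {S T : Submodule ℂ V} (h : S ≤ T) : codim T ≤ codim S := by
  have := codim_add_finrank S
  have := codim_add_finrank T
  have := Submodule.finrank_mono h
  omega

lemma codim_inf_le (S T : Submodule ℂ V) : codim (S ⊓ T) ≤ codim S + codim T := by
  have h1 := codim_add_finrank S
  have h2 := codim_add_finrank T
  have h3 := codim_add_finrank (S ⊓ T)
  have h4 := Submodule.finrank_sup_add_finrank_inf_eq S T
  have h5 := Submodule.finrank_le (S ⊔ T)
  omega

lemma codim_ker_pi_le {ι : Type*} [Fintype ι] (e : ι → Dual ℂ V) :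
    codim (LinearMap.ker (LinearMap.pi e)) ≤ Fintype.card ι := by
  have h1 := LinearMap.finrank_range_add_finrank_ker (LinearMap.pi e)
  have h2 := codim_add_finrank (LinearMap.ker (LinearMap.pi e))
  have h3 := Submodule.finrank_le (LinearMap.range (LinearMap.pi e))
  rw [finrank_fintype_fun_eq_card] at h3
  omega

lemma codim_le_of_forall {ι : Type*} [Fintype ι] {S : Submodule ℂ V} (e : ι → Dual ℂ V)
    (h : ∀ p, (∀ i, e i p = 0) → p ∈ S) : codim S ≤ Fintype.card ι :=
  (codim_anti fun p hp => h p fun i => congrFun (LinearMap.mem_ker.1 hp) i).trans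
    (codim_ker_pi_le e)

lemma codim_ker_le_one (e : Dual ℂ V) : codim (LinearMap.ker e) ≤ 1 := by
  simpa using codim_le_of_forall (S := LinearMap.ker e) (fun _ : Unit => e) (fun p hp => hp ())

lemma exists_forms_of_codim_le (S : Submodule ℂ V) {M : ℕ} (h : codim S ≤ M) :
    ∃ e : Fin M → Dual ℂ V, ∀ p, p ∈ S ↔ ∀ i, e i p = 0 := by
  let b := finBasis ℂ (V ⧸ S)
  refine ⟨fun i => if hi : (i : ℕ) < finrank ℂ (V ⧸ S) then (b.coord ⟨i, hi⟩) ∘ₗ S.mkQ else 0,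
    fun p => ⟨fun hp i => ?_, fun hp => ?_⟩⟩
  · have : S.mkQ p = 0 := by simpa using hp
    dsimp only
    split_ifs
    · rw [LinearMap.comp_apply, this, map_zero]
    · rfl
  · rw [← Submodule.Quotient.mk_eq_zero]
    rw [← b.forall_coord_eq_zero_iff]
    intro i
    have := hp ⟨i, i.2.trans_le h⟩
    simpa using this

lemma codim_qrad_le_of_eq_sum {ι : Type*} [Fintype ι] {Q : QuadraticForm ℂ V}
    {e f : ι → Dual ℂ V} (h : ∀ p, Q p = ∑ i, e i p * f i p) :
    codim (qrad Q) ≤ 2 * Fintype.card ι := by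
  have := codim_le_of_forall (S := qrad Q) (Sum.elim e f) (fun p hp => by
    rw [mem_qrad]
    intro w
    rw [polarBilin_eq_of_eq_sum h]
    refine Finset.sum_eq_zero fun i _ => ?_
    have h1 := hp (Sum.inl i)
    have h2 := hp (Sum.inr i)
    simp only [Sum.elim_inl, Sum.elim_inr] at h1 h2
    rw [h1, h2]; ring)
  rw [Fintype.card_sum] at this
  omega

/-- A form vanishing on a subspace of codimension `M` has rank at most `2M`. -/
lemma codim_qrad_le_of_vanish {Q : QuadraticForm ℂ V} {S : Submodule ℂ V}
    (h : ∀ p ∈ S, Q p = 0) : codim (qrad Q) ≤ 2 * codim S := by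
  obtain ⟨e, he⟩ := exists_forms_of_codim_le S le_rfl
  obtain ⟨f, hf⟩ := exists_eq_sum_of_vanish Q e (fun p hp => h p ((he p).2 hp))
  simpa using codim_qrad_le_of_eq_sum hf

lemma isProdForm_of_codim_qrad_le {Q : QuadraticForm ℂ V} (h : codim (qrad Q) ≤ 2) :
    IsProdForm Q := by
  obtain ⟨e, he⟩ := exists_forms_of_codim_le (qrad Q) h
  by_cases h1 : ∀ p, e 0 p = 0 → e 1 p = 0
  · obtain ⟨m, hm⟩ := exists_eq_mul_of_vanish Q (e 0) (fun p hp =>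
      qform_eq_zero_of_mem_qrad ((he p).2 (by
        intro i; fin_cases i
        exacts [hp, h1 p hp])))
    exact ⟨_, _, hm⟩
  by_cases h2 : ∀ p, e 1 p = 0 → e 0 p = 0
  · obtain ⟨m, hm⟩ := exists_eq_mul_of_vanish Q (e 1) (fun p hp =>
      qform_eq_zero_of_mem_qrad ((he p).2 (by
        intro i; fin_cases i
        exacts [h2 p hp, hp])))
    exact ⟨_, _, hm⟩
  rcases dependent_or_exists_dual ⊤ (e 0) (e 1) with ⟨f, hf⟩ | ⟨x, -, y, -, hx0, hx1, hy0, hy1⟩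
  · obtain ⟨m, hm⟩ := exists_eq_mul_of_vanish Q f (fun p hp =>
      qform_eq_zero_of_mem_qrad ((he p).2 (by
        intro i; fin_cases i
        exacts [(hf p trivial hp).1, (hf p trivial hp).2])))
    exact ⟨_, _, hm⟩
  obtain ⟨a, b, c, d, hf⟩ := exists_binary_factorization (Q x) (Q.polarBilin x y) (Q y)
  refine ⟨a • e 0 + b • e 1, c • e 0 + d • e 1, fun p => ?_⟩
  have hr : p - (e 0 p • x + e 1 p • y) ∈ qrad Q := by
    rw [he]
    intro i
    fin_cases i
    · simp [hx0, hy0]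
    · simp [hx1, hy1]
  have h3 := qform_add_of_mem_qrad hr (e 0 p • x + e 1 p • y)
  rw [add_sub_cancel, qform_pair, hf] at h3
  simpa using h3

end Codim

section PolynomialForms

variable {n : ℕ}

/-- The polynomial of a linear form. -/
noncomputable def lpoly (a : Dual ℂ (Fin n → ℂ)) : MvPolynomial (Fin n) ℂ :=
  ∑ i, C (a (Pi.single i 1)) * X i

/-- The polynomial of a quadratic form. -/
noncomputable def qpoly (Q : QuadraticForm ℂ (Fin n → ℂ)) : MvPolynomial (Fin n) ℂ :=
  ∑ i, ∑ j, C (2⁻¹ * Q.polarBilin (Pi.single i 1) (Pi.single j 1)) * (X i * X j)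

lemma eval_lpoly (a : Dual ℂ (Fin n → ℂ)) (p : Fin n → ℂ) : eval p (lpoly a) = a p := by
  conv_rhs => rw [pi_eq_sum_univ' p]
  simp [lpoly, mul_comm]

lemma eval_qpoly (Q : QuadraticForm ℂ (Fin n → ℂ)) (p : Fin n → ℂ) :
    eval p (qpoly Q) = Q p := by
  have h := polarBilin_self Q p
  conv_lhs at h => rw [pi_eq_sum_univ' p]
  have h2 : Q p = 2⁻¹ * (2 * Q p) := by ring
  rw [h2, ← h]
  simp only [qpoly, map_sum, map_mul, eval_C, eval_X, LinearMap.sum_apply, map_smul,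
    LinearMap.smul_apply, smul_eq_mul, Finset.mul_sum]
  rw [Finset.sum_comm]
  refine Finset.sum_congr rfl fun i _ => Finset.sum_congr rfl fun j _ => ?_
  ring

lemma isHomogeneous_lpoly (a : Dual ℂ (Fin n → ℂ)) : (lpoly a).IsHomogeneous 1 :=
  IsHomogeneous.sum _ _ _ fun i _ => isHomogeneous_C_mul_X _ i

lemma isHomogeneous_qpoly (Q : QuadraticForm ℂ (Fin n → ℂ)) : (qpoly Q).IsHomogeneous 2 :=
  IsHomogeneous.sum _ _ _ fun i _ => IsHomogeneous.sum _ _ _ fun j _ =>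
    ((isHomogeneous_X ℂ i).mul (isHomogeneous_X ℂ j)).C_mul _

lemma exists_eq_lpoly {l : MvPolynomial (Fin n) ℂ} (h : l.IsHomogeneous 1) :
    ∃ a : Dual ℂ (Fin n → ℂ), l = lpoly a := by
  have h0 : ∀ i, ∃ c : ℂ, pderiv i l = C c := fun i => by
    have := h.pderiv (i := i)
    exact ⟨_, totalDegree_eq_zero_iff_eq_C.1 ((totalDegree_zero_iff_isHomogeneous _).2 this)⟩
  choose c hc using h0
  have h1 := h.sum_X_mul_pderiv
  rw [one_smul] at h1
  refine ⟨∑ i, c i • LinearMap.proj i, MvPolynomial.funext fun p => ?_⟩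
  rw [eval_lpoly, ← h1]
  simp [hc, mul_comm]

lemma exists_eq_qpoly {P : MvPolynomial (Fin n) ℂ} (h : P.IsHomogeneous 2) :
    ∃ Q : QuadraticForm ℂ (Fin n → ℂ), P = qpoly Q := by
  have h0 : ∀ i, ∃ a : Dual ℂ (Fin n → ℂ), pderiv i P = lpoly a := fun i =>
    exists_eq_lpoly (h.pderiv (i := i))
  choose a ha using h0
  have h1 := h.sum_X_mul_pderiv
  refine ⟨(2⁻¹ : ℂ) • ∑ i, QuadraticMap.linMulLin (LinearMap.proj i) (a i),
    MvPolynomial.funext fun p => ?_⟩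
  have h2 := congrArg (eval p) h1
  rw [eval_qpoly]
  simp only [map_sum, map_mul, eval_X, ha, eval_lpoly, nsmul_eq_mul, Nat.cast_ofNat] at h2
  rw [map_ofNat] at h2
  simp only [_root_.smul_apply, _root_.sum_apply, QuadraticMap.linMulLin_apply,
    LinearMap.proj_apply, h2, smul_eq_mul]
  ring

lemma qpoly_eq_lpoly_mul_lpoly {Q : QuadraticForm ℂ (Fin n → ℂ)} {a b : Dual ℂ (Fin n → ℂ)}
    (h : ∀ p, Q p = a p * b p) : qpoly Q = lpoly a * lpoly b :=
  MvPolynomial.funext fun p => by rw [map_mul, eval_qpoly, eval_lpoly, eval_lpoly, h]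

lemma homogeneousComponent_add_mul {f g : MvPolynomial (Fin n) ℂ} {i j : ℕ}
    (hf : f.totalDegree ≤ i) (hg : g.totalDegree ≤ j) :
    homogeneousComponent (i + j) (f * g) = homogeneousComponent i f * homogeneousComponent j g := by
  have e1 : ∑ k ∈ Finset.range (i + 1), homogeneousComponent k f = f := by
    conv_rhs => rw [← sum_homogeneousComponent f]
    refine (Finset.sum_subset (Finset.range_mono (by omega)) fun k _ hk => ?_).symm
    exact homogeneousComponent_eq_zero _ _ (by simp at hk; omega)
  have e2 : ∑ k ∈ Finset.range (j + 1), homogeneousComponent k g = g := by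
    conv_rhs => rw [← sum_homogeneousComponent g]
    refine (Finset.sum_subset (Finset.range_mono (by omega)) fun k _ hk => ?_).symm
    exact homogeneousComponent_eq_zero _ _ (by simp at hk; omega)
  conv_lhs => rw [← e1, ← e2, Finset.sum_mul_sum, map_sum]
  have key : ∀ k l, homogeneousComponent (i + j)
      (homogeneousComponent k f * homogeneousComponent l g) =
      if i + j = k + l then homogeneousComponent k f * homogeneousComponent l g else 0 :=
    fun k l => homogeneousComponent_of_mem
      ((homogeneousComponent_isHomogeneous k f).mul (homogeneousComponent_isHomogeneous l g))
  rw [Finset.sum_eq_single i, map_sum, Finset.sum_eq_single j]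
  · rw [key, if_pos rfl]
  · intro l _ hl
    rw [key, if_neg (by omega)]
  · intro h; simp at h
  · intro k hk hki
    rw [map_sum]
    refine Finset.sum_eq_zero fun l hl => ?_
    simp at hk hl
    rw [key, if_neg (by omega)]
  · intro h; simp at h

lemma exists_isHomogeneous_factor {F G g : MvPolynomial (Fin n) ℂ} {i j : ℕ}
    (hF : F.IsHomogeneous i) (hF0 : F ≠ 0) (hG : G.IsHomogeneous (i + j)) (h : G = F * g) :
    ∃ g' : MvPolynomial (Fin n) ℂ, g'.IsHomogeneous j ∧ G = F * g' := by
  by_cases hg : g = 0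
  · exact ⟨0, isHomogeneous_zero _ _ _, by rw [h, hg]⟩
  have hd : (F * g).totalDegree = i + j := by
    rw [← h]
    exact hG.totalDegree (by rw [h]; exact mul_ne_zero hF0 hg)
  rw [totalDegree_mul_of_isDomain hF0 hg, hF.totalDegree hF0] at hd
  refine ⟨homogeneousComponent j g, homogeneousComponent_isHomogeneous _ _, ?_⟩
  have := homogeneousComponent_add_mul (f := F) (g := g) (i := i) (j := j)
    (hF.totalDegree hF0).le (by omega)
  rwa [← h, homogeneousComponent_eq_self hG, homogeneousComponent_eq_self hF] at this

/-- A nonzero form of degree two or three without linear factor is irreducible. -/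
lemma irreducible_of_forall_ne_mul {F : MvPolynomial (Fin n) ℂ} {d : ℕ}
    (hd : d = 1 ∨ d = 2)
    (hF : F.IsHomogeneous (1 + d)) (hF0 : F ≠ 0)
    (h : ∀ f g : MvPolynomial (Fin n) ℂ, f.IsHomogeneous 1 → g.IsHomogeneous d → F ≠ f * g) :
    Irreducible F := by
  have hunit : ∀ f : MvPolynomial (Fin n) ℂ, f ≠ 0 → f.totalDegree = 0 → IsUnit f := by
    intro f hf hf0
    rw [totalDegree_eq_zero_iff_eq_C] at hf0
    rw [hf0]
    refine (isUnit_iff_ne_zero.2 fun hc => hf ?_).map C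
    rw [hf0, hc, map_zero]
  have key : ∀ f g : MvPolynomial (Fin n) ℂ, F = f * g → f.totalDegree = 1 →
      g.totalDegree = d → False := by
    intro f g hfg hf hg
    have := homogeneousComponent_add_mul hf.le hg.le
    rw [← hfg, homogeneousComponent_eq_self hF] at this
    exact h _ _ (homogeneousComponent_isHomogeneous _ _) (homogeneousComponent_isHomogeneous _ _)
      this
  refine ⟨fun hu => ?_, fun f g hfg => ?_⟩
  · have h1 := hF.totalDegree hF0
    rw [MvPolynomial.isUnit_iff_totalDegree_of_isReduced] at hu
    omega
  · have hf : f ≠ 0 := by rintro rfl; simp at hfg; exact hF0 hfg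
    have hg : g ≠ 0 := by rintro rfl; simp at hfg; exact hF0 hfg
    have h1 := hF.totalDegree hF0
    rw [hfg, totalDegree_mul_of_isDomain hf hg] at h1
    by_cases hf0 : f.totalDegree = 0
    · exact Or.inl (hunit f hf hf0)
    by_cases hg0 : g.totalDegree = 0
    · exact Or.inr (hunit g hg hg0)
    exfalso
    by_cases hf1 : f.totalDegree = 1
    · exact key f g hfg hf1 (by omega)
    · exact key g f (by rw [hfg, mul_comm]) (by omega) (by omega)

lemma irreducible_qpoly {Q : QuadraticForm ℂ (Fin n → ℂ)} (h : ¬ IsProdForm Q) :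
    Irreducible (qpoly Q) := by
  refine irreducible_of_forall_ne_mul (d := 1) (Or.inl rfl) (isHomogeneous_qpoly Q) ?_ ?_
  · intro h0
    refine h ⟨0, 0, fun p => ?_⟩
    rw [← eval_qpoly, h0]
    simp
  · intro f g hf hg hfg
    obtain ⟨a, rfl⟩ := exists_eq_lpoly hf
    obtain ⟨b, rfl⟩ := exists_eq_lpoly hg
    exact h ⟨a, b, fun p => by rw [← eval_qpoly, hfg, map_mul, eval_lpoly, eval_lpoly]⟩

lemma not_isProdForm_of_irreducible {Q : QuadraticForm ℂ (Fin n → ℂ)}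
    (h : Irreducible (qpoly Q)) : ¬ IsProdForm Q := by
  rintro ⟨a, b, hab⟩
  have hf := qpoly_eq_lpoly_mul_lpoly hab
  have hu : ∀ c : Dual ℂ (Fin n → ℂ), ¬ IsUnit (lpoly c) := by
    intro c hc
    have h1 := (hc.map (eval (0 : Fin n → ℂ))).ne_zero
    rw [eval_lpoly, map_zero] at h1
    exact h1 rfl
  rcases h.isUnit_or_isUnit hf with h | h
  exacts [hu a h, hu b h]

end PolynomialForms

section Pencil

variable {V : Type*} [AddCommGroup V] [Module ℂ V]

/-- Some nontrivial combination of the two forms is a product of linear forms. -/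
def PencilProd (A B : QuadraticForm ℂ V) : Prop :=
  ∃ α β : ℂ, (α ≠ 0 ∨ β ≠ 0) ∧ IsProdForm (α • A + β • B)

/-- The two forms vanish on the common kernel of two linear forms. -/
def VanishPair (A B : QuadraticForm ℂ V) : Prop :=
  ∃ c d : Dual ℂ V, ∀ p, c p = 0 → d p = 0 → A p = 0 ∧ B p = 0

lemma PencilProd.symm {A B : QuadraticForm ℂ V} (h : PencilProd A B) : PencilProd B A := by
  obtain ⟨α, β, h1, h2⟩ := h
  exact ⟨β, α, h1.symm, by rwa [add_comm]⟩

lemma VanishPair.symm {A B : QuadraticForm ℂ V} (h : VanishPair A B) : VanishPair B A := by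
  obtain ⟨c, d, h⟩ := h
  exact ⟨c, d, fun p hc hd => (h p hc hd).symm⟩

lemma PencilProd.of_left {A B : QuadraticForm ℂ V} (h : IsProdForm A) : PencilProd A B :=
  ⟨1, 0, by simp, by simpa using h⟩

lemma PencilProd.of_vanish {A B : QuadraticForm ℂ V} {α β : ℂ} (h0 : α ≠ 0 ∨ β ≠ 0)
    (l : Dual ℂ V) (h : ∀ p, l p = 0 → α * A p + β * B p = 0) : PencilProd A B := by
  obtain ⟨m, hm⟩ := exists_eq_mul_of_vanish (α • A + β • B) l (fun p hp => by simpa using h p hp)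
  exact ⟨α, β, h0, l, m, hm⟩

lemma qform_mul_qform_eq_zero {A B : QuadraticForm ℂ V} {S : Submodule ℂ V}
    (h : ∀ p ∈ S, A p * B p = 0) : (∀ p ∈ S, A p = 0) ∨ ∀ p ∈ S, B p = 0 := by
  by_contra! hc
  obtain ⟨⟨u, hu, hAu⟩, w, hw, hBw⟩ := hc
  let f : QuadraticForm ℂ V → Polynomial ℂ := fun Q =>
    Polynomial.C (Q u) + Polynomial.C (Q.polarBilin u w) * Polynomial.X +
      Polynomial.C (Q w) * Polynomial.X ^ 2
  have hf : ∀ Q t, (f Q).eval t = Q (u + t • w) := by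
    intro Q t
    have := qform_pair Q u w 1 t
    rw [one_smul] at this
    rw [this]
    simp [f]
  have h0 : f A * f B = 0 := Polynomial.funext fun t => by
    rw [Polynomial.eval_mul, hf, hf, h _ (S.add_mem hu (S.smul_mem _ hw))]
    simp
  rcases mul_eq_zero.1 h0 with h1 | h1
  · apply hAu
    have := hf A 0
    rw [h1] at this
    simpa using this.symm
  · apply hBw
    have := congrArg (fun q => Polynomial.coeff q 2) h1
    simpa [f, Polynomial.coeff_X, Polynomial.coeff_C] using this

/-- A linear syzygy modulo a linear form between two quadratic forms. -/
lemma pencil_of_linear_syzygy {A B : QuadraticForm ℂ V} {l s g : Dual ℂ V}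
    (h : ∀ p, l p = 0 → s p * A p + g p * B p = 0) :
    (∀ p, l p = 0 → s p = 0 ∧ g p = 0) ∨ PencilProd A B ∨ VanishPair A B := by
  have hS : ∀ p, p ∈ LinearMap.ker l ↔ l p = 0 := fun p => LinearMap.mem_ker
  rcases dependent_or_exists_dual (LinearMap.ker l) s g with
    ⟨e, he⟩ | ⟨x, hx, y, hy, hsx, hgx, hsy, hgy⟩
  · by_cases h0 : ∀ p, l p = 0 → e p = 0
    · exact Or.inl fun p hp => he p hp (h0 p hp)
    push Not at h0
    obtain ⟨u, hu, heu⟩ := h0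
    have hprop : ∀ p, l p = 0 → s p = s u / e u * e p ∧ g p = g u / e u * e p := by
      intro p hp
      have h1 := he (p - (e p / e u) • u) (by simp [hS, hu, hp]) (by simp [heu])
      simp only [map_sub, map_smul, smul_eq_mul] at h1
      exact ⟨by linear_combination h1.1, by linear_combination h1.2⟩
    by_cases hz : s u = 0 ∧ g u = 0
    · left
      intro p hp
      have := hprop p hp
      simpa [hz.1, hz.2] using this
    right; left
    have hz' : s u ≠ 0 ∨ g u ≠ 0 := by tauto
    refine PencilProd.of_vanish (α := s u) (β := g u) hz' l fun p hp => ?_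
    have := qform_eq_zero_on_of_mul_eq_zero (Q := s u • A + g u • B) (S := LinearMap.ker l)
      (f := e) (fun p hp => ?_) (u := u) hu heu p hp
    · simpa using this
    · have h1 := h p hp
      obtain ⟨h2, h3⟩ := hprop p hp
      rw [h2, h3] at h1
      field_simp at h1
      simp only [_root_.add_apply, _root_.smul_apply, smul_eq_mul]
      linear_combination h1
  · have hA : ∀ p, l p = 0 → g p = 0 → A p = 0 := by
      intro p hp hgp
      refine qform_eq_zero_on_of_mul_eq_zero (Q := A) (S := LinearMap.ker l ⊓ LinearMap.ker g)
        (f := s) (fun q hq => ?_) (u := x) ⟨hx, hgx⟩ (by simp [hsx]) p ⟨hp, hgp⟩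
      have := h q hq.1
      rwa [show g q = 0 from hq.2, zero_mul, add_zero] at this
    have hB : ∀ p, l p = 0 → s p = 0 → B p = 0 := by
      intro p hp hgp
      refine qform_eq_zero_on_of_mul_eq_zero (Q := B) (S := LinearMap.ker l ⊓ LinearMap.ker s)
        (f := g) (fun q hq => ?_) (u := y) ⟨hy, hsy⟩ (by simp [hgy]) p ⟨hp, hgp⟩
      have := h q hq.1
      rwa [show s q = 0 from hq.2, zero_mul, zero_add] at this
    obtain ⟨e, f, hef⟩ := exists_eq_mul_add_mul_of_vanish A l g hA
    obtain ⟨e', f', hef'⟩ := exists_eq_mul_add_mul_of_vanish B l s hB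
    have h1 : ∀ p ∈ LinearMap.ker l, s p * (QuadraticMap.linMulLin g (f + f')) p = 0 := by
      intro p hp
      have h2 := h p hp
      rw [hef, hef', (hS p).1 hp] at h2
      simp only [QuadraticMap.linMulLin_apply, LinearMap.add_apply]
      linear_combination h2
    have h2 := qform_eq_zero_on_of_mul_eq_zero h1 hx (by simp [hsx])
    have h3 := dual_eq_zero_on_of_mul_eq_zero (S := LinearMap.ker l) (f := g) (g := f + f')
      (fun p hp => h2 p hp)
    have h4 : ∀ p ∈ LinearMap.ker l, (f + f') p = 0 :=
      h3.resolve_left fun h => by simpa [hgy] using h y hy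
    right; right
    refine ⟨l, f, fun p hp hfp => ?_⟩
    have h5 := h4 p hp
    rw [LinearMap.add_apply, hfp, zero_add] at h5
    rw [hef, hef', hp, hfp, h5]
    simp

lemma exists_eq_smul_of_vanish {l m : Dual ℂ V} (h : ∀ p, l p = 0 → m p = 0) {u : V}
    (hu : l u ≠ 0) (p : V) : m p = m u / l u * l p := by
  have h1 := h (p - (l p / l u) • u) (by simp [hu])
  simp only [map_sub, map_smul, smul_eq_mul] at h1
  linear_combination h1

lemma mem_pencil_of_mul_eq {A B R : QuadraticForm ℂ V} {y s g : Dual ℂ V} {u : V}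
    (hu : y u ≠ 0) (h : ∀ p, y p * R p = s p * A p + g p * B p) :
    (∃ α β : ℂ, R = α • A + β • B) ∨ PencilProd A B ∨ VanishPair A B := by
  rcases pencil_of_linear_syzygy (A := A) (B := B) (l := y) (s := s) (g := g)
    (fun p hp => by rw [← h, hp, zero_mul]) with h1 | h1
  · left
    have hs := exists_eq_smul_of_vanish (fun p hp => (h1 p hp).1) hu
    have hg := exists_eq_smul_of_vanish (fun p hp => (h1 p hp).2) hu
    refine ⟨s u / y u, g u / y u, ?_⟩
    ext p
    have := qform_eq_zero_on_of_mul_eq_zero (Q := R - ((s u / y u) • A + (g u / y u) • B))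
      (S := ⊤) (f := y) (fun p _ => ?_) (u := u) trivial hu p trivial
    · rwa [_root_.sub_apply, sub_eq_zero] at this
    · have h2 := h p
      rw [hs p, hg p] at h2
      simp only [_root_.sub_apply, _root_.add_apply, _root_.smul_apply,
        smul_eq_mul]
      linear_combination h2
  · exact Or.inr h1

end Pencil

section IsotropicVector

variable {V : Type*} [AddCommGroup V] [Module ℂ V] [FiniteDimensional ℂ V]

lemma exists_linearIndependent_pair_of_two_le {S : Submodule ℂ V} (h : 2 ≤ finrank ℂ S) :
    ∃ u ∈ S, ∃ w ∈ S, LinearIndependent ℂ ![u, w] := by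
  obtain ⟨f, hf⟩ := exists_linearIndependent_of_le_finrank h
  refine ⟨f 0, (f 0).2, f 1, (f 1).2, ?_⟩
  have := hf.map' S.subtype S.ker_subtype
  have he : ![(f 0 : V), (f 1 : V)] = S.subtype ∘ f := by
    ext i
    fin_cases i <;> rfl
  rwa [he]

lemma exists_isotropic_of_two_le (Q : QuadraticForm ℂ V) {S : Submodule ℂ V}
    (h : 2 ≤ finrank ℂ S) : ∃ v ∈ S, v ≠ 0 ∧ Q v = 0 := by
  obtain ⟨u, hu, w, hw, hi⟩ := exists_linearIndependent_pair_of_two_le h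
  obtain ⟨x, y, hxy, hq⟩ := exists_isotropic_pair Q u w
  refine ⟨_, S.add_mem (S.smul_mem x hu) (S.smul_mem y hw), fun h0 => ?_, hq⟩
  have := LinearIndependent.pair_iff.1 hi x y h0
  tauto

lemma finrank_inf_ker_add_one_ge (S : Submodule ℂ V) (e : Dual ℂ V) :
    finrank ℂ S ≤ finrank ℂ (S ⊓ LinearMap.ker e : Submodule ℂ V) + 1 := by
  have h1 := codim_add_finrank (LinearMap.ker e)
  have h2 := codim_ker_le_one e
  have h3 := Submodule.finrank_sup_add_finrank_inf_eq S (LinearMap.ker e)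
  have h4 := Submodule.finrank_le (S ⊔ LinearMap.ker e)
  omega

lemma exists_common_isotropic (A B : QuadraticForm ℂ V) {S : Submodule ℂ V}
    (h : 4 ≤ finrank ℂ S) : ∃ v ∈ S, v ≠ 0 ∧ A v = 0 ∧ B v = 0 := by
  obtain ⟨v, hv, hv0, hAv⟩ := exists_isotropic_of_two_le A (S := S) (by omega)
  obtain ⟨e, he⟩ : ∃ e : Dual ℂ V, e v ≠ 0 := by
    by_contra! hc
    exact hv0 ((Module.forall_dual_apply_eq_zero_iff ℂ v).1 hc)
  have h1 := finrank_inf_ker_add_one_ge S (A.polarBilin v)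
  have h2 := finrank_inf_ker_add_one_ge (S ⊓ LinearMap.ker (A.polarBilin v)) e
  obtain ⟨w, ⟨⟨hw, hvw⟩, hew⟩, hw0, hAw⟩ := exists_isotropic_of_two_le A
    (S := S ⊓ LinearMap.ker (A.polarBilin v) ⊓ LinearMap.ker e) (by omega)
  obtain ⟨x, y, hxy, hq⟩ := exists_isotropic_pair B v w
  refine ⟨_, S.add_mem (S.smul_mem x hv) (S.smul_mem y hw), fun h0 => ?_, ?_, hq⟩
  · have h3 := congrArg e h0
    have hew' : e w = 0 := hew
    simp [hew', he] at h3
    rw [h3] at h0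
    simp [hw0] at h0
    tauto
  · rw [qform_pair, hAv, hAw, show A.polarBilin v w = 0 from hvw]
    ring

lemma exists_degenerate_of_isCompl {A B : QuadraticForm ℂ V} {H : Submodule ℂ V}
    (hH : IsCompl H (qrad A ⊓ qrad B)) (h0 : H ≠ ⊥) :
    ∃ α β : ℂ, (α ≠ 0 ∨ β ≠ 0) ∧ ∃ w ∈ H, w ≠ 0 ∧ w ∈ qrad (α • A + β • B) := by
  have hpolar : ∀ (α β : ℂ) (x y : V), (α • A + β • B).polarBilin x y =
      α * A.polarBilin x y + β * B.polarBilin x y := by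
    intro α β x y
    simp only [QuadraticMap.polarBilin_apply_apply, QuadraticMap.polar, _root_.add_apply,
      _root_.smul_apply, smul_eq_mul]
    ring
  have hrad : ∀ (α β : ℂ) (w : V), (∀ h ∈ H, α * A.polarBilin w h + β * B.polarBilin w h = 0) →
      w ∈ qrad (α • A + β • B) := by
    intro α β w hw
    rw [mem_qrad]
    intro x
    obtain ⟨h, hh, r, hr, rfl⟩ := Submodule.mem_sup.1
      (show x ∈ H ⊔ (qrad A ⊓ qrad B) by rw [hH.sup_eq_top]; trivial)
    rw [hpolar, map_add, map_add, polarBilin_comm A w r, polarBilin_comm B w r,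
      mem_qrad.1 hr.1, mem_qrad.1 hr.2, add_zero, add_zero]
    exact hw h hh
  let fA : H →ₗ[ℂ] Dual ℂ H := A.polarBilin.domRestrict₁₂ H H
  let fB : H →ₗ[ℂ] Dual ℂ H := B.polarBilin.domRestrict₁₂ H H
  by_cases hinj : Function.Injective fA
  · have : Nontrivial H := (Submodule.nontrivial_iff_ne_bot).2 h0
    let eA : H ≃ₗ[ℂ] Dual ℂ H := LinearEquiv.ofInjectiveOfFinrankEq fA hinj
      Subspace.dual_finrank_eq.symm
    obtain ⟨μ, hμ⟩ := Module.End.exists_eigenvalue (eA.symm.toLinearMap ∘ₗ fB : H →ₗ[ℂ] H)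
    obtain ⟨w, hw⟩ := hμ.exists_hasEigenvector
    have h1 : fB w = μ • fA w := by
      have h2 := hw.apply_eq_smul
      simp only [LinearMap.comp_apply, LinearEquiv.coe_coe] at h2
      rw [LinearEquiv.symm_apply_eq, map_smul] at h2
      exact h2
    refine ⟨-μ, 1, by simp, w, w.2, by simpa using hw.2, hrad _ _ _ fun h hh => ?_⟩
    have h2 := LinearMap.congr_fun h1 ⟨h, hh⟩
    have h3 : B.polarBilin w h = μ * A.polarBilin w h := h2
    rw [h3]; ring
  · rw [← LinearMap.ker_eq_bot, Submodule.eq_bot_iff] at hinj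
    push Not at hinj
    obtain ⟨w, hw, hw0⟩ := hinj
    refine ⟨1, 0, by simp, w, w.2, by simpa using hw0, hrad _ _ _ fun h hh => ?_⟩
    have h2 := LinearMap.congr_fun (LinearMap.mem_ker.1 hw) ⟨h, hh⟩
    have h3 : A.polarBilin w h = 0 := h2
    rw [h3]; ring

lemma exists_common_isotropic_or_pencilProd (A B : QuadraticForm ℂ V) :
    PencilProd A B ∨ ∃ v, A v = 0 ∧ B v = 0 ∧ (A.polarBilin v ≠ 0 ∨ B.polarBilin v ≠ 0) := by
  obtain ⟨H, hH⟩ := Submodule.exists_isCompl (qrad A ⊓ qrad B)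
  have hH := hH.symm
  have hfr := Submodule.finrank_add_eq_of_isCompl hH
  by_cases h4 : 4 ≤ finrank ℂ H
  · right
    obtain ⟨v, hv, hv0, hA, hB⟩ := exists_common_isotropic A B h4
    refine ⟨v, hA, hB, ?_⟩
    by_contra! hc
    exact hv0 (Submodule.disjoint_def.1 hH.disjoint v hv ⟨hc.1, hc.2⟩)
  left
  by_cases h0 : H = ⊥
  · refine PencilProd.of_left (isProdForm_of_codim_qrad_le ?_)
    have h1 : qrad A = ⊤ := by
      have := hH.sup_eq_top
      rw [h0, bot_sup_eq] at this
      rw [eq_top_iff, ← this]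
      exact inf_le_left
    have := codim_add_finrank (qrad A)
    rw [h1, finrank_top] at this
    rw [h1]; omega
  obtain ⟨α, β, hαβ, w, hw, hw0, hwr⟩ := exists_degenerate_of_isCompl hH h0
  refine ⟨α, β, hαβ, isProdForm_of_codim_qrad_le ?_⟩
  have hle : qrad A ⊓ qrad B ≤ qrad (α • A + β • B) := by
    intro x hx
    rw [mem_qrad]
    intro y
    have h1 := mem_qrad.1 hx.1 y
    have h2 := mem_qrad.1 hx.2 y
    simp only [QuadraticMap.polarBilin_apply_apply, QuadraticMap.polar, _root_.add_apply,
      _root_.smul_apply, smul_eq_mul] at h1 h2 ⊢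
    linear_combination α * h1 + β * h2
  have hlt : qrad A ⊓ qrad B < qrad (α • A + β • B) :=
    lt_of_le_of_ne hle fun h => hw0 (Submodule.disjoint_def.1 hH.disjoint w hw (by rwa [h]))
  have h5 := Submodule.finrank_lt_finrank_of_lt hlt
  have h6 := codim_add_finrank (qrad (α • A + β • B))
  omega

end IsotropicVector

section StructureTheorem

variable {n : ℕ}

/-- The substitution `p ↦ y(p) p - A(p) v`. -/
noncomputable def slide (A : QuadraticForm ℂ (Fin n → ℂ)) (y : Dual ℂ (Fin n → ℂ))
    (v : Fin n → ℂ) : MvPolynomial (Fin n) ℂ →ₐ[ℂ] MvPolynomial (Fin n) ℂ :=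
  aeval fun i => lpoly y * X i - qpoly A * C (v i)

lemma eval_slide (A : QuadraticForm ℂ (Fin n → ℂ)) (y : Dual ℂ (Fin n → ℂ)) (v : Fin n → ℂ)
    (F : MvPolynomial (Fin n) ℂ) (p : Fin n → ℂ) :
    eval p (slide A y v F) = eval (y p • p - A p • v) F := by
  have : (eval p).comp (slide A y v).toRingHom = eval (y p • p - A p • v) := by
    apply MvPolynomial.ringHom_ext
    · intro r
      simp [slide]
    · intro i
      simp [slide, eval_lpoly, eval_qpoly]
  exact RingHom.congr_fun this F

lemma eval_slide_qpoly (A R : QuadraticForm ℂ (Fin n → ℂ)) (y : Dual ℂ (Fin n → ℂ))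
    (v p : Fin n → ℂ) : eval p (slide A y v (qpoly R)) =
      y p ^ 2 * R p - y p * A p * R.polarBilin v p + A p ^ 2 * R v := by
  have h := qform_pair R p v (y p) (-A p)
  rw [neg_smul, ← sub_eq_add_neg] at h
  rw [eval_slide, eval_qpoly, h, polarBilin_comm R v p]
  ring

lemma isHomogeneous_slide_qpoly (A R : QuadraticForm ℂ (Fin n → ℂ)) (y : Dual ℂ (Fin n → ℂ))
    (v : Fin n → ℂ) : (slide A y v (qpoly R)).IsHomogeneous 4 := by
  refine (isHomogeneous_qpoly R).aeval (n := 2) _ fun i => ?_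
  refine ((isHomogeneous_lpoly y).mul (isHomogeneous_X ℂ i)).sub ?_
  rw [mul_comm]
  exact (isHomogeneous_qpoly A).C_mul _

lemma exists_prime_dvd_map {ι : Type*} {s : Finset ι} {A B : MvPolynomial (Fin n) ℂ}
    {R : ι → MvPolynomial (Fin n) ℂ} (h : ∏ k ∈ s, R k ∈ (Ideal.span {A, B}).radical)
    (φ : MvPolynomial (Fin n) ℂ →ₐ[ℂ] MvPolynomial (Fin n) ℂ) {D : MvPolynomial (Fin n) ℂ}
    (hD : Prime D) (hA : D ∣ φ A) (hB : D ∣ φ B) : ∃ k ∈ s, D ∣ φ (R k) := by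
  obtain ⟨N, hN⟩ := h
  obtain ⟨x, y, hxy⟩ := Ideal.mem_span_pair.1 hN
  have h1 : D ∣ φ (∏ k ∈ s, R k) ^ N := by
    rw [← map_pow, ← hxy, map_add, map_mul, map_mul]
    exact dvd_add (hA.mul_left _) (hB.mul_left _)
  have h2 := hD.dvd_of_dvd_pow h1
  rw [map_prod] at h2
  exact hD.exists_mem_finset_dvd h2

lemma lpoly_ne_zero {y : Dual ℂ (Fin n → ℂ)} {u : Fin n → ℂ} (hu : y u ≠ 0) : lpoly y ≠ 0 := by
  intro h
  rw [← eval_lpoly, h, map_zero] at hu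
  exact hu rfl

/-- The structure theorem when the common isotropic vector has independent polars. -/
lemma pencil_of_independent_polars {ι : Type*} {s : Finset ι} {A B : QuadraticForm ℂ (Fin n → ℂ)}
    {R : ι → QuadraticForm ℂ (Fin n → ℂ)}
    (h : ∏ k ∈ s, qpoly (R k) ∈ (Ideal.span {qpoly A, qpoly B}).radical) {v : Fin n → ℂ}
    (hA : A v = 0) (hB : B v = 0)
    (hind : ∀ l : Dual ℂ (Fin n → ℂ),
      ¬ ∀ p, l p = 0 → A.polarBilin v p = 0 ∧ B.polarBilin v p = 0) :
    (∃ k ∈ s, ∃ α β : ℂ, R k = α • A + β • B) ∨ PencilProd A B ∨ VanishPair A B := by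
  by_contra hcon
  push Not at hcon
  obtain ⟨hc1, hc2, hc3⟩ := hcon
  set y := A.polarBilin v with hy
  set z := B.polarBilin v with hz
  have hsyz : ∀ l : Dual ℂ (Fin n → ℂ), ¬ ∀ p, l p = 0 → y p * B p - z p * A p = 0 := by
    intro l hl
    rcases pencil_of_linear_syzygy (A := B) (B := A) (l := l) (s := y) (g := -z)
      (fun p hp => by rw [← hl p hp, LinearMap.neg_apply]; ring) with h1 | h1 | h1
    · exact hind l fun p hp => ⟨(h1 p hp).1, by simpa using (h1 p hp).2⟩
    · exact hc2 h1.symm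
    · exact hc3 h1.symm
  set D : MvPolynomial (Fin n) ℂ := lpoly y * qpoly B - lpoly z * qpoly A with hD
  have hDe : ∀ p, eval p D = y p * B p - z p * A p := fun p => by
    simp [hD, eval_lpoly, eval_qpoly]
  have hDh : D.IsHomogeneous 3 :=
    ((isHomogeneous_lpoly y).mul (isHomogeneous_qpoly B)).sub
      ((isHomogeneous_lpoly z).mul (isHomogeneous_qpoly A))
  have hD0 : D ≠ 0 := fun h0 => hsyz 0 fun p _ => by rw [← hDe, h0, map_zero]
  have hDi : Irreducible D := by
    refine irreducible_of_forall_ne_mul (d := 2) (Or.inr rfl) hDh hD0 fun f g hf hg hfg => ?_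
    obtain ⟨l, rfl⟩ := exists_eq_lpoly hf
    exact hsyz l fun p hp => by rw [← hDe, hfg, map_mul, eval_lpoly, hp, zero_mul]
  obtain ⟨u, hu⟩ : ∃ u, y u ≠ 0 := by
    by_contra! hc
    exact hind z fun p hp => ⟨hc p, hp⟩
  obtain ⟨k, hk, g, hg⟩ := exists_prime_dvd_map h (slide A y v) hDi.prime
    (by
      have : slide A y v (qpoly A) = 0 := MvPolynomial.funext fun p => by
        rw [eval_slide_qpoly, hA, map_zero]; ring
      rw [this]; exact dvd_zero _)
    (by
      refine ⟨lpoly y, MvPolynomial.funext fun p => ?_⟩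
      rw [eval_slide_qpoly, hB, map_mul, hDe, eval_lpoly]; ring)
  obtain ⟨g', hg', hg⟩ := exists_isHomogeneous_factor (j := 1) hDh hD0
    (isHomogeneous_slide_qpoly A (R k) y v) hg
  obtain ⟨g, rfl⟩ := exists_eq_lpoly hg'
  have hid : ∀ p, y p ^ 2 * R k p - y p * A p * (R k).polarBilin v p + A p ^ 2 * R k v =
      (y p * B p - z p * A p) * g p := fun p => by
    have := congrArg (eval p) hg
    rwa [eval_slide_qpoly, map_mul, hDe, eval_lpoly] at this
  have hprod := qform_mul_qform_eq_zero (A := A)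
    (B := R k v • A + QuadraticMap.linMulLin z g) (S := LinearMap.ker y) (fun p hp => by
      have h1 := hid p
      rw [LinearMap.mem_ker.1 hp] at h1
      simp only [_root_.add_apply, _root_.smul_apply, QuadraticMap.linMulLin_apply, smul_eq_mul]
      linear_combination h1)
  rcases hprod with h0 | h0
  · exact hc2 (PencilProd.of_vanish (α := 1) (β := 0) (by simp) y fun p hp => by
      rw [h0 p hp]; ring)
  obtain ⟨m, hm⟩ := exists_eq_mul_of_vanish _ y h0
  simp only [_root_.add_apply, _root_.smul_apply, QuadraticMap.linMulLin_apply,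
    smul_eq_mul] at hm
  have hpoly : lpoly y * (lpoly y * qpoly (R k) - qpoly A * lpoly ((R k).polarBilin v - m) -
      qpoly B * lpoly g) = 0 := MvPolynomial.funext fun p => by
    simp only [map_mul, map_sub, eval_lpoly, eval_qpoly, LinearMap.sub_apply, map_zero]
    linear_combination hid p - A p * hm p
  have hpoly := (mul_eq_zero.1 hpoly).resolve_left (lpoly_ne_zero hu)
  rcases mem_pencil_of_mul_eq (A := A) (B := B) (R := R k) (s := (R k).polarBilin v - m) (g := g)
    hu (fun p => by
      have := congrArg (eval p) hpoly
      simp only [map_mul, map_sub, eval_lpoly, eval_qpoly, map_zero] at this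
      linear_combination this) with ⟨α, β, h1⟩ | h1 | h1
  exacts [hc1 k hk α β h1, hc2 h1, hc3 h1]

/-- The structure theorem when the common isotropic vector is in the radical of `B`. -/
lemma pencil_of_mem_qrad {ι : Type*} {s : Finset ι} {A B : QuadraticForm ℂ (Fin n → ℂ)}
    {R : ι → QuadraticForm ℂ (Fin n → ℂ)}
    (h : ∏ k ∈ s, qpoly (R k) ∈ (Ideal.span {qpoly A, qpoly B}).radical) {v : Fin n → ℂ}
    (hA : A v = 0) (hy0 : A.polarBilin v ≠ 0) (hB : B.polarBilin v = 0) :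
    (∃ k ∈ s, ∃ α β : ℂ, R k = α • A + β • B) ∨ PencilProd A B ∨ VanishPair A B := by
  by_contra hcon
  push Not at hcon
  obtain ⟨hc1, hc2, hc3⟩ := hcon
  have hBv : B v = 0 := qform_eq_zero_of_mem_qrad (LinearMap.mem_ker.2 hB)
  set y := A.polarBilin v with hy
  obtain ⟨u, hu⟩ : ∃ u, y u ≠ 0 := by
    by_contra! hc
    exact hy0 (LinearMap.ext hc)
  have hBi := irreducible_qpoly fun hp => hc2 (PencilProd.of_left hp).symm
  obtain ⟨k, hk, g, hg⟩ := exists_prime_dvd_map h (slide A y v) hBi.prime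
    (by
      have : slide A y v (qpoly A) = 0 := MvPolynomial.funext fun p => by
        rw [eval_slide_qpoly, hA, map_zero]; ring
      rw [this]; exact dvd_zero _)
    (by
      refine ⟨lpoly y ^ 2, MvPolynomial.funext fun p => ?_⟩
      rw [eval_slide_qpoly, hBv, hB, map_mul, map_pow, eval_qpoly, eval_lpoly,
        LinearMap.zero_apply]
      ring)
  obtain ⟨g', hg', hg⟩ := exists_isHomogeneous_factor (j := 2) (isHomogeneous_qpoly B) hBi.ne_zero
    (isHomogeneous_slide_qpoly A (R k) y v) hg
  obtain ⟨G, rfl⟩ := exists_eq_qpoly hg'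
  have hid : ∀ p, y p ^ 2 * R k p - y p * A p * (R k).polarBilin v p + A p ^ 2 * R k v =
      B p * G p := fun p => by
    have := congrArg (eval p) hg
    rwa [eval_slide_qpoly, map_mul, eval_qpoly, eval_qpoly] at this
  by_cases hρ : R k v = 0
  · rcases qform_mul_qform_eq_zero (A := B) (B := G) (S := LinearMap.ker y) (fun p hp => by
      rw [← hid p, LinearMap.mem_ker.1 hp, hρ]; ring) with h0 | h0
    · exact hc2 (PencilProd.of_vanish (α := 0) (β := 1) (by simp) y fun p hp => by
        rw [h0 p hp]; ring)
    obtain ⟨m, hm⟩ := exists_eq_mul_of_vanish _ y h0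
    have hpoly : lpoly y * (lpoly y * qpoly (R k) - qpoly A * lpoly ((R k).polarBilin v) -
        qpoly B * lpoly m) = 0 := MvPolynomial.funext fun p => by
      simp only [map_mul, map_sub, eval_lpoly, eval_qpoly, map_zero]
      have := hid p
      rw [hρ, hm] at this
      linear_combination this
    have hpoly := (mul_eq_zero.1 hpoly).resolve_left (lpoly_ne_zero hu)
    rcases mem_pencil_of_mul_eq (A := A) (B := B) (R := R k) (s := (R k).polarBilin v) (g := m)
      hu (fun p => by
        have := congrArg (eval p) hpoly
        simp only [map_mul, map_sub, eval_lpoly, eval_qpoly, map_zero] at this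
        linear_combination this) with ⟨α, β, h1⟩ | h1 | h1
    exacts [hc1 k hk α β h1, hc2 h1, hc3 h1]
  · let π : (Fin n → ℂ) →ₗ[ℂ] (Fin n → ℂ) :=
      LinearMap.id - (LinearMap.toSpanSingleton ℂ (Fin n → ℂ) ((y u)⁻¹ • u)) ∘ₗ y
    have hπ : ∀ p, y (π p) = 0 := fun p => by simp [π, hu]
    have hπ' : ∀ p, y p = 0 → π p = p := fun p hp => by simp [π, hp]
    have hker : ∀ p, y p = 0 → A p ^ 2 * R k v = B p * G p := fun p hp => by
      rw [← hid p, hp]; ring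
    by_cases hp : IsProdForm (B.comp π)
    · obtain ⟨l, m, hlm⟩ := hp
      refine hc3 ⟨y, l, fun p hp hl => ?_⟩
      have hBp : B p = 0 := by
        have := hlm p
        rwa [QuadraticMap.comp_apply, hπ' p hp, hl, zero_mul] at this
      have h1 := hker p hp
      rw [hBp, zero_mul] at h1
      exact ⟨by simpa [hρ] using h1, hBp⟩
    · have hi := irreducible_qpoly hp
      have hdvd : qpoly (B.comp π) ∣ qpoly (A.comp π) ^ 2 := by
        refine ⟨C (R k v)⁻¹ * qpoly (G.comp π), MvPolynomial.funext fun p => ?_⟩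
        have := hker (π p) (hπ p)
        simp only [map_pow, map_mul, eval_qpoly, eval_C, QuadraticMap.comp_apply]
        field_simp
        linear_combination this
      obtain ⟨g, hg⟩ := hi.prime.dvd_of_dvd_pow hdvd
      obtain ⟨g', hg', hg⟩ := exists_isHomogeneous_factor (j := 0) (isHomogeneous_qpoly _)
        hi.ne_zero (isHomogeneous_qpoly _) hg
      have hC := totalDegree_eq_zero_iff_eq_C.1 ((totalDegree_zero_iff_isHomogeneous _).2 hg')
      rw [hC] at hg
      refine hc2 (PencilProd.of_vanish (α := 1) (β := -coeff 0 g') (by simp) y fun p hp => ?_)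
      have := congrArg (eval p) hg
      simp only [map_mul, eval_qpoly, eval_C, QuadraticMap.comp_apply, hπ' p hp] at this
      rw [this]; ring

lemma pencil_of_isotropic {ι : Type*} {s : Finset ι} {A B : QuadraticForm ℂ (Fin n → ℂ)}
    {R : ι → QuadraticForm ℂ (Fin n → ℂ)}
    (h : ∏ k ∈ s, qpoly (R k) ∈ (Ideal.span {qpoly A, qpoly B}).radical) {v : Fin n → ℂ}
    (hA : A v = 0) (hB : B v = 0) (hy0 : A.polarBilin v ≠ 0) :
    (∃ k ∈ s, ∃ α β : ℂ, R k = α • A + β • B) ∨ PencilProd A B ∨ VanishPair A B := by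
  by_cases hind : ∀ l : Dual ℂ (Fin n → ℂ),
      ¬ ∀ p, l p = 0 → A.polarBilin v p = 0 ∧ B.polarBilin v p = 0
  · exact pencil_of_independent_polars h hA hB hind
  push Not at hind
  obtain ⟨l, hl⟩ := hind
  obtain ⟨u, hu⟩ : ∃ u, A.polarBilin v u ≠ 0 := by
    by_contra! hc
    exact hy0 (LinearMap.ext hc)
  have hlu : l u ≠ 0 := fun h0 => hu (hl u h0).1
  have h1 := exists_eq_smul_of_vanish (fun p hp => (hl p hp).1) hlu
  have h2 := exists_eq_smul_of_vanish (fun p hp => (hl p hp).2) hlu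
  set μ : ℂ := B.polarBilin v u / A.polarBilin v u with hμ
  have h3 : ∀ p, B.polarBilin v p = μ * A.polarBilin v p := fun p => by
    rw [h1 p, h2 p, hμ]; field_simp
  have hq : qpoly (B - μ • A) = qpoly B - C μ * qpoly A := MvPolynomial.funext fun p => by
    simp [eval_qpoly]
  have hspan : Ideal.span {qpoly A, qpoly B} ≤ Ideal.span {qpoly A, qpoly (B - μ • A)} := by
    rw [Ideal.span_le]
    have hA' : qpoly A ∈ Ideal.span {qpoly A, qpoly (B - μ • A)} :=
      Ideal.subset_span (by simp)
    have hB' : qpoly (B - μ • A) ∈ Ideal.span {qpoly A, qpoly (B - μ • A)} :=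
      Ideal.subset_span (by simp)
    rintro x (rfl | rfl)
    · exact hA'
    · have := Ideal.add_mem _ hB' (Ideal.mul_mem_left _ (C μ) hA')
      rwa [hq, sub_add_cancel, ← hq] at this
  rcases pencil_of_mem_qrad (Ideal.radical_mono hspan h) hA hy0 (LinearMap.ext fun p => by
      have e : (B - μ • A).polarBilin v p = B.polarBilin v p - μ * A.polarBilin v p := by
        simp only [QuadraticMap.polarBilin_apply_apply, QuadraticMap.polar, _root_.sub_apply,
          _root_.smul_apply, smul_eq_mul]
        ring
      rw [e, h3 p, sub_self, LinearMap.zero_apply]) with ⟨k, hk, α, β, hR⟩ | ⟨α, β, hαβ, hp⟩ |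
      ⟨c, d, hcd⟩
  · refine Or.inl ⟨k, hk, α - β * μ, β, ?_⟩
    rw [hR]
    ext p
    simp only [_root_.add_apply, _root_.sub_apply, _root_.smul_apply, smul_eq_mul]
    ring
  · refine Or.inr (Or.inl ⟨α - β * μ, β, ?_, ?_⟩)
    · by_cases hβ : β = 0
      · simp [hβ] at hαβ ⊢
        exact hαβ
      · exact Or.inr hβ
    · convert hp using 1
      ext p
      simp only [_root_.add_apply, _root_.sub_apply, _root_.smul_apply, smul_eq_mul]
      ring
  · refine Or.inr (Or.inr ⟨c, d, fun p hc hd => ?_⟩)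
    have := hcd p hc hd
    refine ⟨this.1, ?_⟩
    have h4 := this.2
    simpa [this.1] using h4

/-- Structure theorem for products of quadratics in the radical of an ideal generated by two
quadratics. -/
theorem pencil_of_prod_mem_radical {ι : Type*} {s : Finset ι}
    {A B : QuadraticForm ℂ (Fin n → ℂ)} {R : ι → QuadraticForm ℂ (Fin n → ℂ)}
    (h : ∏ k ∈ s, qpoly (R k) ∈ (Ideal.span {qpoly A, qpoly B}).radical) :
    (∃ k ∈ s, ∃ α β : ℂ, R k = α • A + β • B) ∨ PencilProd A B ∨ VanishPair A B := by
  rcases exists_common_isotropic_or_pencilProd A B with hp | ⟨v, hA, hB, h0 | h0⟩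
  · exact Or.inr (Or.inl hp)
  · exact pencil_of_isotropic h hA hB h0
  · rw [Set.pair_comm] at h
    rcases pencil_of_isotropic h hB hA h0 with ⟨k, hk, α, β, hR⟩ | hp | hp
    · exact Or.inl ⟨k, hk, β, α, by rw [hR, add_comm]⟩
    · exact Or.inr (Or.inl hp.symm)
    · exact Or.inr (Or.inr hp.symm)

end StructureTheorem

section Planes

variable {E : Type*} [AddCommGroup E] [Module ℂ E] [FiniteDimensional ℂ E]

lemma one_le_finrank_of_ne_bot {S : Submodule ℂ E} (h : S ≠ ⊥) : 1 ≤ finrank ℂ S := by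
  rw [Nat.one_le_iff_ne_zero]
  exact fun h0 => h (Submodule.finrank_eq_zero.1 h0)

/-- Subspaces of dimension at most two, such that each plane misses few of the others, almost all
meet a fixed subspace of dimension three. -/
lemma exists_subspace_meeting_planes {m N : ℕ} (W : Fin m → Submodule ℂ E)
    (hW : ∀ j, finrank ℂ (W j) ≤ 2) (hm : 4 * N < m)
    (hN : ∀ i, finrank ℂ (W i) = 2 → {j | W i ⊓ W j = ⊥}.ncard ≤ N) :
    ∃ U : Submodule ℂ E, finrank ℂ U ≤ 3 ∧ ∀ j, finrank ℂ (W j) ≤ 1 ∨ W j ⊓ U ≠ ⊥ := by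
  classical
  have hmeet : ∀ i j k l, finrank ℂ (W i) = 2 → finrank ℂ (W j) = 2 → finrank ℂ (W k) = 2 →
      finrank ℂ (W l) = 2 → ∃ x, W i ⊓ W x ≠ ⊥ ∧ W j ⊓ W x ≠ ⊥ ∧ W k ⊓ W x ≠ ⊥ ∧
      W l ⊓ W x ≠ ⊥ := by
    intro i j k l hi hj hk hl
    by_contra! hc
    have hsub : (Set.univ : Set (Fin m)) ⊆ {x | W i ⊓ W x = ⊥} ∪ {x | W j ⊓ W x = ⊥} ∪
        {x | W k ⊓ W x = ⊥} ∪ {x | W l ⊓ W x = ⊥} := by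
      intro x _
      by_contra hx
      simp only [Set.mem_union, Set.mem_ofPred_eq, not_or] at hx
      exact hx.2 (hc x hx.1.1.1 hx.1.1.2 hx.1.2)
    have h1 := Set.ncard_le_ncard hsub
    rw [Set.ncard_univ, Nat.card_fin] at h1
    have h2 := Set.ncard_union_le ({x | W i ⊓ W x = ⊥} ∪ {x | W j ⊓ W x = ⊥} ∪
        {x | W k ⊓ W x = ⊥}) {x | W l ⊓ W x = ⊥}
    have h3 := Set.ncard_union_le ({x | W i ⊓ W x = ⊥} ∪ {x | W j ⊓ W x = ⊥})
        {x | W k ⊓ W x = ⊥}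
    have h4 := Set.ncard_union_le {x | W i ⊓ W x = ⊥} {x | W j ⊓ W x = ⊥}
    have := hN i hi
    have := hN j hj
    have := hN k hk
    have := hN l hl
    omega
  by_contra! hcon
  have hcon' : ∀ U : Submodule ℂ E, finrank ℂ U ≤ 3 → ∃ j, finrank ℂ (W j) = 2 ∧ W j ⊓ U = ⊥ := by
    intro U hU
    obtain ⟨j, h1, h2⟩ := hcon U hU
    exact ⟨j, by have := hW j; omega, h2⟩
  by_cases hcase : ∃ i j, finrank ℂ (W i) = 2 ∧ finrank ℂ (W j) = 2 ∧ W i ≠ W j ∧ W i ⊓ W j ≠ ⊥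
  · obtain ⟨i, j, hi, hj, hne, hij⟩ := hcase
    have h1 := Submodule.finrank_sup_add_finrank_inf_eq (W i) (W j)
    have h2 := one_le_finrank_of_ne_bot hij
    obtain ⟨l, hl, hlU⟩ := hcon' (W i ⊔ W j) (by omega)
    have hi1 : finrank ℂ (W i ⊓ W j : Submodule ℂ E) ≤ 1 := by
      by_contra! hc
      have e1 : W i ⊓ W j = W i := Submodule.eq_of_le_of_finrank_le inf_le_left (by omega)
      have e2 : W i ⊓ W j = W j := Submodule.eq_of_le_of_finrank_le inf_le_right (by omega)
      exact hne (e1.symm.trans e2)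
    obtain ⟨k, hk, hkU⟩ := hcon' ((W i ⊓ W j) ⊔ W l) (by
      have := Submodule.finrank_add_le_finrank_add_finrank (W i ⊓ W j) (W l)
      omega)
    obtain ⟨x, hxi, hxj, hxl, hxk⟩ := hmeet i j l k hi hj hl hk
    set T := W x ⊓ (W i ⊔ W j) with hT
    have hdisj : T ⊓ (W x ⊓ W l) = ⊥ := by
      rw [eq_bot_iff, ← hlU]
      exact le_inf (inf_le_right.trans inf_le_right) (inf_le_left.trans inf_le_right)
    have h3 := Submodule.finrank_sup_add_finrank_inf_eq T (W x ⊓ W l)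
    rw [hdisj, finrank_bot] at h3
    have hle : T ⊔ (W x ⊓ W l) ≤ W x := sup_le inf_le_left inf_le_left
    have h4 := Submodule.finrank_mono hle
    have h5 := hW x
    have h6 := one_le_finrank_of_ne_bot hxl
    rw [inf_comm] at h6
    have hTi : W i ⊓ W x ≤ T := le_inf inf_le_right (inf_le_left.trans le_sup_left)
    have hTj : W j ⊓ W x ≤ T := le_inf inf_le_right (inf_le_left.trans le_sup_right)
    have h7 := one_le_finrank_of_ne_bot hxi
    have h8 := one_le_finrank_of_ne_bot hxj
    have h9 := Submodule.finrank_mono hTi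
    have ei : W i ⊓ W x = T := Submodule.eq_of_le_of_finrank_le hTi (by omega)
    have ej : W j ⊓ W x = T := Submodule.eq_of_le_of_finrank_le hTj (by omega)
    have eT : T ⊔ (W x ⊓ W l) = W x := Submodule.eq_of_le_of_finrank_le hle (by omega)
    have hTle : T ≤ W i ⊓ W j := le_inf (ei ▸ inf_le_left) (ej ▸ inf_le_left)
    have hx : W x ≤ (W i ⊓ W j) ⊔ W l := by
      rw [← eT]
      exact sup_le_sup hTle inf_le_right
    apply hxk
    rw [eq_bot_iff, ← hkU]
    exact inf_le_inf_left _ hx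
  · push Not at hcase
    obtain ⟨l, hl, -⟩ := hcon' ⊥ (by simp)
    obtain ⟨k, hk, hkl⟩ := hcon' (W l) (by omega)
    obtain ⟨x, hxk, hxl, -⟩ := hmeet k l k l hk hl hk hl
    have hdisj : (W k ⊓ W x) ⊓ (W l ⊓ W x) = ⊥ := by
      rw [eq_bot_iff, ← hkl]
      exact le_inf (inf_le_left.trans inf_le_left) (inf_le_right.trans inf_le_left)
    have h3 := Submodule.finrank_sup_add_finrank_inf_eq (W k ⊓ W x) (W l ⊓ W x)
    rw [hdisj, finrank_bot] at h3
    have h4 := Submodule.finrank_mono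
      (sup_le inf_le_right inf_le_right : (W k ⊓ W x) ⊔ (W l ⊓ W x) ≤ W x)
    have h6 := one_le_finrank_of_ne_bot hxk
    have h7 := one_le_finrank_of_ne_bot hxl
    have hx2 : finrank ℂ (W x) = 2 := by have := hW x; omega
    have e1 : W k = W x := by
      by_contra hne
      exact hxk (hcase k x hk hx2 hne)
    have e2 : W l = W x := by
      by_contra hne
      exact hxl (hcase l x hl hx2 hne)
    rw [e1, e2, inf_idem] at hkl
    rw [hkl, finrank_bot] at hx2
    omega

end Planes

/-- The quadratic-form data extracted from a `(Q_o,m₁,m₂)`-set. The index `none` of the family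
`Q` corresponds to `Q_o`. -/
structure QoForms (V : Type*) [AddCommGroup V] [Module ℂ V] (m₁ m₂ : ℕ) where
  Qo : QuadraticForm ℂ V
  a : Option (Fin m₁) → Dual ℂ V
  b : Option (Fin m₁) → Dual ℂ V
  Q : Option (Fin m₁) → QuadraticForm ℂ V
  P : Fin m₂ → QuadraticForm ℂ V
  Q_none : Q none = Qo
  Q_apply : ∀ j p, Q j p = Qo p + a j p * b j p
  Q_not_prod : ∀ j, ¬ IsProdForm (Q j)
  P_pencil : ∀ i, ¬ PencilProd (P i) Qo
  QQ_indep : ∀ i j, i ≠ j → ∀ α β : ℂ, (∀ p, α * Q i p + β * Q j p = 0) → α = 0 ∧ β = 0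
  PQ_indep : ∀ i j, ∀ α β : ℂ, (∀ p, α * P i p + β * Q j p = 0) → α = 0 ∧ β = 0
  PP_indep : ∀ i j, i ≠ j → ∀ α β : ℂ, (∀ p, α * P i p + β * P j p = 0) → α = 0 ∧ β = 0
  QQ : ∀ i j, i ≠ j → (∃ k, ∃ α β : ℂ, P k = α • Q i + β • Q j) ∨
    (∃ k, k ≠ i ∧ k ≠ j ∧ ∃ α β : ℂ, Q k = α • Q i + β • Q j) ∨
    PencilProd (Q i) (Q j) ∨ VanishPair (Q i) (Q j)
  PQ : ∀ i j, (∃ k, k ≠ i ∧ ∃ α β : ℂ, P k = α • P i + β • Q j) ∨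
    (∃ k, k ≠ j ∧ ∃ α β : ℂ, Q k = α • P i + β • Q j) ∨
    PencilProd (P i) (Q j) ∨ VanishPair (P i) (Q j)
  card_vanishPair : {j : Fin m₁ | VanishPair (Q (some j)) Qo}.ncard ≤ m₂
  lt_card : 5 * m₂ + 2 < m₁

namespace QoForms

variable {V : Type*} [AddCommGroup V] [Module ℂ V] [FiniteDimensional ℂ V] {m₁ m₂ : ℕ}
  (D : QoForms V m₁ m₂)

/-- Two indices are separated on `K` if `K` contains vectors dual to `a_i, b_i` in the kernel
of `a_j, b_j`. -/
def Separated (K : Submodule ℂ V) (i j : Option (Fin m₁)) : Prop :=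
  ∃ x ∈ K, ∃ y ∈ K, (D.a i x = 1 ∧ D.b i x = 0 ∧ D.a i y = 0 ∧ D.b i y = 1) ∧
    (D.a j x = 0 ∧ D.b j x = 0 ∧ D.a j y = 0 ∧ D.b j y = 0)

/-- Either `K` lies in the radical of `Q_o`, or `Q_o` has large rank. -/
def Adapted (K : Submodule ℂ V) : Prop := K ≤ qrad D.Qo ∨ (K = ⊤ ∧ 21 ≤ codim (qrad D.Qo))

variable {D}

lemma codim_qrad_Qo_le {ι : Type*} [Fintype ι] {e f : ι → Dual ℂ V}
    (h : ∀ p, D.Qo p = ∑ i, e i p * f i p) (hhigh : 21 ≤ codim (qrad D.Qo)) :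
    11 ≤ Fintype.card ι := by
  have := codim_qrad_le_of_eq_sum h
  omega

lemma eq_zero_of_separated {K : Submodule ℂ V} (hK : D.Adapted K) {i j : Option (Fin m₁)}
    (hj : j ≠ none) (hs : D.Separated K i j) {α β γ : ℂ} (hα : α ≠ 0)
    (h : IsProdForm (α • D.Q i + β • D.Q j - γ • D.Qo)) : β = 0 := by
  obtain ⟨x, hx, y, hy, ⟨hax, hbx, hay, hby⟩, hax', hbx', hay', hby'⟩ := hs
  obtain ⟨c, d, hcd⟩ := h
  have hN : ∀ p, c p * d p = α * (D.a i p * D.b i p) + β * (D.a j p * D.b j p) +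
      (α + β - γ) * D.Qo p := by
    intro p
    rw [← hcd p]
    simp only [_root_.sub_apply, _root_.add_apply, _root_.smul_apply, smul_eq_mul, D.Q_apply]
    ring
  have hrad : ∀ v ∈ K, ∀ p, (α + β - γ) * D.Qo.polarBilin v p = 0 := by
    intro v hv p
    rcases hK with hK | ⟨-, hK⟩
    · rw [mem_qrad.1 (hK hv), mul_zero]
    · by_cases hδ : α + β - γ = 0
      · rw [hδ, zero_mul]
      exfalso
      have := codim_qrad_Qo_le (D := D) (e := ![c, D.a i, D.a j])
        (f := ![(α + β - γ)⁻¹ • d, -((α + β - γ)⁻¹ * α) • D.b i,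
          -((α + β - γ)⁻¹ * β) • D.b j]) (fun p => by
          have := hN p
          simp [Fin.sum_univ_three]
          field_simp
          linear_combination -this) hK
      simp at this
  have hpol : ∀ v ∈ K, D.a j v = 0 → D.b j v = 0 → ∀ p,
      D.a i v * D.b i p + D.a i p * D.b i v = (α⁻¹ • c) v * d p + (α⁻¹ • c) p * d v := by
    intro v hv h1 h2 p
    have e1 := hN (v + p)
    have e2 := hN v
    have e3 := hN p
    rw [qform_add] at e1
    have e4 := hrad v hv p
    simp only [map_add, h1, h2] at e1 e2
    simp only [LinearMap.smul_apply, smul_eq_mul]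
    field_simp
    linear_combination -(e1 - e2 - e3) - e4
  have hprod : ∀ p, D.a i p * D.b i p = (α⁻¹ • c) p * d p := by
    refine mul_eq_mul_of_polar_eq (K := Submodule.span ℂ {x, y}) (x := x) (y := y)
      (Submodule.subset_span (by simp)) (Submodule.subset_span (by simp)) hax hbx hay hby ?_
    intro v hv p
    obtain ⟨s, t, rfl⟩ := Submodule.mem_span_pair.1 hv
    exact hpol _ (K.add_mem (K.smul_mem _ hx) (K.smul_mem _ hy)) (by simp [hax', hay'])
      (by simp [hbx', hby']) p
  have hzero : ∀ p, β * (D.a j p * D.b j p) + (α + β - γ) * D.Qo p = 0 := by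
    intro p
    have e1 := hN p
    have e2 := hprod p
    simp only [LinearMap.smul_apply, smul_eq_mul] at e2
    field_simp at e2
    linear_combination -e1 - e2
  by_contra hβ
  by_cases hδ : α + β - γ = 0
  · have := D.QQ_indep j none hj 1 (-1) (fun p => by
      have h1 := hzero p
      rw [hδ, zero_mul, add_zero] at h1
      have h2 := (mul_eq_zero.1 h1).resolve_left hβ
      rw [D.Q_apply, D.Q_none, h2]
      ring)
    simp at this
  · refine D.Q_not_prod none ⟨D.a j, (-((α + β - γ)⁻¹ * β)) • D.b j, fun p => ?_⟩
    have h1 := hzero p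
    rw [D.Q_none]
    simp only [LinearMap.smul_apply, smul_eq_mul]
    field_simp
    linear_combination h1

lemma not_vanishPair_of_separated {K : Submodule ℂ V} (hK : D.Adapted K) {i j : Option (Fin m₁)}
    (hs : D.Separated K i j) : ¬ VanishPair (D.Q i) (D.Q j) := by
  rintro ⟨c, d, hcd⟩
  obtain ⟨x, hx, y, hy, ⟨hax, hbx, hay, hby⟩, hax', hbx', hay', hby'⟩ := hs
  rcases hK with hK | ⟨-, hK⟩
  · obtain ⟨e, f, hef⟩ := exists_eq_mul_add_mul_of_vanish (D.Q j) c d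
      (fun p h1 h2 => (hcd p h1 h2).2)
    have hradj : ∀ v ∈ K, D.a j v = 0 → D.b j v = 0 → v ∈ qrad (D.Q j) := by
      intro v hv h1 h2
      refine mem_qrad_of_forall_add fun p => ?_
      rw [D.Q_apply, D.Q_apply, qform_add_of_mem_qrad (hK hv), map_add, map_add, h1, h2, add_zero,
        add_zero]
    have hx1 := apply_eq_zero_of_mem_qrad (D.Q_not_prod j) hef (hradj x hx hax' hbx')
    have hy1 := apply_eq_zero_of_mem_qrad (D.Q_not_prod j) hef (hradj y hy hay' hby')
    have h1 := (hcd (x + y) (by simp [hx1, hy1]) (by simp [hx1, hy1])).1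
    rw [D.Q_apply, qform_add_of_mem_qrad (hK hy), qform_eq_zero_of_mem_qrad (hK hx)] at h1
    simp [hax, hbx, hay, hby] at h1
  · obtain ⟨e, f, hef⟩ := exists_eq_mul_add_mul_of_vanish (D.Q i) c d
      (fun p h1 h2 => (hcd p h1 h2).1)
    have := codim_qrad_Qo_le (D := D) (e := ![c, d, D.a i]) (f := ![e, f, -D.b i]) (fun p => by
      have := hef p
      rw [D.Q_apply] at this
      simp [Fin.sum_univ_three]
      linear_combination this) hK
    simp at this

lemma exists_P_of_separated {K : Submodule ℂ V} (hK : D.Adapted K) {i j : Option (Fin m₁)}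
    (hij : i ≠ j) (hj : j ≠ none) (hs : D.Separated K i j) :
    ∃ k, ∃ α β : ℂ, β ≠ 0 ∧ D.P k = α • D.Q i + β • D.Q j := by
  have key : ∀ α β γ : ℂ, α ≠ 0 → β ≠ 0 → ¬ IsProdForm (α • D.Q i + β • D.Q j - γ • D.Qo) :=
    fun α β γ hα hβ h => hβ (eq_zero_of_separated hK hj hs hα h)
  rcases D.QQ i j hij with ⟨k, α, β, h⟩ | ⟨k, hki, hkj, α, β, h⟩ | ⟨α, β, h0, h⟩ | h
  · refine ⟨k, α, β, fun hβ => ?_, h⟩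
    have := D.PQ_indep k i 1 (-α) (fun p => by rw [h, hβ]; simp)
    simp at this
  · exfalso
    refine key α β 1 (fun hα => ?_) (fun hβ => ?_) ⟨D.a k, D.b k, fun p => ?_⟩
    · have := D.QQ_indep k j hkj 1 (-β) (fun p => by rw [h, hα]; simp)
      simp at this
    · have := D.QQ_indep k i hki 1 (-α) (fun p => by rw [h, hβ]; simp)
      simp at this
    · have h1 := D.Q_apply k p
      rw [← h, _root_.sub_apply, h1]
      simp
  · exfalso
    have hprod : ∀ (F : QuadraticForm ℂ V) (t : ℂ), t ≠ 0 → IsProdForm (t • F) → IsProdForm F := by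
      rintro F t ht ⟨c, d, hcd⟩
      refine ⟨t⁻¹ • c, d, fun p => ?_⟩
      have := hcd p
      simp only [_root_.smul_apply, LinearMap.smul_apply, smul_eq_mul] at this ⊢
      field_simp
      linear_combination this
    refine key α β 0 (fun hα => ?_) (fun hβ => ?_) (by simpa using h)
    · refine D.Q_not_prod j (hprod _ β ?_ ?_)
      · simpa [hα] using h0
      · simpa [hα] using h
    · refine D.Q_not_prod i (hprod _ α ?_ ?_)
      · simpa [hβ] using h0
      · simpa [hβ] using h
  · exact absurd h (not_vanishPair_of_separated hK hs)

lemma ncard_separated_le {K : Submodule ℂ V} (hK : D.Adapted K) (i : Fin m₁) :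
    {j : Fin m₁ | D.Separated K (some i) (some j)}.ncard ≤ m₂ := by
  have hex : ∀ j ∈ {j : Fin m₁ | D.Separated K (some i) (some j)},
      ∃ k, ∃ α β : ℂ, β ≠ 0 ∧ D.P k = α • D.Q (some i) + β • D.Q (some j) := by
    intro j hj
    refine exists_P_of_separated hK ?_ (by simp) hj
    rintro heq
    obtain ⟨x, hx, y, hy, ⟨hax, -⟩, hax', -⟩ := hj
    rw [← heq, hax] at hax'
    exact one_ne_zero hax'
  rcases Set.eq_empty_or_nonempty {j : Fin m₁ | D.Separated K (some i) (some j)} with h0 | ⟨j₀, hj₀⟩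
  · simp [h0]
  have : Nonempty (Fin m₂) := ⟨(hex j₀ hj₀).choose⟩
  choose! k hk using hex
  have := Set.ncard_le_ncard_of_injOn (t := (Set.univ : Set (Fin m₂))) k (fun _ _ => trivial) (by
    intro j hj j' hj' hkk
    obtain ⟨α, β, hβ, h⟩ := hk j hj
    obtain ⟨α', β', hβ', h'⟩ := hk j' hj'
    rw [hkk, h'] at h
    have hp : ∀ p, α' * D.Q (some i) p + β' * D.Q (some j') p =
        α * D.Q (some i) p + β * D.Q (some j) p := fun p => by
      simpa using congrArg (fun F : QuadraticForm ℂ V => F p) h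
    by_contra hne
    by_cases hαα : α - α' = 0
    · have := D.QQ_indep (some j) (some j') (by simpa using hne) β (-β') (fun p => by
        linear_combination -hp p - hαα * D.Q (some i) p)
      exact hβ this.1
    · refine hβ (eq_zero_of_separated hK (by simp) hj hαα (γ := β')
        ⟨β' • D.a (some j'), D.b (some j'), fun p => ?_⟩)
      have h1 := D.Q_apply (some j') p
      have h2 := hp p
      simp only [_root_.sub_apply, _root_.add_apply, _root_.smul_apply, smul_eq_mul,
        LinearMap.smul_apply]
      linear_combination -h2 + β' * h1)
  simpa using this

end QoForms

lemma finrank_span_pair_eq_two_iff {E : Type*} [AddCommGroup E] [Module ℂ E] (A B : E) :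
    finrank ℂ (Submodule.span ℂ {A, B}) = 2 ↔
      ∀ s t : ℂ, s • A + t • B = 0 → s = 0 ∧ t = 0 := by
  rw [← LinearIndependent.pair_iff, linearIndependent_iff_card_eq_finrank_span,
    Matrix.range_cons, Matrix.range_cons, Matrix.range_empty, Set.union_empty,
    Set.singleton_union, Set.finrank, Fintype.card_fin, eq_comm]

lemma exists_combination_eq_zero_of_dependent {V : Type*} [AddCommGroup V] [Module ℂ V]
    {S : Submodule ℂ V} {c a b : Dual ℂ V} (h : ∀ p ∈ S, c p = 0 → a p = 0 ∧ b p = 0) :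
    ∃ s t : ℂ, ¬ (s = 0 ∧ t = 0) ∧ ∀ p ∈ S, s * a p + t * b p = 0 := by
  by_cases hc : ∀ p ∈ S, c p = 0
  · exact ⟨1, 0, by simp, fun p hp => by simp [(h p hp (hc p hp)).1]⟩
  push Not at hc
  obtain ⟨u, hu, hcu⟩ := hc
  have key : ∀ p ∈ S, a p = c p / c u * a u ∧ b p = c p / c u * b u := by
    intro p hp
    have := h (p - (c p / c u) • u) (S.sub_mem hp (S.smul_mem _ hu)) (by
      simp only [map_sub, map_smul, smul_eq_mul]; field_simp; ring)
    simp only [map_sub, map_smul, smul_eq_mul] at this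
    exact ⟨by linear_combination this.1, by linear_combination this.2⟩
  by_cases h0 : b u = 0 ∧ a u = 0
  · exact ⟨1, 0, by simp, fun p hp => by rw [(key p hp).1, h0.2]; ring⟩
  · refine ⟨b u, -a u, by simpa using h0, fun p hp => ?_⟩
    rw [(key p hp).1, (key p hp).2]
    ring

namespace QoForms

variable {V : Type*} [AddCommGroup V] [Module ℂ V] [FiniteDimensional ℂ V] {m₁ m₂ : ℕ}
  {D : QoForms V m₁ m₂}

/-- The restrictions to `K` of the two linear forms of index `j`. -/
def plane (D : QoForms V m₁ m₂) (K : Submodule ℂ V) (j : Fin m₁) : Submodule ℂ (Dual ℂ K) :=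
  Submodule.span ℂ {K.dualRestrict (D.a (some j)), K.dualRestrict (D.b (some j))}

lemma separated_of_plane_inf_eq_bot {K : Submodule ℂ V} {i j : Fin m₁}
    (h2 : finrank ℂ (D.plane K i) = 2) (h : D.plane K i ⊓ D.plane K j = ⊥) :
    D.Separated K (some i) (some j) := by
  rcases dependent_or_exists_dual
    (K ⊓ (LinearMap.ker (D.a (some j)) ⊓ LinearMap.ker (D.b (some j))))
    (D.a (some i)) (D.b (some i)) with ⟨c, hc⟩ | ⟨x, hx, y, hy, h1, h2, h3, h4⟩
  · exfalso
    obtain ⟨s, t, h0, hst⟩ := exists_combination_eq_zero_of_dependent hc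
    have hi : s • K.dualRestrict (D.a (some i)) + t • K.dualRestrict (D.b (some i)) ∈
        D.plane K i := Submodule.mem_span_pair.2 ⟨s, t, rfl⟩
    have hj : s • K.dualRestrict (D.a (some i)) + t • K.dualRestrict (D.b (some i)) ∈
        D.plane K j := by
      have := mem_span_of_iInf_ker_le_ker
        (L := ![K.dualRestrict (D.a (some j)), K.dualRestrict (D.b (some j))])
        (K := s • K.dualRestrict (D.a (some i)) + t • K.dualRestrict (D.b (some i))) (by
          intro p hp
          rw [Submodule.mem_iInf] at hp
          have h0 := hp 0
          have h1 := hp 1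
          simp only [Matrix.cons_val_zero, Matrix.cons_val_one, LinearMap.mem_ker,
            Submodule.dualRestrict_apply] at h0 h1
          rw [LinearMap.mem_ker]
          simpa using hst p ⟨p.2, h0, h1⟩)
      rwa [Matrix.range_cons, Matrix.range_cons, Matrix.range_empty, Set.union_empty,
        Set.singleton_union] at this
    have hz : s • K.dualRestrict (D.a (some i)) + t • K.dualRestrict (D.b (some i)) = 0 := by
      have := Submodule.mem_inf.2 ⟨hi, hj⟩
      rwa [h, Submodule.mem_bot] at this
    exact h0 ((finrank_span_pair_eq_two_iff _ _).1 h2 s t hz)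
  · exact ⟨x, hx.1, y, hy.1, ⟨h1, h2, h3, h4⟩, hx.2.1, hx.2.2, hy.2.1, hy.2.2⟩

lemma exists_common_direction {K : Submodule ℂ V} (hK : D.Adapted K) :
    ∃ K' ≤ K, codim K' ≤ codim K + 3 ∧ ∀ j, ∃ c : Dual ℂ V, ∀ p ∈ K', c p = 0 →
      D.a j p = 0 ∧ D.b j p = 0 := by
  obtain ⟨U, hU, hmeet⟩ := exists_subspace_meeting_planes (N := m₂) (D.plane K)
    (fun j => by
      have := finrank_range_le_card (R := ℂ)
        (b := ![K.dualRestrict (D.a (some j)), K.dualRestrict (D.b (some j))])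
      rwa [Matrix.range_cons, Matrix.range_cons, Matrix.range_empty, Set.union_empty,
        Set.singleton_union, Fintype.card_fin] at this)
    (by have := D.lt_card; omega) (fun i hi => by
      refine (Set.ncard_le_ncard ?_).trans (ncard_separated_le hK i)
      exact fun j hj => separated_of_plane_inf_eq_bot hi hj)
  have hmem : ∀ p, p ∈ U.dualCoannihilator.map K.subtype ↔
      ∃ hp : p ∈ K, ∀ φ ∈ U, φ ⟨p, hp⟩ = 0 := by
    intro p
    simp [Submodule.mem_dualCoannihilator]
  refine ⟨U.dualCoannihilator.map K.subtype, Submodule.map_subtype_le _ _, ?_, fun j => ?_⟩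
  · have h1 := Subspace.finrank_add_finrank_dualCoannihilator_eq U
    have h2 := codim_add_finrank K
    have h3 := codim_add_finrank (U.dualCoannihilator.map K.subtype)
    rw [Submodule.finrank_map_subtype_eq] at h3
    omega
  rcases j with _ | j
  · have h0 : ∀ p ∈ (⊤ : Submodule ℂ V), D.a none p * D.b none p = 0 := by
      intro p _
      have := D.Q_apply none p
      rw [D.Q_none] at this
      linear_combination -this
    rcases dual_eq_zero_on_of_mul_eq_zero h0 with h | h
    · exact ⟨D.b none, fun p _ hp => ⟨h p trivial, hp⟩⟩
    · exact ⟨D.a none, fun p _ hp => ⟨hp, h p trivial⟩⟩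
  rcases dependent_or_exists_dual (U.dualCoannihilator.map K.subtype) (D.a (some j))
    (D.b (some j)) with h | ⟨x, hx, y, hy, h1, h2, h3, h4⟩
  · exact h
  exfalso
  obtain ⟨hx, hxU⟩ := (hmem x).1 hx
  obtain ⟨hy, hyU⟩ := (hmem y).1 hy
  rcases hmeet j with h | h
  · have : finrank ℂ (D.plane K j) = 2 := by
      refine (finrank_span_pair_eq_two_iff _ _).2 fun s t hst => ?_
      have e1 := LinearMap.congr_fun hst ⟨x, hx⟩
      have e2 := LinearMap.congr_fun hst ⟨y, hy⟩
      simp [h1, h2] at e1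
      simp [h3, h4] at e2
      exact ⟨e1, e2⟩
    omega
  · obtain ⟨φ, hφ, hne⟩ := Submodule.exists_mem_ne_zero_of_ne_bot h
    obtain ⟨s, t, rfl⟩ := Submodule.mem_span_pair.1 hφ.1
    have e1 := hxU _ hφ.2
    have e2 := hyU _ hφ.2
    simp [h1, h2] at e1
    simp [h3, h4] at e2
    simp [e1, e2] at hne

end QoForms

namespace QoForms

variable {V : Type*} [AddCommGroup V] [Module ℂ V] {m₁ m₂ : ℕ} {D : QoForms V m₁ m₂}

lemma P_not_prod (D : QoForms V m₁ m₂) (i : Fin m₂) : ¬ IsProdForm (D.P i) :=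
  fun h => D.P_pencil i (PencilProd.of_left h)

/-- `P_i` lies in the span of `Q_j` and another `Q_k`. -/
def Collinear (D : QoForms V m₁ m₂) (i : Fin m₂) (j : Fin m₁) : Prop :=
  ∃ k, k ≠ some j ∧ ∃ α β : ℂ, ∀ p, D.P i p = α * D.Q (some j) p + β * D.Q k p

/-- `P_i` is a multiple of `Q_j` plus a product of two linear forms. -/
def ProdClose (D : QoForms V m₁ m₂) (i : Fin m₂) (j : Fin m₁) : Prop :=
  ∃ α : ℂ, α ≠ 0 ∧ ∃ c d : Dual ℂ V, ∀ p, D.P i p = α * D.Q (some j) p + c p * d p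

/-- The pairs `P_i, Q_j` whose relation does not come from another `P_k`. -/
def Typed (D : QoForms V m₁ m₂) (i : Fin m₂) (j : Fin m₁) : Prop :=
  D.Collinear i j ∨ D.ProdClose i j ∨ VanishPair (D.P i) (D.Q (some j))

lemma typed_or (i : Fin m₂) (j : Fin m₁) : D.Typed i j ∨
    ∃ k, k ≠ i ∧ ∃ α β : ℂ, ∀ p, D.P k p = α * D.P i p + β * D.Q (some j) p := by
  rcases D.PQ i (some j) with ⟨k, hk, α, β, h⟩ | ⟨k, hk, α, β, h⟩ | ⟨α, β, h0, c, d, h⟩ | h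
  · exact Or.inr ⟨k, hk, α, β, fun p => by rw [h]; simp⟩
  · have hα : α ≠ 0 := by
      rintro rfl
      have := D.QQ_indep k (some j) hk 1 (-β) (fun p => by rw [h]; simp)
      simp at this
    refine Or.inl (Or.inl ⟨k, hk, -(α⁻¹ * β), α⁻¹, fun p => ?_⟩)
    rw [h]
    simp only [_root_.add_apply, _root_.smul_apply, smul_eq_mul]
    field_simp
    ring
  · have h' : ∀ p, α * D.P i p + β * D.Q (some j) p = c p * d p := by
      intro p
      rw [← h p]
      simp
    have hα : α ≠ 0 := by
      rintro rfl
      have hβ : β ≠ 0 := by simpa using h0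
      refine D.Q_not_prod (some j) ⟨β⁻¹ • c, d, fun p => ?_⟩
      have := h' p
      simp only [LinearMap.smul_apply, smul_eq_mul]
      field_simp
      linear_combination this
    have hβ : β ≠ 0 := by
      rintro rfl
      refine D.P_not_prod i ⟨α⁻¹ • c, d, fun p => ?_⟩
      have := h' p
      simp only [LinearMap.smul_apply, smul_eq_mul]
      field_simp
      linear_combination this
    refine Or.inl (Or.inr (Or.inl ⟨-(α⁻¹ * β), by simp [hα, hβ], α⁻¹ • c, d, fun p => ?_⟩))
    have := h' p
    simp only [LinearMap.smul_apply, smul_eq_mul]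
    field_simp
    linear_combination this
  · exact Or.inl (Or.inr (Or.inr h))

lemma ncard_not_typed_le (i : Fin m₂) : {j : Fin m₁ | ¬ D.Typed i j}.ncard ≤ m₂ := by
  have hex : ∀ j ∈ {j : Fin m₁ | ¬ D.Typed i j}, ∃ k, k ≠ i ∧ ∃ α β : ℂ,
      ∀ p, D.P k p = α * D.P i p + β * D.Q (some j) p :=
    fun j hj => (typed_or i j).resolve_left hj
  have : Nonempty (Fin m₂) := ⟨i⟩
  choose! k hk using hex
  have := Set.ncard_le_ncard_of_injOn (t := (Set.univ : Set (Fin m₂))) k (fun _ _ => trivial) (by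
    intro j hj j' hj' hkk
    obtain ⟨hki, α, β, h⟩ := hk j hj
    obtain ⟨hki', α', β', h'⟩ := hk j' hj'
    by_contra hne
    by_cases hαα : α - α' = 0
    · have := D.QQ_indep (some j) (some j') (by simpa using hne) β (-β') (fun p => by
        have e1 := h p
        rw [hkk] at e1
        linear_combination -e1 + h' p - hαα * D.P i p)
      have := D.PP_indep (k j) i hki 1 (-α) (fun p => by
        rw [h p, this.1]; ring)
      simp at this
    · refine hj (Or.inl ⟨some j', by simpa using fun h => hne h.symm, -(α - α')⁻¹ * β,
        (α - α')⁻¹ * β', fun p => ?_⟩)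
      have e1 := h p
      rw [hkk] at e1
      field_simp
      linear_combination -e1 + h' p)
  simpa using this

lemma exists_pair_typed (i i' : Fin m₂) : ∃ j j', j ≠ j' ∧ D.Typed i j ∧ D.Typed i' j ∧
    D.Typed i j' ∧ D.Typed i' j' := by
  have h1 := ncard_not_typed_le (D := D) i
  have h2 := ncard_not_typed_le (D := D) i'
  have h3 := Set.ncard_union_le {j : Fin m₁ | ¬ D.Typed i j} {j : Fin m₁ | ¬ D.Typed i' j}
  have h4 := Set.ncard_add_ncard_compl
    ({j : Fin m₁ | ¬ D.Typed i j} ∪ {j : Fin m₁ | ¬ D.Typed i' j})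
  rw [Nat.card_fin] at h4
  have h5 := D.lt_card
  obtain ⟨j, j', hj, hj', hne⟩ := (Set.one_lt_ncard_iff (Set.toFinite _)).1
    (show 1 < ({j : Fin m₁ | ¬ D.Typed i j} ∪ {j : Fin m₁ | ¬ D.Typed i' j})ᶜ.ncard by omega)
  simp only [Set.mem_compl_iff, Set.mem_union, Set.mem_ofPred_eq, not_or, not_not] at hj hj'
  exact ⟨j, j', hne, hj.1, hj.2, hj'.1, hj'.2⟩

lemma not_isProdForm_P_sub (i : Fin m₂) (γ : ℂ) : ¬ IsProdForm (D.P i - γ • D.Qo) := by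
  rintro ⟨c, d, h⟩
  refine D.P_pencil i ⟨1, -γ, by simp, c, d, fun p => ?_⟩
  rw [← h p]
  simp only [_root_.sub_apply, _root_.add_apply, _root_.smul_apply, smul_eq_mul]
  ring

lemma mem_qrad_of_apply_eq_zero {F : QuadraticForm ℂ V} {a b c d : Dual ℂ V}
    (h : ∀ p, F p = a p * b p + c p * d p) {v : V} (ha : a v = 0) (hb : b v = 0) (hc : c v = 0)
    (hd : d v = 0) : v ∈ qrad F := by
  rw [mem_qrad]
  intro w
  rw [polarBilin_eq_of_eq_mul_add_mul h, ha, hb, hc, hd]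
  ring

variable [FiniteDimensional ℂ V]

/-- The normal form of a typed pair when `Q_o` has large rank. -/
lemma exists_normal_form (hhigh : 21 ≤ codim (qrad D.Qo)) {i : Fin m₂} {j : Fin m₁}
    (h : D.Typed i j) : ∃ γ α : ℂ, ∃ c d : Dual ℂ V, α ≠ 0 ∧
      (∀ p, (D.P i - γ • D.Qo) p = (α • D.a (some j)) p * D.b (some j) p + c p * d p) ∧
      ((∃ k, ∃ β : ℂ, c = β • D.a k ∧ d = D.b k) ∨ γ = α) := by
  rcases h with ⟨k, hk, α, β, h⟩ | ⟨α, hα, c, d, h⟩ | ⟨c, d, h⟩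
  · refine ⟨α + β, α, β • D.a k, D.b k, ?_, fun p => ?_, Or.inl ⟨k, β, rfl, rfl⟩⟩
    · rintro rfl
      have := D.PQ_indep i k 1 (-β) (fun p => by rw [h]; ring)
      simp at this
    · simp only [_root_.sub_apply, _root_.smul_apply, LinearMap.smul_apply, smul_eq_mul]
      rw [h, D.Q_apply, D.Q_apply]
      ring
  · refine ⟨α, α, c, d, hα, fun p => ?_, Or.inr rfl⟩
    simp only [_root_.sub_apply, _root_.smul_apply, LinearMap.smul_apply, smul_eq_mul]
    rw [h, D.Q_apply]
    ring
  · exfalso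
    obtain ⟨e, f, hef⟩ := exists_eq_mul_add_mul_of_vanish (D.Q (some j)) c d
      (fun p h1 h2 => (h p h1 h2).2)
    have := codim_qrad_Qo_le (D := D) (e := ![c, d, D.a (some j)]) (f := ![e, f, -D.b (some j)])
      (fun p => by
        have := hef p
        rw [D.Q_apply] at this
        simp [Fin.sum_univ_three]
        linear_combination this) hhigh
    simp at this

lemma eq_of_two_normal_forms (hhigh : 21 ≤ codim (qrad D.Qo)) {i : Fin m₂} {γ γ' : ℂ}
    {a b c d a' b' c' d' : Dual ℂ V} (h : ∀ p, (D.P i - γ • D.Qo) p = a p * b p + c p * d p)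
    (h' : ∀ p, (D.P i - γ' • D.Qo) p = a' p * b' p + c' p * d' p) : γ = γ' := by
  by_contra hne
  have hne : γ' - γ ≠ 0 := fun h => hne (sub_eq_zero.1 h).symm
  have := codim_qrad_Qo_le (D := D) (e := ![a, c, a', c'])
    (f := ![(γ' - γ)⁻¹ • b, (γ' - γ)⁻¹ • d, -(γ' - γ)⁻¹ • b', -(γ' - γ)⁻¹ • d'])
    (fun p => by
      have e1 := h p
      have e2 := h' p
      simp only [_root_.sub_apply, _root_.smul_apply, smul_eq_mul] at e1 e2
      simp [Fin.sum_univ_four]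
      field_simp
      linear_combination e1 - e2) hhigh
  simp at this

lemma exists_common_direction_P_of_high {K : Submodule ℂ V} (hhigh : 21 ≤ codim (qrad D.Qo))
    (hdir : ∀ j, ∃ c : Dual ℂ V, ∀ p ∈ K, c p = 0 → D.a j p = 0 ∧ D.b j p = 0) :
    ∃ K' ≤ K, codim K' ≤ codim K + 4 ∧ ∀ i, ∃ γ : ℂ, ∃ c : Dual ℂ V, ∀ p ∈ K', c p = 0 →
      p ∈ qrad (D.P i - γ • D.Qo) := by
  rcases isEmpty_or_nonempty (Fin m₂) with hm | ⟨⟨i₀⟩⟩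
  · exact ⟨K, le_rfl, by omega, fun i => (hm.false i).elim⟩
  obtain ⟨j₀, -, -, hj₀, -⟩ := exists_pair_typed (D := D) i₀ i₀
  obtain ⟨γ₀, α₀, c₀, d₀, hα₀, h₀, -⟩ := exists_normal_form hhigh hj₀
  have hvan : ∀ j, D.Typed i₀ j → ∀ v ∈ K ⊓ qrad (D.P i₀ - γ₀ • D.Qo),
      D.a (some j) v = 0 ∧ D.b (some j) v = 0 := by
    intro j hj v hv
    obtain ⟨γ, α, c, d, hα, h, -⟩ := exists_normal_form hhigh hj
    obtain rfl := eq_of_two_normal_forms hhigh h₀ h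
    have := apply_eq_zero_of_mem_qrad (not_isProdForm_P_sub i₀ γ₀) h hv.2
    refine ⟨?_, this.2.1⟩
    simpa [hα] using this.1
  refine ⟨K ⊓ qrad (D.P i₀ - γ₀ • D.Qo), inf_le_left, ?_, fun i => ?_⟩
  · refine (codim_inf_le _ _).trans ?_
    have := codim_qrad_le_of_eq_sum (Q := D.P i₀ - γ₀ • D.Qo) (e := ![α₀ • D.a (some j₀), c₀])
      (f := ![D.b (some j₀), d₀]) (fun p => by rw [h₀ p, Fin.sum_univ_two]; rfl)
    simp at this
    omega
  obtain ⟨j, j', hne, hj, hij, hj', hij'⟩ := exists_pair_typed (D := D) i₀ i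
  obtain ⟨γ, α, c, d, hα, h, hk⟩ := exists_normal_form hhigh hij
  obtain ⟨γ', α', c', d', hα', h', hk'⟩ := exists_normal_form hhigh hij'
  obtain rfl := eq_of_two_normal_forms hhigh h h'
  have hdep : ∀ (j : Fin m₁) (α : ℂ) (c d : Dual ℂ V), D.Typed i₀ j →
      (∀ p, (D.P i - γ • D.Qo) p = (α • D.a (some j)) p * D.b (some j) p + c p * d p) →
      (∃ e : Dual ℂ V, ∀ p ∈ K ⊓ qrad (D.P i₀ - γ₀ • D.Qo), e p = 0 → c p = 0 ∧ d p = 0) →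
      ∃ γ : ℂ, ∃ c : Dual ℂ V, ∀ p ∈ K ⊓ qrad (D.P i₀ - γ₀ • D.Qo), c p = 0 →
      p ∈ qrad (D.P i - γ • D.Qo) := by
    rintro j α c d hj h ⟨e, he⟩
    refine ⟨γ, e, fun p hp hep => ?_⟩
    have h1 := hvan j hj p hp
    exact mem_qrad_of_apply_eq_zero h (by simp [h1.1]) h1.2 (he p hp hep).1 (he p hp hep).2
  have hdir' : ∀ (k : Option (Fin m₁)) (β : ℂ), ∃ e : Dual ℂ V,
      ∀ p ∈ K ⊓ qrad (D.P i₀ - γ₀ • D.Qo), e p = 0 → (β • D.a k) p = 0 ∧ D.b k p = 0 := by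
    intro k β
    obtain ⟨e, he⟩ := hdir k
    refine ⟨e, fun p hp hep => ⟨?_, (he p hp.1 hep).2⟩⟩
    simp [(he p hp.1 hep).1]
  rcases hk with ⟨k, β, rfl, rfl⟩ | hγ
  · exact hdep j α _ _ hj h (hdir' k β)
  rcases hk' with ⟨k, β, rfl, rfl⟩ | hγ'
  · exact hdep j' α' _ _ hj' h' (hdir' k β)
  subst hγ hγ'
  rcases dependent_or_exists_dual (K ⊓ qrad (D.P i₀ - γ₀ • D.Qo)) c d with
    hcd | ⟨x, hx, y, hy, h1, h2, h3, h4⟩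
  · exact hdep j _ c d hj h hcd
  exfalso
  have hprod := mul_eq_mul_of_polar_eq (c' := c') (d' := d') hx hy h1 h2 h3 h4 (fun v hv p => by
    have e1 := polarBilin_eq_of_eq_mul_add_mul h v p
    have e2 := polarBilin_eq_of_eq_mul_add_mul h' v p
    simp only [LinearMap.smul_apply, hvan j hj v hv, hvan j' hj' v hv] at e1 e2
    simp only [smul_eq_mul, mul_zero, zero_mul, zero_add] at e1 e2
    rw [← e1, e2])
  have := D.QQ_indep (some j) (some j') (by simpa using hne) 1 (-1) (fun p => by
    have e1 := h p
    have e2 := h' p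
    rw [e1, hprod p] at e2
    simp only [LinearMap.smul_apply, smul_eq_mul, add_left_inj, mul_assoc] at e2
    have e3 := mul_left_cancel₀ hα e2
    rw [D.Q_apply, D.Q_apply, e3]
    ring)
  simp at this

end QoForms

namespace QoForms

variable {V : Type*} [AddCommGroup V] [Module ℂ V] {m₁ m₂ : ℕ} {D : QoForms V m₁ m₂}

/-- `P_i` is invariant under no hyperplane of `K`. -/
def Spread (D : QoForms V m₁ m₂) (K : Submodule ℂ V) (i : Fin m₂) : Prop :=
  ¬ ∃ c : Dual ℂ V, ∀ p ∈ K, c p = 0 → p ∈ qrad (D.P i)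

/-- The indices `j` whose `Q_j` is `K`-invariant or not invariant under `K ∩ rad P_i`. -/
def exceptional (D : QoForms V m₁ m₂) (K : Submodule ℂ V) (i : Fin m₂) : Set (Fin m₁) :=
  {j | K ≤ qrad (D.Q (some j)) ∨ ¬ K ⊓ qrad (D.P i) ≤ qrad (D.Q (some j))}

/-- `P_i` and `Q_j` vanish together on the zero set of two linear forms vanishing on `K`. -/
def VanishOn (D : QoForms V m₁ m₂) (K : Submodule ℂ V) (i : Fin m₂) (j : Fin m₁) : Prop :=
  ∃ c d : Dual ℂ V, (∀ v ∈ K, c v = 0 ∧ d v = 0) ∧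
    ∀ p, c p = 0 → d p = 0 → D.P i p = 0 ∧ D.Q (some j) p = 0

variable {K : Submodule ℂ V} {i : Fin m₂}

lemma Spread.false_of_hyperplane (hs : D.Spread K i) {v : V} (hv : v ∈ K) (hvP : v ∈ qrad (D.P i))
    {e f : Dual ℂ V} (hev : e v ≠ 0) (h : ∀ p ∈ K, e p = 0 → f p = 0 → p ∈ qrad (D.P i)) :
    False := by
  refine hs ⟨f - (f v / e v) • e, fun p hp hfp => ?_⟩
  have hp' : p = (p - (e p / e v) • v) + (e p / e v) • v := by simp
  rw [hp']
  refine Submodule.add_mem _ (h _ (K.sub_mem hp (K.smul_mem _ hv)) ?_ ?_)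
    (Submodule.smul_mem _ _ hvP)
  · simp only [map_sub, map_smul, smul_eq_mul]
    field_simp
    ring
  · simp only [LinearMap.sub_apply, LinearMap.smul_apply, smul_eq_mul] at hfp
    simp only [map_sub, map_smul, smul_eq_mul]
    linear_combination hfp

/-- If `P_i = c e + d f` with `c, d` vanishing on `K`, then `e, f` are independent on `K`. -/
lemma Spread.exists_dual (hs : D.Spread K i) {c d e f : Dual ℂ V}
    (hcd : ∀ v ∈ K, c v = 0 ∧ d v = 0) (h : ∀ p, D.P i p = c p * e p + d p * f p) :
    ∃ x ∈ K, ∃ y ∈ K, e x = 1 ∧ f x = 0 ∧ e y = 0 ∧ f y = 1 := by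
  refine (dependent_or_exists_dual K e f).resolve_left ?_
  rintro ⟨g, hg⟩
  refine hs ⟨g, fun p hp hgp => ?_⟩
  have := hg p hp hgp
  have := hcd p hp
  exact mem_qrad_of_apply_eq_zero h (by tauto) (by tauto) (by tauto) (by tauto)

/-- Two pairs of linear forms vanishing on `K`, on whose common zeros two spread quadratics that
are proportional up to `K`-invariant terms vanish, have the same zeros. -/
lemma Spread.apply_eq_zero (hs : D.Spread K i) {k : Fin m₂} {α : ℂ}
    (hpol : ∀ v ∈ K, ∀ p, (D.P i).polarBilin v p = α * (D.P k).polarBilin v p)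
    {c d c' d' : Dual ℂ V}
    (hcd : ∀ v ∈ K, c v = 0 ∧ d v = 0) (hcd' : ∀ v ∈ K, c' v = 0 ∧ d' v = 0)
    (h : ∀ p, c p = 0 → d p = 0 → D.P k p = 0) (h' : ∀ p, c' p = 0 → d' p = 0 → D.P i p = 0)
    {p : V} (hc : c p = 0) (hd : d p = 0) : c' p = 0 ∧ d' p = 0 := by
  obtain ⟨e, f, hef⟩ := exists_eq_mul_add_mul_of_vanish _ _ _ h
  obtain ⟨e', f', hef'⟩ := exists_eq_mul_add_mul_of_vanish _ _ _ h'
  obtain ⟨x, hx, y, hy, h1, h2, h3, h4⟩ := hs.exists_dual hcd' hef'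
  have hx' := hpol x hx p
  have hy' := hpol y hy p
  rw [polarBilin_eq_of_eq_mul_add_mul hef, polarBilin_eq_of_eq_mul_add_mul hef'] at hx' hy'
  simp only [hcd x hx, hcd y hy, hcd' x hx, hcd' y hy, h1, h2, h3, h4, hc, hd] at hx' hy'
  constructor
  · linear_combination hx'
  · linear_combination hy'

lemma prodClose_or_vanishOn (hrad : ∀ j, ∃ c : Dual ℂ V, ∀ p ∈ K, c p = 0 → p ∈ qrad (D.Q j))
    (hs : D.Spread K i) {j : Fin m₁} (hj : j ∈ D.exceptional K i) (ht : D.Typed i j) :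
    (K ≤ qrad (D.Q (some j)) ∧ D.ProdClose i j) ∨ D.VanishOn K i j := by
  obtain ⟨cj, hcj⟩ := hrad (some j)
  have hcomb : ∀ (F G : QuadraticForm ℂ V) (α β : ℂ), (∀ p, D.P i p = α * F p + β * G p) → ∀ v w,
      (D.P i).polarBilin v w = α * F.polarBilin v w + β * G.polarBilin v w := by
    intro F G α β h v w
    simp only [QuadraticMap.polarBilin_apply_apply, QuadraticMap.polar, h]
    ring
  have hcomb' : ∀ (F : QuadraticForm ℂ V) (α : ℂ) (c d : Dual ℂ V),
      (∀ p, D.P i p = α * F p + c p * d p) → ∀ v w,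
      (D.P i).polarBilin v w = α * F.polarBilin v w + (c v * d w + c w * d v) := by
    intro F α c d h v w
    simp only [QuadraticMap.polarBilin_apply_apply, QuadraticMap.polar, h, map_add]
    ring
  have hev : ∀ v ∈ K, v ∉ qrad (D.Q (some j)) → cj v ≠ 0 := fun v hv h1 h2 => h1 (hcj v hv h2)
  rcases ht with ⟨k, hk, α, β, h⟩ | ⟨α, hα, c, d, h⟩ | ⟨c, d, h⟩
  · exfalso
    have hα : α ≠ 0 := by
      rintro rfl
      have := D.PQ_indep i k 1 (-β) (fun p => by rw [h]; ring)
      simp at this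
    obtain ⟨ck, hck⟩ := hrad k
    have hmem : ∀ p, p ∈ qrad (D.Q (some j)) → p ∈ qrad (D.Q k) → p ∈ qrad (D.P i) := by
      intro p h1 h2
      rw [mem_qrad]
      intro w
      rw [hcomb _ _ _ _ h, mem_qrad.1 h1, mem_qrad.1 h2]
      ring
    rcases hj with hj | hj
    · exact hs ⟨ck, fun p hp hcp => hmem p (hj hp) (hck p hp hcp)⟩
    · obtain ⟨v, hv, hvj⟩ := SetLike.not_le_iff_exists.1 hj
      exact hs.false_of_hyperplane hv.1 hv.2 (hev v hv.1 hvj)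
        (fun p hp h1 h2 => hmem p (hcj p hp h1) (hck p hp h2))
  · by_cases hKj : K ≤ qrad (D.Q (some j))
    · exact Or.inl ⟨hKj, α, hα, c, d, h⟩
    exfalso
    obtain ⟨v, hv, hvj⟩ := SetLike.not_le_iff_exists.1 (hj.resolve_left hKj)
    have hH : ∀ p ∈ K ⊓ LinearMap.ker cj, p ∈ qrad (D.Q (some j)) := fun p hp => hcj p hp.1 hp.2
    rcases dependent_or_exists_dual (K ⊓ LinearMap.ker cj) c d with
      ⟨e, he⟩ | ⟨x, hx, y, hy, h1, h2, h3, h4⟩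
    · refine hs.false_of_hyperplane hv.1 hv.2 (hev v hv.1 hvj) (f := e) fun p hp hcp hep => ?_
      have := he p ⟨hp, hcp⟩ hep
      rw [mem_qrad]
      intro w
      rw [hcomb' _ _ _ _ h, mem_qrad.1 (hcj p hp hcp), this.1, this.2]
      ring
    · apply hvj
      have ex := hcomb' _ _ _ _ h v x
      have ey := hcomb' _ _ _ _ h v y
      rw [mem_qrad.1 hv.2, polarBilin_comm, mem_qrad.1 (hH x hx), h1, h2] at ex
      rw [mem_qrad.1 hv.2, polarBilin_comm, mem_qrad.1 (hH y hy), h3, h4] at ey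
      rw [mem_qrad]
      intro w
      have ew := hcomb' _ _ _ _ h v w
      have hdv : d v = 0 := by linear_combination -ex
      have hcv : c v = 0 := by linear_combination -ey
      rw [mem_qrad.1 hv.2, hdv, hcv] at ew
      refine (mul_eq_zero.1 (?_ : α * _ = 0)).resolve_left hα
      linear_combination -ew
  · refine Or.inr ⟨c, d, ?_, h⟩
    obtain ⟨e, f, hef⟩ := exists_eq_mul_add_mul_of_vanish (D.Q (some j)) c d
      (fun p h1 h2 => (h p h1 h2).2)
    obtain ⟨e', f', hef'⟩ := exists_eq_mul_add_mul_of_vanish (D.P i) c d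
      (fun p h1 h2 => (h p h1 h2).1)
    have hQ : ∀ v ∈ qrad (D.Q (some j)), c v = 0 ∧ d v = 0 := fun v hv =>
      have := apply_eq_zero_of_mem_qrad (D.Q_not_prod _) hef hv
      ⟨this.1, this.2.2.1⟩
    by_cases hKj : K ≤ qrad (D.Q (some j))
    · exact fun v hv => hQ v (hKj hv)
    obtain ⟨v, hv, hvj⟩ := SetLike.not_le_iff_exists.1 (hj.resolve_left hKj)
    have hPv := apply_eq_zero_of_mem_qrad (D.P_not_prod i) hef' hv.2
    have hcv := hev v hv.1 hvj
    intro w hw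
    have := hQ (w - (cj w / cj v) • v) (hcj _ (K.sub_mem hw (K.smul_mem _ hv.1)) (by
      simp only [map_sub, map_smul, smul_eq_mul]; field_simp; ring))
    simpa [hPv.1, hPv.2.2.1] using this

end QoForms

namespace QoForms

variable {V : Type*} [AddCommGroup V] [Module ℂ V] {m₁ m₂ : ℕ} {D : QoForms V m₁ m₂}
  {K : Submodule ℂ V} {i : Fin m₂}

lemma ncard_prodClose_le_one (hs : D.Spread K i) :
    {j | K ≤ qrad (D.Q (some j)) ∧ D.ProdClose i j}.ncard ≤ 1 := by
  refine (Set.ncard_le_one (Set.toFinite _)).2 ?_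
  rintro j ⟨hj, α, hα, c, d, h⟩ j' ⟨hj', α', hα', c', d', h'⟩
  by_contra hne
  have hpol : ∀ (j : Fin m₁) (α : ℂ) (c d : Dual ℂ V), K ≤ qrad (D.Q (some j)) →
      (∀ p, D.P i p = α * D.Q (some j) p + c p * d p) → ∀ v ∈ K, ∀ p,
      (D.P i).polarBilin v p = c v * d p + c p * d v := by
    intro j α c d hj h v hv p
    have e1 : (D.P i).polarBilin v p = α * (D.Q (some j)).polarBilin v p +
        (c v * d p + c p * d v) := by
      simp only [QuadraticMap.polarBilin_apply_apply, QuadraticMap.polar, h, map_add]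
      ring
    rw [e1, mem_qrad.1 (hj hv)]
    ring
  rcases dependent_or_exists_dual K c d with ⟨e, he⟩ | ⟨x, hx, y, hy, h1, h2, h3, h4⟩
  · refine hs ⟨e, fun p hp hep => mem_qrad.2 fun w => ?_⟩
    rw [hpol j α c d hj h p hp, (he p hp hep).1, (he p hp hep).2]
    ring
  · have hprod := mul_eq_mul_of_polar_eq (c' := c') (d' := d') hx hy h1 h2 h3 h4
      (fun v hv p => by rw [← hpol j α c d hj h v hv, ← hpol j' α' c' d' hj' h' v hv])
    have := D.QQ_indep (some j) (some j') (by simpa using hne) α (-α') (fun p => by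
      linear_combination -h p + h' p - hprod p)
    exact hα this.1

lemma ncard_exceptional_le_of_vanishOn
    (hrad : ∀ j, ∃ c : Dual ℂ V, ∀ p ∈ K, c p = 0 → p ∈ qrad (D.Q j))
    (hs : D.Spread K i) {N : ℕ} (hN : {j | D.VanishOn K i j}.ncard ≤ N) :
    (D.exceptional K i).ncard ≤ m₂ + 1 + N := by
  have hsub : D.exceptional K i ⊆ {j | ¬ D.Typed i j} ∪
      {j | K ≤ qrad (D.Q (some j)) ∧ D.ProdClose i j} ∪ {j | D.VanishOn K i j} := by
    intro j hj
    by_cases ht : D.Typed i j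
    · rcases prodClose_or_vanishOn hrad hs hj ht with h | h
      · exact Or.inl (Or.inr h)
      · exact Or.inr h
    · exact Or.inl (Or.inl ht)
  have h1 := Set.ncard_le_ncard hsub
  have h2 := Set.ncard_union_le ({j | ¬ D.Typed i j} ∪
      {j | K ≤ qrad (D.Q (some j)) ∧ D.ProdClose i j}) {j | D.VanishOn K i j}
  have h3 := Set.ncard_union_le {j | ¬ D.Typed i j}
      {j | K ≤ qrad (D.Q (some j)) ∧ D.ProdClose i j}
  have h4 := ncard_not_typed_le (D := D) i
  have h5 := ncard_prodClose_le_one hs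
  omega

lemma ncard_exceptional_le (hK : K ≤ qrad D.Qo)
    (hrad : ∀ j, ∃ c : Dual ℂ V, ∀ p ∈ K, c p = 0 → p ∈ qrad (D.Q j))
    (hs : D.Spread K i) : (D.exceptional K i).ncard ≤ 2 * m₂ + 1 := by
  by_cases hall : ∀ j, D.VanishOn K i j → VanishPair (D.Q (some j)) D.Qo
  · have := ncard_exceptional_le_of_vanishOn hrad hs
      ((Set.ncard_le_ncard (fun j hj => hall j hj)).trans D.card_vanishPair)
    omega
  push Not at hall
  obtain ⟨j, ⟨c, d, hcd, h⟩, hjo⟩ := hall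
  have hneq : ¬ ∀ p, c p = 0 → d p = 0 → D.Qo p = 0 := fun hc =>
    hjo ⟨c, d, fun p h1 h2 => ⟨(h p h1 h2).2, hc p h1 h2⟩⟩
  obtain ⟨k, hki, α, β, hk⟩ : ∃ k, k ≠ i ∧ ∃ α β : ℂ, D.P k = α • D.P i + β • D.Qo := by
    rcases D.PQ i none with ⟨k, hk, α, β, hk'⟩ | ⟨k, hk, α, β, hk'⟩ | h' | ⟨c', d', h'⟩
    · exact ⟨k, hk, α, β, by rw [hk', D.Q_none]⟩
    · exfalso
      have hp : ∀ p, α * D.P i p + (β - 1) * D.Qo p = D.a k p * D.b k p := by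
        intro p
        have := D.Q_apply k p
        rw [hk', D.Q_none] at this
        simp only [_root_.add_apply, _root_.smul_apply, smul_eq_mul] at this
        linear_combination this
      by_cases h0 : α ≠ 0 ∨ β - 1 ≠ 0
      · exact D.P_pencil i ⟨α, β - 1, h0, D.a k, D.b k, fun p => by rw [← hp p]; simp⟩
      · push Not at h0
        have := D.QQ_indep k none hk 1 (-1) (fun p => by
          have := hp p
          rw [D.Q_apply, D.Q_none, ← hp p, h0.1, h0.2]
          ring)
        simp at this
    · rw [D.Q_none] at h'
      exact absurd h' (D.P_pencil i)
    · exfalso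
      rw [D.Q_none] at h'
      obtain ⟨e, f, hef⟩ := exists_eq_mul_add_mul_of_vanish D.Qo c' d'
        (fun p h1 h2 => (h' p h1 h2).2)
      have hcd' : ∀ v ∈ K, c' v = 0 ∧ d' v = 0 := fun v hv =>
        have := apply_eq_zero_of_mem_qrad (D.Q_none ▸ D.Q_not_prod none) hef (hK hv)
        ⟨this.1, this.2.2.1⟩
      refine hneq fun p h1 h2 => ?_
      have := hs.apply_eq_zero (α := 1) (fun v _ p => (one_mul _).symm) hcd hcd'
        (fun p h1 h2 => (h p h1 h2).1) (fun p h1 h2 => (h' p h1 h2).1) h1 h2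
      exact (h' p this.1 this.2).2
  have hα : α ≠ 0 := by
    rintro rfl
    have := D.PQ_indep k none 1 (-β) (fun p => by rw [hk, D.Q_none]; simp)
    simp at this
  have hβ : β ≠ 0 := by
    rintro rfl
    have := D.PP_indep k i hki 1 (-α) (fun p => by rw [hk]; simp)
    simp at this
  have hpol : ∀ v ∈ K, ∀ p, (D.P k).polarBilin v p = α * (D.P i).polarBilin v p := by
    intro v hv p
    have : (D.P k).polarBilin v p = α * (D.P i).polarBilin v p + β * D.Qo.polarBilin v p := by
      rw [hk]
      simp only [QuadraticMap.polarBilin_apply_apply, QuadraticMap.polar, _root_.add_apply,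
        _root_.smul_apply, smul_eq_mul]
      ring
    rw [this, mem_qrad.1 (hK hv)]
    ring
  have hiff : ∀ v ∈ K, (v ∈ qrad (D.P k) ↔ v ∈ qrad (D.P i)) := by
    intro v hv
    rw [mem_qrad, mem_qrad]
    refine forall_congr' fun w => ?_
    rw [hpol v hv]
    simp [hα]
  have hs' : D.Spread K k := by
    rintro ⟨e, he⟩
    exact hs ⟨e, fun p hp hep => (hiff p hp).1 (he p hp hep)⟩
  have hX : D.exceptional K k = D.exceptional K i := by
    have : K ⊓ qrad (D.P k) = K ⊓ qrad (D.P i) := by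
      ext v
      simp only [Submodule.mem_inf]
      exact and_congr_right (hiff v)
    rw [exceptional, exceptional, this]
  have hempty : {j | D.VanishOn K k j}.ncard ≤ 0 := by
    rw [Nat.le_zero, Set.ncard_eq_zero, Set.eq_empty_iff_forall_notMem]
    rintro j' ⟨c', d', hcd', h'⟩
    refine hneq fun p h1 h2 => ?_
    have h3 := hs'.apply_eq_zero hpol hcd hcd' (fun p h1 h2 => (h p h1 h2).1)
      (fun p h1 h2 => (h' p h1 h2).1) h1 h2
    have h4 := (h' p h3.1 h3.2).1
    rw [hk] at h4
    simpa [(h p h1 h2).1, hβ] using h4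
  have := ncard_exceptional_le_of_vanishOn hrad hs' hempty
  rw [hX] at this
  omega

variable [FiniteDimensional ℂ V]

lemma codim_inf_qrad_P_le (hrad : ∀ j, ∃ c : Dual ℂ V, ∀ p ∈ K, c p = 0 → p ∈ qrad (D.Q j)) :
    codim (K ⊓ qrad (D.P i)) ≤ codim K + 4 := by
  obtain ⟨j, -, -, ht, -⟩ := exists_pair_typed (D := D) i i
  have key : ∀ e : Fin 4 → Dual ℂ V, (∀ p ∈ K, (∀ t, e t p = 0) → p ∈ qrad (D.P i)) →
      codim (K ⊓ qrad (D.P i)) ≤ codim K + 4 := by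
    intro e he
    have h1 := codim_ker_pi_le e
    rw [Fintype.card_fin] at h1
    have h2 := codim_inf_le K (LinearMap.ker (LinearMap.pi e))
    have h3 : K ⊓ LinearMap.ker (LinearMap.pi e) ≤ K ⊓ qrad (D.P i) := fun p hp =>
      ⟨hp.1, he p hp.1 fun t => congrFun (LinearMap.mem_ker.1 hp.2) t⟩
    have := codim_anti h3
    omega
  obtain ⟨cj, hcj⟩ := hrad (some j)
  rcases ht with ⟨k, -, α, β, h⟩ | ⟨α, -, c, d, h⟩ | ⟨c, d, h⟩
  · obtain ⟨ck, hck⟩ := hrad k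
    refine key ![cj, ck, 0, 0] fun p hp h0 => mem_qrad_of_forall_add fun w => ?_
    rw [h, h, qform_add_of_mem_qrad (hcj p hp (h0 0)), qform_add_of_mem_qrad (hck p hp (h0 1))]
  · refine key ![cj, c, d, 0] fun p hp h0 => mem_qrad_of_forall_add fun w => ?_
    have h1 : c p = 0 := h0 1
    have h2 : d p = 0 := h0 2
    rw [h, h, qform_add_of_mem_qrad (hcj p hp (h0 0)), map_add, map_add, h1, h2, add_zero, add_zero]
  · obtain ⟨e, f, hef⟩ := exists_eq_mul_add_mul_of_vanish _ c d (fun p h1 h2 => (h p h1 h2).1)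
    exact key ![c, e, d, f] fun p hp h0 =>
      mem_qrad_of_apply_eq_zero hef (h0 0) (h0 1) (h0 2) (h0 3)

lemma exists_common_direction_P_of_le_qrad (hK : K ≤ qrad D.Qo)
    (hrad : ∀ j, ∃ c : Dual ℂ V, ∀ p ∈ K, c p = 0 → p ∈ qrad (D.Q j)) :
    ∃ K' ≤ K, codim K' ≤ codim K + 4 ∧ ∀ i, ∃ c : Dual ℂ V, ∀ p ∈ K', c p = 0 →
      p ∈ qrad (D.P i) := by
  by_cases hall : ∀ i, ¬ D.Spread K i
  · exact ⟨K, le_rfl, by omega, fun i => not_not.1 (hall i)⟩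
  push Not at hall
  obtain ⟨i₀, hi₀⟩ := hall
  refine ⟨K ⊓ qrad (D.P i₀), inf_le_left, codim_inf_qrad_P_le hrad, fun i => ?_⟩
  by_contra hi
  have h1 := ncard_exceptional_le hK hrad hi₀
  have h2 := ncard_exceptional_le (K := K ⊓ qrad (D.P i₀)) (i := i) (inf_le_left.trans hK)
    (fun j => (hrad j).imp fun c hc p hp => hc p hp.1) hi
  have h3 : (D.exceptional K i₀)ᶜ ⊆ D.exceptional (K ⊓ qrad (D.P i₀)) i := by
    intro j hj
    simp only [exceptional, Set.mem_compl_iff, Set.mem_ofPred_eq, not_or, not_not] at hj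
    exact Or.inl hj.2
  have h4 := Set.ncard_le_ncard h3
  have h5 := Set.ncard_add_ncard_compl (D.exceptional K i₀)
  rw [Nat.card_fin] at h5
  have := D.lt_card
  omega

/-- There is a subspace `K` of bounded codimension such that, modulo `Q_o`, every quadratic is
invariant under a hyperplane of `K`. -/
lemma exists_adapted_subspace (D : QoForms V m₁ m₂) : ∃ K : Submodule ℂ V, codim K ≤ 27 ∧
    (K ≤ qrad D.Qo ∨ (codim K ≤ 7 ∧ 21 ≤ codim (qrad D.Qo))) ∧
    (∀ j, ∃ c : Dual ℂ V, ∀ p ∈ K, c p = 0 → p ∈ qrad (D.Q j - D.Qo)) ∧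
    ∀ i, ∃ γ : ℂ, ∃ c : Dual ℂ V, ∀ p ∈ K, c p = 0 → p ∈ qrad (D.P i - γ • D.Qo) := by
  have hab : ∀ j p, D.a j p = 0 ∧ D.b j p = 0 → p ∈ qrad (D.Q j - D.Qo) := by
    intro j p hp
    refine mem_qrad_of_apply_eq_zero (a := D.a j) (b := D.b j) (c := 0) (d := 0) (fun w => ?_)
      hp.1 hp.2 rfl rfl
    rw [_root_.sub_apply, D.Q_apply]
    simp
  by_cases hhigh : 21 ≤ codim (qrad D.Qo)
  · obtain ⟨K, -, hc, hdir⟩ := exists_common_direction (D := D) (K := ⊤) (Or.inr ⟨rfl, hhigh⟩)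
    obtain ⟨K', hKK, hc', hP⟩ := exists_common_direction_P_of_high hhigh hdir
    have : codim (⊤ : Submodule ℂ V) = 0 := by
      have := codim_add_finrank (⊤ : Submodule ℂ V)
      rw [finrank_top] at this
      omega
    refine ⟨K', by omega, Or.inr ⟨by omega, hhigh⟩, fun j => ?_, hP⟩
    obtain ⟨c, hc⟩ := hdir j
    exact ⟨c, fun p hp hcp => hab j p (hc p (hKK hp) hcp)⟩
  · obtain ⟨K, hK, hc, hdir⟩ := exists_common_direction (D := D) (K := qrad D.Qo) (Or.inl le_rfl)
    obtain ⟨K', hKK, hc', hP⟩ := exists_common_direction_P_of_le_qrad hK (fun j => by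
      obtain ⟨c, hc⟩ := hdir j
      refine ⟨c, fun p hp hcp => mem_qrad_of_forall_add fun w => ?_⟩
      rw [D.Q_apply, D.Q_apply, qform_add_of_mem_qrad (hK hp), map_add, map_add,
        (hc p hp hcp).1, (hc p hp hcp).2, add_zero, add_zero])
    refine ⟨K', by omega, Or.inl (hKK.trans hK), fun j => ?_, fun i => ?_⟩
    · obtain ⟨c, hc⟩ := hdir j
      exact ⟨c, fun p hp hcp => hab j p (hc p (hKK hp) hcp)⟩
    · obtain ⟨c, hc⟩ := hP i
      exact ⟨0, c, fun p hp hcp => by simpa using hc p hp hcp⟩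

end QoForms

section Lifts

variable {n : ℕ}

lemma exists_mem_forall_eval_ne_zero (S : Submodule ℂ (Fin n → ℂ))
    (F : Finset (MvPolynomial (Fin n) ℂ)) (h : ∀ f ∈ F, ∃ w ∈ S, eval w f ≠ 0) :
    ∃ w ∈ S, ∀ f ∈ F, eval w f ≠ 0 := by
  classical
  let b := finBasis ℂ S
  let A : (Fin (finrank ℂ S) → ℂ) →ₗ[ℂ] (Fin n → ℂ) := S.subtype ∘ₗ b.equivFun.symm.toLinearMap
  have hA : ∀ u, A u ∈ S := fun u => (b.equivFun.symm u).2
  have hA' : ∀ w ∈ S, ∃ u, A u = w := fun w hw => ⟨b.equivFun ⟨w, hw⟩, by simp [A]⟩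
  let ψ : MvPolynomial (Fin n) ℂ →ₐ[ℂ] MvPolynomial (Fin (finrank ℂ S)) ℂ :=
    aeval fun i => lpoly (LinearMap.proj i ∘ₗ A)
  have hψ : ∀ u f, eval u (ψ f) = eval (A u) f := by
    intro u f
    have : (eval u).comp (ψ : MvPolynomial (Fin n) ℂ →+* _) = eval (A u) := by
      refine MvPolynomial.ringHom_ext (fun r => ?_) fun i => ?_
      · simp [ψ]
      · simp [ψ, eval_lpoly]
    exact RingHom.congr_fun this f
  have hne : ∏ f ∈ F, ψ f ≠ 0 := by
    rw [Finset.prod_ne_zero_iff]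
    intro f hf h0
    obtain ⟨w, hw, hfw⟩ := h f hf
    obtain ⟨u, rfl⟩ := hA' w hw
    rw [← hψ, h0, map_zero] at hfw
    exact hfw rfl
  obtain ⟨u, hu⟩ : ∃ u, eval u (∏ f ∈ F, ψ f) ≠ 0 := by
    by_contra! hc
    exact hne (MvPolynomial.funext fun u => by rw [hc u, map_zero])
  refine ⟨A u, hA u, fun f hf => ?_⟩
  rw [map_prod, Finset.prod_ne_zero_iff] at hu
  rw [← hψ]
  exact hu f hf

/-- Points with prescribed values of the polynomials `Y`, moving only inside the common kernel of
two linear forms on `K`, can be found avoiding finitely many conditions on linear forms. -/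
def LiftProperty {δ : Type*} (K : Submodule ℂ (Fin n → ℂ)) (Y : δ → MvPolynomial (Fin n) ℂ) :
    Prop :=
  ∀ (c₁ c₂ : Dual ℂ (Fin n → ℂ)) (p₀ : Fin n → ℂ) (τ : δ → ℂ)
    (E : Finset (Dual ℂ (Fin n → ℂ))) (Z : Finset ℂ),
    (∀ e ∈ E, ∃ w ∈ K, c₁ w = 0 ∧ c₂ w = 0 ∧ e w ≠ 0) →
    ∃ w ∈ K, c₁ w = 0 ∧ c₂ w = 0 ∧ (∀ d, eval (p₀ + w) (Y d) = τ d) ∧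
      ∀ e ∈ E, ∀ z ∈ Z, e (p₀ + w) ≠ z

lemma liftProperty_of_isEmpty {δ : Type*} [IsEmpty δ] (K : Submodule ℂ (Fin n → ℂ))
    (Y : δ → MvPolynomial (Fin n) ℂ) : LiftProperty K Y := by
  classical
  intro c₁ c₂ p₀ τ E Z hE
  obtain ⟨w, ⟨hw, h1, h2⟩, h⟩ := exists_mem_forall_eval_ne_zero
    (K ⊓ (LinearMap.ker c₁ ⊓ LinearMap.ker c₂))
    ((E ×ˢ Z).image fun ez => lpoly ez.1 + C (ez.1 p₀ - ez.2)) (by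
      intro f hf
      obtain ⟨⟨e, z⟩, hez, rfl⟩ := Finset.mem_image.1 hf
      obtain ⟨w, hw, h1, h2, h3⟩ := hE e (Finset.mem_product.1 hez).1
      by_cases h0 : e p₀ - z = 0
      · exact ⟨w, ⟨hw, h1, h2⟩, by simpa [eval_lpoly, h0] using h3⟩
      · exact ⟨0, Submodule.zero_mem _, by
          rw [map_add, eval_lpoly, map_zero, eval_C, zero_add]
          exact h0⟩)
  refine ⟨w, hw, h1, h2, fun d => isEmptyElim d, fun e he z hz h0 => ?_⟩
  refine h _ (Finset.mem_image_of_mem _ (Finset.mk_mem_product he hz)) ?_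
  rw [map_add] at h0
  simp only [map_add, eval_lpoly, eval_C]
  linear_combination h0

lemma exists_isotropic_not_mem_radical {V : Type*} [AddCommGroup V] [Module ℂ V]
    [FiniteDimensional ℂ V] {Q : QuadraticForm ℂ V} {S : Submodule ℂ V}
    (h : 2 * (codim S + 1) < codim (qrad Q)) :
    ∃ v ∈ S, Q v = 0 ∧ ∃ w ∈ S, Q.polarBilin w v ≠ 0 := by
  let R : Submodule ℂ S := LinearMap.ker ((Q.polarBilin.domRestrict₁₂ S S))
  have hR : ∀ v : S, v ∈ R ↔ ∀ w ∈ S, Q.polarBilin v w = 0 := by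
    intro v
    rw [LinearMap.mem_ker]
    constructor
    · intro h w hw
      exact LinearMap.congr_fun h ⟨w, hw⟩
    · intro h
      ext w
      exact h w w.2
  have h1 := codim_qrad_le_of_vanish (Q := Q) (S := R.map S.subtype) (by
    rintro _ ⟨v, hv, rfl⟩
    have := (hR v).1 hv v v.2
    rw [polarBilin_self] at this
    simpa using this)
  obtain ⟨C, hC⟩ := R.exists_isCompl
  have h2 := codim_add_finrank (R.map S.subtype)
  have h3 := codim_add_finrank S
  rw [Submodule.finrank_map_subtype_eq] at h2
  have h4 := Submodule.finrank_add_eq_of_isCompl hC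
  obtain ⟨v, hv, hv0, hQv⟩ := exists_isotropic_of_two_le Q (S := C.map S.subtype) (by
    rw [Submodule.finrank_map_subtype_eq]
    omega)
  obtain ⟨u, hu, rfl⟩ := hv
  refine ⟨u, u.2, hQv, ?_⟩
  by_contra! hc
  have huR : u ∈ R := (hR u).2 fun w hw => by rw [polarBilin_comm]; exact hc w hw
  have : u = 0 := by simpa using hC.disjoint.le_bot ⟨huR, hu⟩
  exact hv0 (by simp [this])

lemma liftProperty_of_codim_lt {δ : Type*} [Subsingleton δ] {K : Submodule ℂ (Fin n → ℂ)}
    {Q : QuadraticForm ℂ (Fin n → ℂ)} (h : 2 * (codim K + 3) < codim (qrad Q)) :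
    LiftProperty K (fun _ : δ => qpoly Q) := by
  classical
  intro c₁ c₂ p₀ τ E Z hE
  rcases isEmpty_or_nonempty δ with hδ | ⟨⟨d₀⟩⟩
  · exact liftProperty_of_isEmpty K _ c₁ c₂ p₀ τ E Z hE
  set S := K ⊓ (LinearMap.ker c₁ ⊓ LinearMap.ker c₂) with hS
  have hcodim : codim S ≤ codim K + 2 := by
    have h1 := codim_inf_le K (LinearMap.ker c₁ ⊓ LinearMap.ker c₂)
    rw [← hS] at h1
    have h2 := codim_inf_le (LinearMap.ker c₁) (LinearMap.ker c₂)
    have h3 := codim_ker_le_one c₁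
    have h4 := codim_ker_le_one c₂
    omega
  obtain ⟨v, hv, hQv, w₀, hw₀, hB⟩ := exists_isotropic_not_mem_radical (Q := Q) (S := S) (by omega)
  let B : Dual ℂ (Fin n → ℂ) := Q.polarBilin v
  have hBw : ∀ w, Q.polarBilin w v = B w := fun w => polarBilin_comm Q w v
  rw [hBw] at hB
  have htr : ∀ w, Q (p₀ + w) = Q p₀ + Q w + Q.polarBilin p₀ w := fun w => qform_add Q p₀ w
  let G : Dual ℂ (Fin n → ℂ) → ℂ → MvPolynomial (Fin n) ℂ := fun e z =>
    (lpoly B + C (B p₀)) * (lpoly e + C (e p₀ - z)) +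
      C (e v) * (C (τ d₀ - Q p₀) - qpoly Q - lpoly (Q.polarBilin p₀))
  have hG : ∀ e z w, eval w (G e z) = B (p₀ + w) * (e (p₀ + w) - z) +
      e v * (τ d₀ - Q (p₀ + w)) := by
    intro e z w
    simp only [G, map_add, map_mul, map_sub, eval_lpoly, eval_C, eval_qpoly, htr]
    ring
  have hGne : ∀ e ∈ E, ∀ z, ∃ w ∈ S, eval w (G e z) ≠ 0 := by
    intro e he z
    obtain ⟨w, hw, hq⟩ : ∃ w ∈ S, B w * e w - e v * Q w ≠ 0 := by
      by_contra! hc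
      by_cases hev : e v = 0
      · rcases dual_eq_zero_on_of_mul_eq_zero (S := S) (f := B) (g := e) (fun p hp => by
          have := hc p hp
          rw [hev] at this
          linear_combination this) with h1 | h1
        · exact hB (h1 w₀ hw₀)
        · obtain ⟨w, hw, h2, h3, h4⟩ := hE e he
          exact h4 (h1 w ⟨hw, h2, h3⟩)
      · have h1 := codim_qrad_le_of_vanish (Q := Q) (S := S ⊓ LinearMap.ker B) (by
          intro p hp
          have h1 := hc p hp.1
          have h2 : B p = 0 := hp.2
          rw [h2] at h1
          refine (mul_eq_zero.1 (?_ : e v * Q p = 0)).resolve_left hev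
          linear_combination -h1)
        have h2 := codim_inf_le S (LinearMap.ker B)
        have h3 := codim_ker_le_one B
        omega
    by_contra! hc
    have e1 := hc w hw
    have e2 := hc (-w) (S.neg_mem hw)
    have e3 := hc 0 S.zero_mem
    rw [hG] at e1 e2 e3
    simp only [htr, map_add, map_neg, QuadraticMap.map_neg, add_zero] at e1 e2 e3
    refine hq ?_
    linear_combination (e1 + e2 - 2 * e3) / 2
  obtain ⟨w, hw, hwF⟩ := exists_mem_forall_eval_ne_zero S
    (insert (lpoly B + C (B p₀)) ((E ×ˢ Z).image fun ez => G ez.1 ez.2)) (by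
      intro f hf
      rcases Finset.mem_insert.1 hf with rfl | hf
      · by_cases h0 : B p₀ = 0
        · exact ⟨w₀, hw₀, by simpa [eval_lpoly, h0] using hB⟩
        · exact ⟨0, S.zero_mem, by
          rw [map_add, eval_lpoly, map_zero, eval_C, zero_add]
          exact h0⟩
      · obtain ⟨⟨e, z⟩, hez, rfl⟩ := Finset.mem_image.1 hf
        exact hGne e (Finset.mem_product.1 hez).1 z)
  have hBne : B (p₀ + w) ≠ 0 := by
    have := hwF _ (Finset.mem_insert_self _ _)
    simp only [map_add, eval_lpoly, eval_C] at this
    rwa [map_add, add_comm]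
  set s : ℂ := (τ d₀ - Q (p₀ + w)) / B (p₀ + w) with hs
  have hmem : w + s • v ∈ S := S.add_mem hw (S.smul_mem _ hv)
  refine ⟨w + s • v, hmem.1, hmem.2.1, hmem.2.2, fun d => ?_, fun e he z hz h0 => ?_⟩
  · rw [eval_qpoly, ← add_assoc, qform_add, qform_smul, hQv, map_smul, smul_eq_mul, hBw, hs,
      Subsingleton.elim d d₀]
    field_simp
    ring
  · refine hwF _ (Finset.mem_insert_of_mem
      (Finset.mem_image_of_mem _ (Finset.mk_mem_product he hz))) ?_
    rw [hG]
    rw [← add_assoc, map_add, map_smul, smul_eq_mul, hs] at h0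
    field_simp at h0
    linear_combination h0

end Lifts

section Coprime

open Polynomial in
/-- Gauss's lemma and Bézout over the fraction field: an irreducible polynomial over a unique
factorization domain which does not divide `H` generates with `H` a nonzero constant. -/
lemma exists_mul_add_mul_eq_C {B : Type*} [CommRing B] [IsDomain B] [UniqueFactorizationMonoid B]
    {G H : B[X]} (hG : Irreducible G) (hGH : ¬ G ∣ H) :
    ∃ d : B, d ≠ 0 ∧ ∃ u v : B[X], u * G + v * H = Polynomial.C d := by
  by_cases hdeg : G.natDegree = 0
  · obtain ⟨g, rfl⟩ := Polynomial.natDegree_eq_zero.1 hdeg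
    exact ⟨g, fun h => hG.ne_zero (by simp [h]), 1, 0, by simp⟩
  have : Nonempty (NormalizedGCDMonoid B) := inferInstance
  have hprim : G.IsPrimitive := hG.isPrimitive hdeg
  have hirr := (hprim.irreducible_iff_irreducible_map_fraction_map (K := FractionRing B)).1 hG
  have hdvd : ¬ G.map (algebraMap B (FractionRing B)) ∣ H.map (algebraMap B (FractionRing B)) :=
    fun h => hGH (hprim.dvd_of_fraction_map_dvd_fraction_map h)
  obtain ⟨a, b, hab⟩ := (hirr.isCoprime_or_dvd _).resolve_right hdvd
  obtain ⟨x, hx, hxa⟩ := IsLocalization.integerNormalization_spec (nonZeroDivisors B) a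
  obtain ⟨y, hy, hyb⟩ := IsLocalization.integerNormalization_spec (nonZeroDivisors B) b
  refine ⟨x * y, mul_ne_zero (nonZeroDivisors.ne_zero hx) (nonZeroDivisors.ne_zero hy),
    Polynomial.C y * IsLocalization.integerNormalization (nonZeroDivisors B) a,
    Polynomial.C x * IsLocalization.integerNormalization (nonZeroDivisors B) b,
    Polynomial.map_injective _ (IsFractionRing.injective B (FractionRing B)) ?_⟩
  simp only [Polynomial.map_add, Polynomial.map_mul, Polynomial.map_C, hxa, hyb, map_mul,
    ← algebraMap_smul (FractionRing B) x, ← algebraMap_smul (FractionRing B) y,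
    Polynomial.smul_eq_C_mul]
  linear_combination (Polynomial.C (algebraMap B (FractionRing B) x) *
    Polynomial.C (algebraMap B (FractionRing B) y)) * hab

end Coprime

section Fibers

variable {n : ℕ} {ι δ : Type*}

/-- Up to a linear combination of the polynomials `Y`, the polynomial `h` is invariant under
translations by `K`. -/
def FiberForm [Fintype δ] (K : Submodule ℂ (Fin n → ℂ)) (Y : δ → MvPolynomial (Fin n) ℂ)
    (h : MvPolynomial (Fin n) ℂ) : Prop :=
  ∃ (γ : δ → ℂ) (g : MvPolynomial (Fin n) ℂ), h = ∑ d, C (γ d) * Y d + g ∧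
    ∀ p, ∀ v ∈ K, eval (p + v) g = eval p g

lemma FiberForm.anti [Fintype δ] {K K' : Submodule ℂ (Fin n → ℂ)}
    {Y : δ → MvPolynomial (Fin n) ℂ} {h : MvPolynomial (Fin n) ℂ} (hh : FiberForm K Y h)
    (hK : K' ≤ K) : FiberForm K' Y h := by
  obtain ⟨γ, g, rfl, hg⟩ := hh
  exact ⟨γ, g, rfl, fun p v hv => hg p v (hK hv)⟩

/-- The point of the base below `p`: its image under `L` together with the values of `Y`. -/
noncomputable def basePoint (L : (Fin n → ℂ) →ₗ[ℂ] (ι → ℂ)) (Y : δ → MvPolynomial (Fin n) ℂ)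
    (p : Fin n → ℂ) : ι ⊕ δ → ℂ :=
  Sum.elim (L p) fun d => eval p (Y d)

/-- Pull back polynomials in one variable over the base, the variable being sent to the linear
form `c`. -/
noncomputable def basePullback (L : (Fin n → ℂ) →ₗ[ℂ] (ι → ℂ)) (Y : δ → MvPolynomial (Fin n) ℂ)
    (c : Dual ℂ (Fin n → ℂ)) :
    Polynomial (MvPolynomial (ι ⊕ δ) ℂ) →+* MvPolynomial (Fin n) ℂ :=
  Polynomial.eval₂RingHom
    (aeval (Sum.elim (fun i => lpoly (LinearMap.proj i ∘ₗ L)) Y)).toRingHom (lpoly c)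

lemma eval_basePullback (L : (Fin n → ℂ) →ₗ[ℂ] (ι → ℂ)) (Y : δ → MvPolynomial (Fin n) ℂ)
    (c : Dual ℂ (Fin n → ℂ)) (G : Polynomial (MvPolynomial (ι ⊕ δ) ℂ)) (p : Fin n → ℂ) :
    eval p (basePullback L Y c G) = (G.map (eval (basePoint L Y p))).eval (c p) := by
  have hC : ∀ b : MvPolynomial (ι ⊕ δ) ℂ,
      eval p (aeval (Sum.elim (fun i => lpoly (LinearMap.proj i ∘ₗ L)) Y) b) =
        eval (basePoint L Y p) b := by
    intro b
    induction b using MvPolynomial.induction_on with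
    | C a => simp
    | add f g hf hg => simp only [map_add, hf, hg]
    | mul_X f i hf =>
      simp only [map_mul, hf, aeval_X, eval_X]
      rcases i with i | d <;> simp [basePoint, eval_lpoly]
  induction G using Polynomial.induction_on' with
  | add f g hf hg => simp only [map_add, hf, hg, Polynomial.map_add, Polynomial.eval_add]
  | monomial k b =>
    simp only [basePullback, Polynomial.coe_eval₂RingHom, Polynomial.eval₂_monomial, map_mul,
      map_pow, eval_lpoly, Polynomial.map_monomial, Polynomial.eval_monomial]
    congr 1
    exact hC b

lemma exists_eval_eq_of_invariant [Fintype ι] (L : (Fin n → ℂ) →ₗ[ℂ] (ι → ℂ))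
    (hL : Function.Surjective L) (g : MvPolynomial (Fin n) ℂ)
    (hg : ∀ p v, L v = 0 → eval (p + v) g = eval p g) :
    ∃ b : MvPolynomial ι ℂ, ∀ p, eval (L p) b = eval p g := by
  classical
  obtain ⟨s, hs⟩ := L.exists_rightInverse_of_surjective (LinearMap.range_eq_top.2 hL)
  have hs' : ∀ y, L (s y) = y := fun y => LinearMap.congr_fun hs y
  refine ⟨aeval (fun k : Fin n => ∑ i, C (s (Pi.single i 1) k) * X i) g, fun p => ?_⟩
  have key : ∀ y f, eval y (aeval (fun k : Fin n => ∑ i, C (s (Pi.single i 1) k) * X i) f :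
      MvPolynomial ι ℂ) = eval (s y) f := by
    intro y f
    induction f using MvPolynomial.induction_on with
    | C a => simp
    | add f g hf hg => simp only [map_add, hf, hg]
    | mul_X f k hf =>
      simp only [map_mul, hf, aeval_X, eval_X, map_sum, eval_C]
      congr 1
      conv_rhs => rw [LinearMap.pi_apply_eq_sum_univ s y]
      rw [Finset.sum_apply]
      refine Finset.sum_congr rfl fun i _ => ?_
      rw [Pi.smul_apply, smul_eq_mul, mul_comm]
      have : (Pi.single i 1 : ι → ℂ) = fun j => if i = j then 1 else 0 := by
        ext j
        simp [Pi.single_apply, eq_comm]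
      rw [this]
  rw [key, ← hg p (s (L p) - p) (by rw [map_sub, hs', sub_self]), add_sub_cancel]

lemma surjective_option_of_exists_ne {L : (Fin n → ℂ) →ₗ[ℂ] (ι → ℂ)}
    (hL : Function.Surjective L) {c : Dual ℂ (Fin n → ℂ)} (hc : ∃ w, L w = 0 ∧ c w ≠ 0)
    (y : ι → ℂ) (z : ℂ) : ∃ p, L p = y ∧ c p = z := by
  obtain ⟨w, hw, hcw⟩ := hc
  obtain ⟨p, rfl⟩ := hL y
  exact ⟨p + ((z - c p) / c w) • w, by simp [hw], by simp [hcw]⟩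

lemma LiftProperty.exists_basePoint_eq {L : (Fin n → ℂ) →ₗ[ℂ] (ι → ℂ)}
    (hL : Function.Surjective L) {Y : δ → MvPolynomial (Fin n) ℂ}
    (hY : LiftProperty (LinearMap.ker L) Y) {c : Dual ℂ (Fin n → ℂ)}
    (hc : ∃ w, L w = 0 ∧ c w ≠ 0) (y : ι ⊕ δ → ℂ) (z : ℂ) :
    ∃ p, basePoint L Y p = y ∧ c p = z := by
  obtain ⟨p, h1, h2⟩ := surjective_option_of_exists_ne hL hc (y ∘ Sum.inl) z
  obtain ⟨w, hw, h3, -, h4, -⟩ := hY c 0 p (y ∘ Sum.inr) ∅ ∅ (by simp)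
  refine ⟨p + w, funext fun x => ?_, by rw [map_add, h2, h3, add_zero]⟩
  rcases x with i | d
  · simp [basePoint, h1, LinearMap.mem_ker.1 hw]
  · simpa [basePoint] using h4 d

lemma LiftProperty.basePullback_injective {L : (Fin n → ℂ) →ₗ[ℂ] (ι → ℂ)}
    (hL : Function.Surjective L) {Y : δ → MvPolynomial (Fin n) ℂ}
    (hY : LiftProperty (LinearMap.ker L) Y) {c : Dual ℂ (Fin n → ℂ)}
    (hc : ∃ w, L w = 0 ∧ c w ≠ 0) : Function.Injective (basePullback L Y c) := by
  rw [injective_iff_map_eq_zero]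
  intro G hG
  refine Polynomial.ext fun k => MvPolynomial.funext fun y => ?_
  have : G.map (eval y) = 0 := Polynomial.funext fun z => by
    obtain ⟨p, rfl, rfl⟩ := hY.exists_basePoint_eq hL hc y z
    rw [← eval_basePullback, hG, map_zero, Polynomial.eval_zero]
  rw [← Polynomial.coeff_map, this]
  simp

variable [Fintype ι] [Fintype δ]

lemma FiberForm.exists_base {L : (Fin n → ℂ) →ₗ[ℂ] (ι → ℂ)} (hL : Function.Surjective L)
    {Y : δ → MvPolynomial (Fin n) ℂ} {h : MvPolynomial (Fin n) ℂ}
    (hh : FiberForm (LinearMap.ker L) Y h) (h0 : h ≠ 0) :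
    ∃ b : MvPolynomial (ι ⊕ δ) ℂ, b ≠ 0 ∧ ∀ p, eval p h = 0 → eval (basePoint L Y p) b = 0 := by
  obtain ⟨γ, g, rfl, hg⟩ := hh
  obtain ⟨b, hb⟩ := exists_eval_eq_of_invariant L hL g fun p v hv => hg p v hv
  have key : ∀ p, eval (basePoint L Y p) (rename Sum.inl b + ∑ d, C (γ d) * X (Sum.inr d)) =
      eval p (∑ d, C (γ d) * Y d + g) := by
    intro p
    simp only [map_add, map_sum, map_mul, eval_C, eval_X, eval_rename, ← hb]
    rw [add_comm]
    rfl
  refine ⟨rename Sum.inl b + ∑ d, C (γ d) * X (Sum.inr d), fun hz => h0 ?_,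
    fun p hp => by rw [key, hp]⟩
  exact MvPolynomial.funext fun p => by rw [← key, hz, map_zero, map_zero]

lemma FiberForm.exists_pullback {L : (Fin n → ℂ) →ₗ[ℂ] (ι → ℂ)} (hL : Function.Surjective L)
    {Y : δ → MvPolynomial (Fin n) ℂ} {h : MvPolynomial (Fin n) ℂ} {c : Dual ℂ (Fin n → ℂ)}
    (hc : ∃ w, L w = 0 ∧ c w ≠ 0)
    (hh : FiberForm (LinearMap.ker L ⊓ LinearMap.ker c) Y h) :
    ∃ G, basePullback L Y c G = h := by
  obtain ⟨γ, g, rfl, hg⟩ := hh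
  let L' : (Fin n → ℂ) →ₗ[ℂ] (Option ι → ℂ) :=
    LinearMap.pi fun o => o.elim c fun i => LinearMap.proj i ∘ₗ L
  have hL' : Function.Surjective L' := by
    intro y
    obtain ⟨p, h1, h2⟩ := surjective_option_of_exists_ne hL hc (fun i => y (some i)) (y none)
    refine ⟨p, funext fun o => ?_⟩
    rcases o with _ | i
    · simp [L', h2]
    · simp [L', h1]
  obtain ⟨b, hb⟩ := exists_eval_eq_of_invariant L' hL' g fun p v hv => hg p v
    ⟨funext fun i => by simpa [L'] using congr_fun hv (some i),
      by simpa [L'] using congr_fun hv none⟩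
  refine ⟨aeval (fun o : Option ι => o.elim Polynomial.X fun i => Polynomial.C (X (Sum.inl i))) b +
    Polynomial.C (∑ d, C (γ d) * X (Sum.inr d)), MvPolynomial.funext fun p => ?_⟩
  have key : ∀ f : MvPolynomial (Option ι) ℂ, Polynomial.eval (c p) (Polynomial.map
      (eval (basePoint L Y p)) (aeval (fun o : Option ι => o.elim Polynomial.X
        fun i => Polynomial.C (X (Sum.inl i : ι ⊕ δ) : MvPolynomial (ι ⊕ δ) ℂ)) f)) =
      eval (L' p) f := by
    intro f
    induction f using MvPolynomial.induction_on with
    | C a => simp [MvPolynomial.algebraMap_eq, Polynomial.algebraMap_apply]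
    | add f g hf hg => simp only [map_add, Polynomial.map_add, Polynomial.eval_add, hf, hg]
    | mul_X f o hf =>
      simp only [map_mul, Polynomial.map_mul, Polynomial.eval_mul, hf, aeval_X, eval_X]
      rcases o with _ | i <;> simp [L', basePoint]
  rw [eval_basePullback, Polynomial.map_add, Polynomial.eval_add, key, hb]
  rw [Polynomial.map_C, Polynomial.eval_C]
  simp [basePoint, add_comm]

/-- Away from a hypersurface of the base, the zeros of `h` in a fiber are given by finitely many
values of `c`. -/
lemma FiberForm.exists_roots {L : (Fin n → ℂ) →ₗ[ℂ] (ι → ℂ)} (hL : Function.Surjective L)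
    {Y : δ → MvPolynomial (Fin n) ℂ} (hY : LiftProperty (LinearMap.ker L) Y)
    {h : MvPolynomial (Fin n) ℂ} {c : Dual ℂ (Fin n → ℂ)} (hc : ∃ w, L w = 0 ∧ c w ≠ 0)
    (hh : FiberForm (LinearMap.ker L ⊓ LinearMap.ker c) Y h)
    (hn : ¬ FiberForm (LinearMap.ker L) Y h) :
    ∃ b : MvPolynomial (ι ⊕ δ) ℂ, b ≠ 0 ∧ ∀ y, eval y b ≠ 0 → ∃ Z : Finset ℂ, Z.Nonempty ∧
      ∀ p, basePoint L Y p = y → (eval p h = 0 ↔ c p ∈ Z) := by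
  classical
  obtain ⟨G, hG⟩ := hh.exists_pullback hL hc
  have hdeg : G.natDegree ≠ 0 := by
    intro h0
    obtain ⟨b, rfl⟩ := Polynomial.natDegree_eq_zero.1 h0
    obtain ⟨γ, g, hhg, hg⟩ := hh
    refine hn ⟨γ, g, hhg, fun p v hv => ?_⟩
    obtain ⟨w, hw, h3, -, h4, -⟩ := hY c 0 (p + v) (fun d => eval p (Y d)) ∅ ∅ (by simp)
    have hbase : basePoint L Y (p + v + w) = basePoint L Y p := by
      funext x
      rcases x with i | d
      · simp [basePoint, LinearMap.mem_ker.1 hv, LinearMap.mem_ker.1 hw]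
      · simpa [basePoint] using h4 d
    have e : eval (p + v + w) h = eval p h := by
      rw [← hG, eval_basePullback, eval_basePullback, hbase]
      simp
    rw [hhg] at e
    simp only [map_add, map_sum, map_mul, eval_C, h4] at e
    rw [← hg (p + v) w ⟨hw, h3⟩]
    exact add_left_cancel e
  refine ⟨G.leadingCoeff, fun h0 => hdeg (by rw [Polynomial.leadingCoeff_eq_zero.1 h0]; simp),
    fun y hy => ⟨(G.map (eval y)).roots.toFinset, ?_, ?_⟩⟩
  · obtain ⟨z, hz⟩ := IsAlgClosed.exists_root (G.map (eval y)) (by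
      rw [Polynomial.degree_map_eq_of_leadingCoeff_ne_zero _ hy]
      exact fun h0 => hdeg (Polynomial.natDegree_eq_of_degree_eq_some h0))
    refine ⟨z, ?_⟩
    rw [Multiset.mem_toFinset, Polynomial.mem_roots']
    refine ⟨fun h0 => hy ?_, hz⟩
    rw [Polynomial.leadingCoeff, ← Polynomial.coeff_map, h0, Polynomial.coeff_zero]
  · rintro p rfl
    rw [Multiset.mem_toFinset, Polynomial.mem_roots', Polynomial.IsRoot, ← eval_basePullback, hG]
    refine ⟨fun h0 => ⟨fun hz => hy ?_, h0⟩, fun h0 => h0.2⟩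
    rw [Polynomial.leadingCoeff, ← Polynomial.coeff_map, hz, Polynomial.coeff_zero]

lemma FiberForm.exists_coprime {L : (Fin n → ℂ) →ₗ[ℂ] (ι → ℂ)} (hL : Function.Surjective L)
    {Y : δ → MvPolynomial (Fin n) ℂ} (hY : LiftProperty (LinearMap.ker L) Y)
    {h h' : MvPolynomial (Fin n) ℂ} {c : Dual ℂ (Fin n → ℂ)} (hc : ∃ w, L w = 0 ∧ c w ≠ 0)
    (hh : FiberForm (LinearMap.ker L ⊓ LinearMap.ker c) Y h)
    (hh' : FiberForm (LinearMap.ker L ⊓ LinearMap.ker c) Y h')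
    (hirr : Irreducible h) (hdvd : ¬ h ∣ h') :
    ∃ b : MvPolynomial (ι ⊕ δ) ℂ, b ≠ 0 ∧
      ∀ p, eval p h = 0 → eval p h' = 0 → eval (basePoint L Y p) b = 0 := by
  obtain ⟨G, rfl⟩ := hh.exists_pullback hL hc
  obtain ⟨H, rfl⟩ := hh'.exists_pullback hL hc
  have hinj := hY.basePullback_injective hL hc
  have hunit : ∀ A, IsUnit (basePullback L Y c A) → IsUnit A := by
    intro A hA
    obtain ⟨r, hr, hrA⟩ := MvPolynomial.isUnit_iff_eq_C_of_isReduced.1 hA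
    have : A = Polynomial.C (C r) := hinj (by
      rw [hrA]
      refine MvPolynomial.funext fun p => ?_
      rw [eval_basePullback]
      simp)
    rw [this]
    exact (hr.map C).map Polynomial.C
  have hGirr : Irreducible G :=
    ⟨fun hu => hirr.not_isUnit (hu.map _), fun A B hAB => by
      rcases hirr.isUnit_or_isUnit (a := basePullback L Y c A) (b := basePullback L Y c B)
        (by rw [hAB, map_mul]) with h | h
      · exact Or.inl (hunit _ h)
      · exact Or.inr (hunit _ h)⟩
  obtain ⟨b, hb, u, v, huv⟩ := exists_mul_add_mul_eq_C hGirr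
    (H := H) fun h => hdvd (map_dvd (basePullback L Y c) h)
  refine ⟨b, hb, fun p h1 h2 => ?_⟩
  have := congrArg (fun F => eval p (basePullback L Y c F)) huv
  simp only [map_add, map_mul, h1, h2, mul_zero, add_zero] at this
  rw [eval_basePullback] at this
  simpa using this.symm

end Fibers

section FiberConfiguration

lemma dualRestrict_mem_span_pair {V : Type*} [AddCommGroup V] [Module ℂ V] {K : Submodule ℂ V}
    {c₁ c₂ e : Dual ℂ V} (h : ∀ w ∈ K, c₁ w = 0 → c₂ w = 0 → e w = 0) :
    K.dualRestrict e ∈ Submodule.span ℂ {K.dualRestrict c₁, K.dualRestrict c₂} := by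
  have := mem_span_of_iInf_ker_le_ker (L := ![K.dualRestrict c₁, K.dualRestrict c₂])
    (K := K.dualRestrict e) (by
      intro w hw
      have h0 := (Submodule.mem_iInf _).1 hw 0
      have h1 := (Submodule.mem_iInf _).1 hw 1
      exact h w w.2 h0 h1)
  simpa [Matrix.range_cons, Matrix.range_empty, Set.pair_comm] using this

lemma dualRestrict_mem_span_singleton {V : Type*} [AddCommGroup V] [Module ℂ V]
    {K : Submodule ℂ V} {c e : Dual ℂ V} (h : ∀ w ∈ K, c w = 0 → e w = 0) :
    K.dualRestrict e ∈ Submodule.span ℂ {K.dualRestrict c} := by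
  simpa using dualRestrict_mem_span_pair (c₁ := c) (c₂ := c) fun w hw h1 _ => h w hw h1

lemma span_singleton_eq_of_mem_span_singleton {V : Type*} [AddCommGroup V] [Module ℂ V] {u e : V}
    (hu : u ≠ 0) (h : u ∈ Submodule.span ℂ {e}) : Submodule.span ℂ {u} = Submodule.span ℂ {e} := by
  obtain ⟨s, rfl⟩ := Submodule.mem_span_singleton.1 h
  exact Submodule.span_singleton_smul_eq (IsUnit.mk0 s fun h0 => hu (by simp [h0])) e

variable {n : ℕ} {ι δ κ : Type*} [Fintype ι] [Fintype δ] [Fintype κ]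

/-- A point of the base over which the fiber behaves generically for all members of a finite
family. -/
lemma exists_generic_base {L : (Fin n → ℂ) →ₗ[ℂ] (ι → ℂ)} (hL : Function.Surjective L)
    {Y : δ → MvPolynomial (Fin n) ℂ} (hY : LiftProperty (LinearMap.ker L) Y)
    {h : κ → MvPolynomial (Fin n) ℂ} (hirr : ∀ k, Irreducible (h k))
    (hdvd : ∀ k l, k ≠ l → ¬ h k ∣ h l) {c : κ → Dual ℂ (Fin n → ℂ)}
    (hc : ∀ k, FiberForm (LinearMap.ker L ⊓ LinearMap.ker (c k)) Y (h k))
    (hne : ∀ k, ¬ FiberForm (LinearMap.ker L) Y (h k) → ∃ w, L w = 0 ∧ c k w ≠ 0) :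
    ∃ y : ι ⊕ δ → ℂ,
      (∀ k, FiberForm (LinearMap.ker L) Y (h k) → ∀ p, basePoint L Y p = y → eval p (h k) ≠ 0) ∧
      (∀ k, ¬ FiberForm (LinearMap.ker L) Y (h k) → ∃ Z : Finset ℂ, Z.Nonempty ∧
        ∀ p, basePoint L Y p = y → (eval p (h k) = 0 ↔ c k p ∈ Z)) ∧
      ∀ k l, ¬ FiberForm (LinearMap.ker L) Y (h k) → k ≠ l →
        FiberForm (LinearMap.ker L ⊓ LinearMap.ker (c k)) Y (h l) →
        ∀ p, basePoint L Y p = y → eval p (h k) = 0 → eval p (h l) ≠ 0 := by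
  classical
  have h1 : ∀ k, ∃ b : MvPolynomial (ι ⊕ δ) ℂ, b ≠ 0 ∧ (FiberForm (LinearMap.ker L) Y (h k) →
      ∀ p, eval p (h k) = 0 → eval (basePoint L Y p) b = 0) := by
    intro k
    by_cases hk : FiberForm (LinearMap.ker L) Y (h k)
    · obtain ⟨b, hb, hbk⟩ := hk.exists_base hL (hirr k).ne_zero
      exact ⟨b, hb, fun _ => hbk⟩
    · exact ⟨1, one_ne_zero, fun h => absurd h hk⟩
  have h2 : ∀ k, ∃ b : MvPolynomial (ι ⊕ δ) ℂ, b ≠ 0 ∧ (¬ FiberForm (LinearMap.ker L) Y (h k) →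
      ∀ y, eval y b ≠ 0 → ∃ Z : Finset ℂ, Z.Nonempty ∧
        ∀ p, basePoint L Y p = y → (eval p (h k) = 0 ↔ c k p ∈ Z)) := by
    intro k
    by_cases hk : FiberForm (LinearMap.ker L) Y (h k)
    · exact ⟨1, one_ne_zero, fun h => absurd hk h⟩
    · obtain ⟨b, hb, hbk⟩ := (hc k).exists_roots hL hY (hne k hk) hk
      exact ⟨b, hb, fun _ => hbk⟩
  have h3 : ∀ k l, ∃ b : MvPolynomial (ι ⊕ δ) ℂ, b ≠ 0 ∧
      (¬ FiberForm (LinearMap.ker L) Y (h k) → k ≠ l →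
        FiberForm (LinearMap.ker L ⊓ LinearMap.ker (c k)) Y (h l) →
        ∀ p, eval p (h k) = 0 → eval p (h l) = 0 → eval (basePoint L Y p) b = 0) := by
    intro k l
    by_cases hk : ¬ FiberForm (LinearMap.ker L) Y (h k) ∧ k ≠ l ∧
      FiberForm (LinearMap.ker L ⊓ LinearMap.ker (c k)) Y (h l)
    · obtain ⟨b, hb, hbk⟩ := (hc k).exists_coprime hL hY (hne k hk.1) hk.2.2 (hirr k)
        (hdvd k l hk.2.1)
      exact ⟨b, hb, fun _ _ _ => hbk⟩
    · exact ⟨1, one_ne_zero, fun a b c => absurd ⟨a, b, c⟩ hk⟩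
  choose b₁ hb₁ hb₁' using h1
  choose b₂ hb₂ hb₂' using h2
  choose b₃ hb₃ hb₃' using h3
  have hne0 : (∏ k, b₁ k) * (∏ k, b₂ k) * ∏ k, ∏ l, b₃ k l ≠ 0 :=
    mul_ne_zero (mul_ne_zero (Finset.prod_ne_zero_iff.2 fun k _ => hb₁ k)
      (Finset.prod_ne_zero_iff.2 fun k _ => hb₂ k))
      (Finset.prod_ne_zero_iff.2 fun k _ => Finset.prod_ne_zero_iff.2 fun l _ => hb₃ k l)
  obtain ⟨y, hy⟩ : ∃ y, eval y ((∏ k, b₁ k) * (∏ k, b₂ k) * ∏ k, ∏ l, b₃ k l) ≠ 0 := by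
    by_contra! hcon
    exact hne0 (MvPolynomial.funext fun u => by rw [hcon u, map_zero])
  simp only [map_mul, map_prod, mul_ne_zero_iff, Finset.prod_ne_zero_iff, Finset.mem_univ,
    forall_true_left] at hy
  obtain ⟨⟨hy₁, hy₂⟩, hy₃⟩ := hy
  refine ⟨y, fun k hk p hp h0 => hy₁ k ?_, fun k hk => hb₂' k hk y (hy₂ k),
    fun k l hk hkl hl p hp h0 h0' => hy₃ k l ?_⟩
  · rw [← hp]
    exact hb₁' k hk p h0
  · rw [← hp]
    exact hb₃' k l hk hkl hl p h0 h0'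

/-- A finite family of irreducible polynomials, each depending on a single linear form modulo the
base and satisfying the Sylvester-Gallai covering condition, depends on boundedly many linear
forms modulo the base. -/
theorem exists_fiberForm_subspace {K : Submodule ℂ (Fin n → ℂ)} {Y : δ → MvPolynomial (Fin n) ℂ}
    (hY : LiftProperty K Y) {h : κ → MvPolynomial (Fin n) ℂ} (hirr : ∀ k, Irreducible (h k))
    (hdvd : ∀ k l, k ≠ l → ¬ h k ∣ h l)
    (hcover : ∀ i j, i ≠ j → ∀ p, eval p (h i) = 0 → eval p (h j) = 0 →
      ∃ k, k ≠ i ∧ k ≠ j ∧ eval p (h k) = 0)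
    (hform : ∀ k, ∃ c : Dual ℂ (Fin n → ℂ), FiberForm (K ⊓ LinearMap.ker c) Y (h k)) :
    ∃ K' : Submodule ℂ (Fin n → ℂ), codim K' ≤ codim K + 12 ∧ ∀ k, FiberForm K' Y (h k) := by
  classical
  choose c hc using hform
  obtain ⟨N, L, hL, rfl⟩ : ∃ (N : ℕ) (L : (Fin n → ℂ) →ₗ[ℂ] (Fin N → ℂ)),
      Function.Surjective L ∧ LinearMap.ker L = K := by
    let e := (finBasis ℂ ((Fin n → ℂ) ⧸ K)).equivFun
    refine ⟨_, e.toLinearMap ∘ₗ K.mkQ, e.surjective.comp K.mkQ_surjective, ?_⟩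
    rw [LinearMap.ker_comp, LinearEquiv.ker, Submodule.comap_bot, Submodule.ker_mkQ]
  have hne : ∀ k, ¬ FiberForm (LinearMap.ker L) Y (h k) → ∃ w, L w = 0 ∧ c k w ≠ 0 := by
    intro k hk
    by_contra! hcon
    exact hk ((hc k).anti fun w hw => ⟨hw, hcon w hw⟩)
  obtain ⟨y, hbase, hroots, hcop⟩ := exists_generic_base hL hY hirr hdvd hc hne
  let J := {k // ¬ FiberForm (LinearMap.ker L) Y (h k)}
  let v : J → Dual ℂ (LinearMap.ker L) := fun k => (LinearMap.ker L).dualRestrict (c k)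
  have hv0 : ∀ k, v k ≠ 0 := by
    intro k h0
    obtain ⟨w, hw, hcw⟩ := hne k k.2
    exact hcw (LinearMap.congr_fun h0 ⟨w, hw⟩)
  choose Z hZne hZ using fun k : J => hroots k k.2
  have hpar : ∀ i k : J, k ≠ i → ∀ p, basePoint L Y p = y → eval p (h i) = 0 →
      eval p (h k) = 0 → Submodule.span ℂ {v k} ≠ Submodule.span ℂ {v i} := by
    intro i k hki p hp hi hk heq
    refine hcop i k i.2 (fun h => hki (Subtype.ext h.symm)) ((hc k).anti fun w hw => ?_) p hp hi hk
    refine ⟨hw.1, ?_⟩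
    obtain ⟨s, hs⟩ := Submodule.mem_span_singleton.1 (heq ▸ Submodule.mem_span_singleton_self (v k))
    have := LinearMap.congr_fun hs ⟨w, hw.1⟩
    have h0 : c i w = 0 := hw.2
    change s * c i w = c k w at this
    rw [h0, mul_zero] at this
    exact this.symm
  have hSG := finrank_span_le_of_sylvesterGallai v hv0 (by
    intro i j hij
    rcases dependent_or_exists_dual (LinearMap.ker L) (c i) (c j) with
      ⟨e, he⟩ | ⟨x₁, hx₁, x₂, hx₂, h11, h12, h21, h22⟩
    · refine absurd ?_ hij
      rw [span_singleton_eq_of_mem_span_singleton (hv0 i)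
          (dualRestrict_mem_span_singleton fun w hw h0 => (he w hw h0).1),
        span_singleton_eq_of_mem_span_singleton (hv0 j)
          (dualRestrict_mem_span_singleton fun w hw h0 => (he w hw h0).2)]
    obtain ⟨zi, hzi⟩ := hZne i
    obtain ⟨zj, hzj⟩ := hZne j
    obtain ⟨q, hq⟩ := hL (y ∘ Sum.inl)
    obtain ⟨w, hw, hw1, hw2, hwY, hwE⟩ := hY (c i) (c j)
      (q + (zi - c i q) • x₁ + (zj - c j q) • x₂) (y ∘ Sum.inr)
      ((Finset.univ.filter fun m : J => ∃ w, L w = 0 ∧ c i w = 0 ∧ c j w = 0 ∧ c m w ≠ 0).image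
        fun m : J => c m.1) (Finset.univ.biUnion Z) (by
        intro e he
        obtain ⟨m, hm, rfl⟩ := Finset.mem_image.1 he
        exact (Finset.mem_filter.1 hm).2)
    set p := q + (zi - c i q) • x₁ + (zj - c j q) • x₂ + w with hp
    have hpy : basePoint L Y p = y := by
      funext x
      rcases x with x | d
      · simp [basePoint, hp, hq, LinearMap.mem_ker.1 hx₁, LinearMap.mem_ker.1 hx₂,
          LinearMap.mem_ker.1 hw]
      · simpa [basePoint] using hwY d
    have hpi : eval p (h i) = 0 := by
      rw [hZ i p hpy]
      simpa [hp, h11, h21, hw1] using hzi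
    have hpj : eval p (h j) = 0 := by
      rw [hZ j p hpy]
      simpa [hp, h12, h22, hw2] using hzj
    obtain ⟨k, hki, hkj, hpk⟩ := hcover i j (fun h => hij (by rw [Subtype.ext h])) p hpi hpj
    have hkJ : ¬ FiberForm (LinearMap.ker L) Y (h k) := fun hk => hbase k hk p hpy hpk
    have hki' : (⟨k, hkJ⟩ : J) ≠ i := fun h => hki (congrArg Subtype.val h)
    have hkj' : (⟨k, hkJ⟩ : J) ≠ j := fun h => hkj (congrArg Subtype.val h)
    refine ⟨⟨k, hkJ⟩, hpar i _ hki' p hpy hpi hpk, hpar j _ hkj' p hpy hpj hpk,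
      dualRestrict_mem_span_pair fun w hw h1 h2 => ?_⟩
    by_contra h3
    exact hwE (c k) (Finset.mem_image.2 ⟨⟨k, hkJ⟩, Finset.mem_filter.2
      ⟨Finset.mem_univ _, w, hw, h1, h2, h3⟩, rfl⟩) (c k p) (Finset.mem_biUnion.2
      ⟨⟨k, hkJ⟩, Finset.mem_univ _, (hZ ⟨k, hkJ⟩ p hpy).1 hpk⟩) rfl)
  refine ⟨(Submodule.span ℂ (Set.range v)).dualCoannihilator.map (LinearMap.ker L).subtype, ?_,
    fun k => ?_⟩
  · have h1 := Subspace.finrank_add_finrank_dualCoannihilator_eq (Submodule.span ℂ (Set.range v))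
    have h2 := codim_add_finrank (LinearMap.ker L)
    have h3 := codim_add_finrank
      ((Submodule.span ℂ (Set.range v)).dualCoannihilator.map (LinearMap.ker L).subtype)
    rw [Submodule.finrank_map_subtype_eq] at h3
    omega
  by_cases hk : FiberForm (LinearMap.ker L) Y (h k)
  · exact hk.anti (Submodule.map_subtype_le _ _)
  · refine (hc k).anti fun w hw => ⟨Submodule.map_subtype_le _ _ hw, ?_⟩
    obtain ⟨u, hu, rfl⟩ := hw
    exact (Submodule.mem_dualCoannihilator _).1 hu (v ⟨k, hk⟩)
      (Submodule.subset_span (Set.mem_range_self _))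

end FiberConfiguration

section SpanBound

variable {n : ℕ} {δ κ : Type*} [Fintype δ]

lemma fiberForm_of_invariant {K : Submodule ℂ (Fin n → ℂ)} (Y : δ → MvPolynomial (Fin n) ℂ)
    {h : MvPolynomial (Fin n) ℂ} (hh : ∀ p, ∀ v ∈ K, eval (p + v) h = eval p h) :
    FiberForm K Y h :=
  ⟨0, h, by simp, hh⟩

lemma fiberForm_of_le_qrad {K : Submodule ℂ (Fin n → ℂ)} {Q Qo : QuadraticForm ℂ (Fin n → ℂ)}
    {γ : ℂ} (h : K ≤ qrad (Q - γ • Qo)) : FiberForm K (fun _ : Unit => qpoly Qo) (qpoly Q) := by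
  refine ⟨fun _ => γ, qpoly (Q - γ • Qo), MvPolynomial.funext fun p => ?_, fun p v hv => ?_⟩
  · simp [eval_qpoly]
  · rw [eval_qpoly, eval_qpoly, qform_add_of_mem_qrad (h hv)]

lemma FiberForm.exists_eval_add_sub {K : Submodule ℂ (Fin n → ℂ)}
    {Qo : QuadraticForm ℂ (Fin n → ℂ)} {h : MvPolynomial (Fin n) ℂ}
    (hh : FiberForm K (fun _ : δ => qpoly Qo) h) :
    ∃ γ : ℂ, ∀ p, ∀ v ∈ K, eval (p + v) h - γ * Qo (p + v) = eval p h - γ * Qo p := by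
  obtain ⟨γ, g, rfl, hg⟩ := hh
  refine ⟨∑ d, γ d, fun p v hv => ?_⟩
  simp only [map_add, map_sum, map_mul, eval_C, eval_qpoly, Finset.sum_mul, hg p v hv]
  ring

/-- Quadratics which are invariant under `K` modulo `Q_o`, and squares of linear forms which are,
span a space of dimension at most `(codim K)² + 1`. -/
lemma finrank_span_le_of_fiberForm {K : Submodule ℂ (Fin n → ℂ)}
    {Qo : QuadraticForm ℂ (Fin n → ℂ)} {f : κ → MvPolynomial (Fin n) ℂ}
    (hf : ∀ k, (∃ Q, f k = qpoly Q ∧ FiberForm K (fun _ : δ => qpoly Qo) (qpoly Q)) ∨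
      ∃ l, f k = lpoly l ^ 2 ∧ FiberForm K (fun _ : δ => qpoly Qo) (lpoly l)) :
    finrank ℂ (Submodule.span ℂ (Set.range f)) ≤ codim K * codim K + 1 := by
  classical
  let B : Basis (Fin (codim K)) ℂ ((Fin n → ℂ) ⧸ K) := finBasis ℂ ((Fin n → ℂ) ⧸ K)
  let e : Fin (codim K) → Dual ℂ (Fin n → ℂ) := fun i => B.coord i ∘ₗ K.mkQ
  obtain ⟨s, hs⟩ : ∃ s : Fin (codim K) → Fin n → ℂ, ∀ p, p - ∑ i, e i p • s i ∈ K := by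
    choose s hs using fun i => K.mkQ_surjective (B i)
    refine ⟨s, fun p => (Submodule.Quotient.mk_eq_zero K).1 ?_⟩
    change K.mkQ (p - ∑ i, e i p • s i) = 0
    rw [map_sub, map_sum, sub_eq_zero]
    simp only [map_smul, hs]
    exact (B.sum_repr _).symm
  let W : Option (Fin (codim K) × Fin (codim K)) → MvPolynomial (Fin n) ℂ := fun o =>
    o.elim (qpoly Qo) fun ij => lpoly (e ij.1) * lpoly (e ij.2)
  have hW : ∀ t : Fin (codim K) → Fin (codim K) → ℂ,
      ∑ i, ∑ j, t i j • (lpoly (e i) * lpoly (e j)) ∈ Submodule.span ℂ (Set.range W) := fun t =>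
    Submodule.sum_mem _ fun i _ => Submodule.sum_mem _ fun j _ => Submodule.smul_mem _ _
      (Submodule.subset_span ⟨some (i, j), rfl⟩)
  have hle : Submodule.span ℂ (Set.range f) ≤ Submodule.span ℂ (Set.range W) := by
    rw [Submodule.span_le]
    rintro _ ⟨k, rfl⟩
    rcases hf k with ⟨Q, hk, hQ⟩ | ⟨l, hk, hl⟩
    · obtain ⟨γ, hγ⟩ := hQ.exists_eval_add_sub
      have hrad : ∀ v ∈ K, v ∈ qrad (Q - γ • Qo) := fun v hv => mem_qrad_of_forall_add fun p => by
        have := hγ p v hv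
        simpa [eval_qpoly] using this
      have hQp : ∀ p, Q p = γ * Qo p + ∑ i, ∑ j,
          (2⁻¹ * (Q - γ • Qo).polarBilin (s i) (s j)) * (e i p * e j p) := by
        intro p
        have h1 := qform_add_of_mem_qrad (hrad _ (hs p)) (∑ i, e i p • s i)
        rw [add_sub_cancel] at h1
        have h2 := polarBilin_self (Q - γ • Qo) (∑ i, e i p • s i)
        rw [← h1] at h2
        simp only [map_sum, map_smul, LinearMap.sum_apply, LinearMap.smul_apply, smul_eq_mul,
          Finset.mul_sum] at h2
        have h3 : (Q - γ • Qo) p = Q p - γ * Qo p := by simp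
        rw [h3] at h2
        have h4 : Q p - γ * Qo p = 2⁻¹ * (2 * (Q p - γ * Qo p)) := by ring
        rw [← sub_eq_iff_eq_add', h4, ← h2, Finset.mul_sum]
        rw [Finset.sum_comm]
        refine Finset.sum_congr rfl fun i _ => ?_
        rw [Finset.mul_sum]
        refine Finset.sum_congr rfl fun j _ => ?_
        ring
      have : f k = γ • qpoly Qo + ∑ i, ∑ j, (2⁻¹ * (Q - γ • Qo).polarBilin (s i) (s j)) •
          (lpoly (e i) * lpoly (e j)) := by
        rw [hk]
        refine MvPolynomial.funext fun p => ?_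
        simp only [map_add, map_sum, smul_eval, map_mul, eval_qpoly, eval_lpoly]
        exact hQp p
      rw [this]
      exact Submodule.add_mem _ (Submodule.smul_mem _ _ (Submodule.subset_span ⟨none, rfl⟩)) (hW _)
    · obtain ⟨γ, hγ⟩ := hl.exists_eval_add_sub
      have hlK : ∀ v ∈ K, l v = 0 := by
        intro v hv
        have h1 := hγ 0 v hv
        have h2 := hγ 0 ((2 : ℂ) • v) (K.smul_mem _ hv)
        simp only [zero_add, eval_lpoly, qform_smul, map_smul, smul_eq_mul, map_zero] at h1 h2
        linear_combination 2 * h1 - 2⁻¹ * h2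
      have hlp : ∀ p, l p = ∑ i, e i p * l (s i) := by
        intro p
        have := hlK _ (hs p)
        rw [map_sub, sub_eq_zero] at this
        rw [this]
        simp
      have : f k = ∑ i, ∑ j, (l (s i) * l (s j)) • (lpoly (e i) * lpoly (e j)) := by
        rw [hk]
        refine MvPolynomial.funext fun p => ?_
        simp only [map_sum, smul_eval, map_mul, map_pow, eval_lpoly]
        rw [hlp p, sq, Finset.sum_mul_sum]
        refine Finset.sum_congr rfl fun i _ => Finset.sum_congr rfl fun j _ => ?_
        ring
      rw [this]
      exact hW _
  have : FiniteDimensional ℂ (Submodule.span ℂ (Set.range W)) :=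
    FiniteDimensional.span_of_finite ℂ (Set.finite_range W)
  refine (Submodule.finrank_mono hle).trans ((finrank_range_le_card W).trans ?_)
  simp

/-- The dimension bound for families satisfying the covering condition whose members are, up to
squaring, the quadratics of `D` or linear forms. -/
theorem QoForms.finrank_span_le {m₁ m₂ : ℕ} (D : QoForms (Fin n → ℂ) m₁ m₂) [Fintype κ]
    {h f : κ → MvPolynomial (Fin n) ℂ} (hirr : ∀ k, Irreducible (h k))
    (hdvd : ∀ k l, k ≠ l → ¬ h k ∣ h l)
    (hcover : ∀ i j, i ≠ j → ∀ p, eval p (h i) = 0 → eval p (h j) = 0 →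
      ∃ k, k ≠ i ∧ k ≠ j ∧ eval p (h k) = 0)
    (hf : ∀ k, (∃ j, h k = qpoly (D.Q j) ∧ f k = h k) ∨ (∃ i, h k = qpoly (D.P i) ∧ f k = h k) ∨
      ∃ l, h k = lpoly l ∧ f k = h k ^ 2) :
    finrank ℂ (Submodule.span ℂ (Set.range f)) ≤ 39 * 39 + 1 := by
  obtain ⟨K, hK, hcase, hQ, hP⟩ := D.exists_adapted_subspace
  have hbound : ∀ (δ : Type) [Fintype δ] (K' : Submodule ℂ (Fin n → ℂ)), codim K' ≤ codim K + 12 →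
      (∀ k, FiberForm K' (fun _ : δ => qpoly D.Qo) (h k)) →
      finrank ℂ (Submodule.span ℂ (Set.range f)) ≤ 39 * 39 + 1 := by
    intro δ _ K' hK' hform
    have := finrank_span_le_of_fiberForm (κ := κ) (δ := δ) (K := K') (Qo := D.Qo) (f := f) (by
      intro k
      have hk := hform k
      rcases hf k with ⟨j, h1, h2⟩ | ⟨i, h1, h2⟩ | ⟨l, h1, h2⟩
      · exact Or.inl ⟨_, h2.trans h1, h1 ▸ hk⟩
      · exact Or.inl ⟨_, h2.trans h1, h1 ▸ hk⟩
      · exact Or.inr ⟨_, by rw [h2, h1], h1 ▸ hk⟩)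
    have h39 : codim K' ≤ 39 := by omega
    exact this.trans (Nat.add_le_add_right (Nat.mul_le_mul h39 h39) 1)
  have hlin : ∀ l : Dual ℂ (Fin n → ℂ), ∀ p, ∀ v ∈ K ⊓ LinearMap.ker l,
      eval (p + v) (lpoly l) = eval p (lpoly l) := by
    intro l p v hv
    have : l v = 0 := hv.2
    rw [eval_lpoly, eval_lpoly, map_add, this, add_zero]
  rcases hcase with hlow | ⟨h7, h21⟩
  · have hinv : ∀ (Q : QuadraticForm ℂ (Fin n → ℂ)) (γ : ℂ) (c : Dual ℂ (Fin n → ℂ)),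
        (∀ p ∈ K, c p = 0 → p ∈ qrad (Q - γ • D.Qo)) → ∀ p, ∀ v ∈ K ⊓ LinearMap.ker c,
          eval (p + v) (qpoly Q) = eval p (qpoly Q) := by
      intro Q γ c hc p v hv
      have h1 := qform_add_of_mem_qrad (hc v hv.1 hv.2) p
      have h2 := qform_add_of_mem_qrad (hlow hv.1) p
      simp only [_root_.sub_apply, _root_.smul_apply, smul_eq_mul] at h1
      rw [eval_qpoly, eval_qpoly]
      linear_combination h1 + γ * h2
    obtain ⟨K', hK', hform⟩ := exists_fiberForm_subspace
      (liftProperty_of_isEmpty K fun _ : Empty => qpoly D.Qo) hirr hdvd hcover (by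
        intro k
        rcases hf k with ⟨j, h1, -⟩ | ⟨i, h1, -⟩ | ⟨l, h1, -⟩ <;> rw [h1]
        · obtain ⟨c, hc⟩ := hQ j
          exact ⟨c, fiberForm_of_invariant _ (hinv _ 1 c (by simpa using hc))⟩
        · obtain ⟨γ, c, hc⟩ := hP i
          exact ⟨c, fiberForm_of_invariant _ (hinv _ γ c hc)⟩
        · exact ⟨l, fiberForm_of_invariant _ (hlin l)⟩)
    exact hbound Empty K' hK' hform
  · obtain ⟨K', hK', hform⟩ := exists_fiberForm_subspace
      (liftProperty_of_codim_lt (δ := Unit) (K := K) (Q := D.Qo) (by omega)) hirr hdvd hcover (by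
        intro k
        rcases hf k with ⟨j, h1, -⟩ | ⟨i, h1, -⟩ | ⟨l, h1, -⟩ <;> rw [h1]
        · obtain ⟨c, hc⟩ := hQ j
          exact ⟨c, fiberForm_of_le_qrad (γ := 1) fun p hp => by simpa using hc p hp.1 hp.2⟩
        · obtain ⟨γ, c, hc⟩ := hP i
          exact ⟨c, fiberForm_of_le_qrad fun p hp => hc p hp.1 hp.2⟩
        · exact ⟨l, fiberForm_of_invariant _ (hlin l)⟩)
    exact hbound Unit K' hK' hform

end SpanBound

section Translation

variable {n : ℕ}

lemma irreducible_of_isHomogeneous_one {l : MvPolynomial (Fin n) ℂ} (h : l.IsHomogeneous 1)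
    (h0 : l ≠ 0) : Irreducible l := by
  refine irreducible_of_totalDegree_eq_one (h.totalDegree h0) fun x hx => ?_
  obtain ⟨d, hd⟩ := exists_coeff_ne_zero h0
  exact (ne_zero_of_dvd_ne_zero hd (hx d)).isUnit

lemma eq_C_mul_of_dvd {f g : MvPolynomial (Fin n) ℂ} (hf : Irreducible f) (hg : Irreducible g)
    (h : f ∣ g) : ∃ u : ℂ, g = C u * f := by
  obtain ⟨t, rfl⟩ := h
  obtain ⟨u, -, rfl⟩ := MvPolynomial.isUnit_iff_eq_C_of_isReduced.1
    ((hg.isUnit_or_isUnit rfl).resolve_left hf.not_isUnit)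
  exact ⟨u, mul_comm _ _⟩

lemma eq_zero_of_linearIndependent_qpoly {A B : QuadraticForm ℂ (Fin n → ℂ)}
    (h : LinearIndependent ℂ ![qpoly A, qpoly B]) (α β : ℂ)
    (h0 : ∀ p, α * A p + β * B p = 0) : α = 0 ∧ β = 0 := by
  refine LinearIndependent.pair_iff.1 h α β (MvPolynomial.funext fun p => ?_)
  simpa [smul_eval, eval_qpoly] using h0 p

lemma rankS_le_one_of_isProdForm {Q : QuadraticForm ℂ (Fin n → ℂ)} (h : IsProdForm Q) :
    rankS (qpoly Q) ≤ 1 := by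
  obtain ⟨a, b, hab⟩ := h
  exact Nat.sInf_le ⟨fun _ => lpoly a, fun _ => lpoly b, fun _ => isHomogeneous_lpoly a,
    fun _ => isHomogeneous_lpoly b, by simpa using qpoly_eq_lpoly_mul_lpoly hab⟩

lemma qpoly_mem_span_pair_of_vanish {Q : QuadraticForm ℂ (Fin n → ℂ)}
    {c d : Dual ℂ (Fin n → ℂ)} (h : ∀ p, c p = 0 → d p = 0 → Q p = 0) :
    qpoly Q ∈ Ideal.span {lpoly c, lpoly d} := by
  obtain ⟨e, f, hef⟩ := exists_eq_mul_add_mul_of_vanish Q c d h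
  refine Ideal.mem_span_pair.2 ⟨lpoly e, lpoly f, MvPolynomial.funext fun p => ?_⟩
  simp only [map_add, map_mul, eval_lpoly, eval_qpoly, hef p]
  ring

lemma exists_eval_eq_zero_of_prod_mem_radical {κ : Type*} {s : Finset κ}
    {f : κ → MvPolynomial (Fin n) ℂ} {g g' : MvPolynomial (Fin n) ℂ}
    (h : ∏ k ∈ s, f k ∈ (Ideal.span {g, g'}).radical) {p : Fin n → ℂ} (hg : eval p g = 0)
    (hg' : eval p g' = 0) : ∃ k ∈ s, eval p (f k) = 0 := by
  obtain ⟨N, hN⟩ := h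
  obtain ⟨a, b, hab⟩ := Ideal.mem_span_pair.1 hN
  have := congrArg (eval p) hab
  rw [map_add, map_mul, map_mul, hg, hg', mul_zero, mul_zero, add_zero, map_pow, map_prod] at this
  exact Finset.prod_eq_zero_iff.1 (eq_zero_of_pow_eq_zero this.symm)

end Translation

namespace IsQoSet

variable {n m₁ m₂ r : ℕ} {Qo : MvPolynomial (Fin n) ℂ} {Qs : Fin m₁ → MvPolynomial (Fin n) ℂ}
  {Ps : Fin m₂ → MvPolynomial (Fin n) ℂ} {ls : Fin r → MvPolynomial (Fin n) ℂ}

lemma isHomogeneous_QoFam (h : IsQoSet m₁ m₂ r Qo Qs Ps ls)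
    (k : Unit ⊕ Fin m₁ ⊕ Fin m₂ ⊕ Fin r) : (QoFam Qo Qs Ps ls k).IsHomogeneous 2 := by
  obtain ⟨h1, h2, h3, h4, -⟩ := h
  rcases k with _ | j | i | t
  exacts [h1.1, (h2 j).1, (h3 i).1, (h4 t).pow 2]

lemma ls_ne_zero (h : IsQoSet m₁ m₂ r Qo Qs Ps ls) (t : Fin r) : ls t ≠ 0 := by
  obtain ⟨-, -, -, -, h5, -⟩ := h
  intro h0
  refine (h5 (Sum.inr (Sum.inr (Sum.inr t))) (Sum.inl ()) (by simp)).ne_zero 0 ?_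
  simp [QoFam, h0]

/-- The member of the family attached to an index of `𝒬₁`, where `none` stands for `Q_o`. -/
def idx (m₁ m₂ r : ℕ) (o : Option (Fin m₁)) : Unit ⊕ Fin m₁ ⊕ Fin m₂ ⊕ Fin r :=
  o.elim (Sum.inl ()) fun j => Sum.inr (Sum.inl j)

lemma idx_injective : Function.Injective (idx m₁ m₂ r) := by
  rintro (_ | i) (_ | j) <;> simp [idx]

lemma exists_pencil (h : IsQoSet m₁ m₂ r Qo Qs Ps ls)
    {R : Unit ⊕ Fin m₁ ⊕ Fin m₂ ⊕ Fin r → QuadraticForm ℂ (Fin n → ℂ)}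
    (hR : ∀ k, QoFam Qo Qs Ps ls k = qpoly (R k)) {i j : Unit ⊕ Fin m₁ ⊕ Fin m₂ ⊕ Fin r}
    (hij : i ≠ j) :
    (∃ k : Fin m₂, Sum.inr (Sum.inr (Sum.inl k)) ≠ i ∧ Sum.inr (Sum.inr (Sum.inl k)) ≠ j ∧
      ∃ α β : ℂ, R (Sum.inr (Sum.inr (Sum.inl k))) = α • R i + β • R j) ∨
    (∃ k : Option (Fin m₁), idx m₁ m₂ r k ≠ i ∧ idx m₁ m₂ r k ≠ j ∧
      ∃ α β : ℂ, R (idx m₁ m₂ r k) = α • R i + β • R j) ∨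
    PencilProd (R i) (R j) ∨ VanishPair (R i) (R j) := by
  have hls := h.ls_ne_zero
  obtain ⟨-, -, -, h4, -, h6, -⟩ := h
  have hrad := h6 i j hij
  simp only [hR] at hrad
  rcases pencil_of_prod_mem_radical hrad with ⟨k, hk, α, β, hαβ⟩ | hp
  · have hkj : k ≠ j := (Finset.mem_erase.1 hk).1
    have hki : k ≠ i := (Finset.mem_erase.1 (Finset.mem_erase.1 hk).2).1
    rcases k with _ | k | k | t
    · exact Or.inr (Or.inl ⟨none, hki, hkj, α, β, hαβ⟩)
    · exact Or.inr (Or.inl ⟨some k, hki, hkj, α, β, hαβ⟩)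
    · exact Or.inl ⟨k, hki, hkj, α, β, hαβ⟩
    · obtain ⟨l, hl⟩ := exists_eq_lpoly (h4 t)
      have hRl : ∀ p, R (Sum.inr (Sum.inr (Sum.inr t))) p = l p * l p := by
        intro p
        rw [← eval_qpoly, ← hR]
        simp [QoFam, hl, eval_lpoly, sq]
      refine Or.inr (Or.inr (Or.inl ⟨α, β, ?_, l, l, fun p => by rw [← hαβ, hRl]⟩))
      by_contra! h0
      refine hls t (MvPolynomial.funext fun p => ?_)
      have := hRl p
      rw [hαβ, h0.1, h0.2] at this
      rw [hl, eval_lpoly, map_zero]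
      simpa using this.symm
  · exact Or.inr (Or.inr hp)

lemma exists_qoForms (h : IsQoSet m₁ m₂ r Qo Qs Ps ls) :
    ∃ D : QoForms (Fin n → ℂ) m₁ m₂, Qo = qpoly (D.Q none) ∧ (∀ j, Qs j = qpoly (D.Q (some j))) ∧
      ∀ i, Ps i = qpoly (D.P i) := by
  choose R hR using fun k => exists_eq_qpoly (h.isHomogeneous_QoFam k)
  have hpencil := fun i j => h.exists_pencil hR (i := i) (j := j)
  obtain ⟨h1, h2, h3, h4, h5, h6, h7, h8, h9, h10⟩ := h
  choose A B hA hB hAB using h8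
  choose a ha using fun j => exists_eq_lpoly (hA j)
  choose b hb using fun j => exists_eq_lpoly (hB j)
  have hRo : Qo = qpoly (R (Sum.inl ())) := hR (Sum.inl ())
  have hRQ : ∀ j, Qs j = qpoly (R (Sum.inr (Sum.inl j))) := fun j => hR (Sum.inr (Sum.inl j))
  have hRP : ∀ i, Ps i = qpoly (R (Sum.inr (Sum.inr (Sum.inl i)))) := fun i =>
    hR (Sum.inr (Sum.inr (Sum.inl i)))
  have hindep : ∀ i j, i ≠ j → ∀ α β : ℂ, (∀ p, α * R i p + β * R j p = 0) → α = 0 ∧ β = 0 :=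
    fun i j hij => eq_zero_of_linearIndependent_qpoly (by rw [← hR, ← hR]; exact h5 i j hij)
  refine ⟨{
    Qo := R (Sum.inl ())
    a := fun o => o.elim 0 a
    b := fun o => o.elim 0 b
    Q := fun o => R (idx m₁ m₂ r o)
    P := fun i => R (Sum.inr (Sum.inr (Sum.inl i)))
    Q_none := rfl
    Q_apply := ?_
    Q_not_prod := ?_
    P_pencil := ?_
    QQ_indep := fun i j hij => hindep _ _ (idx_injective.ne hij)
    PQ_indep := fun i j => hindep _ _ (by rcases j with _ | j <;> simp [idx])
    PP_indep := fun i j hij => hindep _ _ (by simpa using hij)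
    QQ := ?_
    PQ := ?_
    card_vanishPair := ?_
    lt_card := h7 }, hRo, hRQ, hRP⟩
  · rintro (_ | j) p
    · simp [idx]
    · have := congrArg (eval p) (hAB j)
      rw [hRQ, hRo, ha, hb] at this
      simpa [eval_qpoly, eval_lpoly, idx] using this
  · rintro (_ | j)
    · exact not_isProdForm_of_irreducible (hRo ▸ h1.2)
    · exact not_isProdForm_of_irreducible (hRQ j ▸ (h2 j).2)
  · rintro i ⟨α, β, h0, hprod⟩
    have := rankS_le_one_of_isProdForm hprod
    have h' := h9 i α β (by tauto)
    rw [hRP, hRo] at h'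
    have e : α • qpoly (R (Sum.inr (Sum.inr (Sum.inl i)))) + β • qpoly (R (Sum.inl ())) =
        qpoly (α • R (Sum.inr (Sum.inr (Sum.inl i))) + β • R (Sum.inl ())) :=
      MvPolynomial.funext fun p => by simp [smul_eval, eval_qpoly]
    rw [e] at h'
    omega
  · intro i j hij
    rcases hpencil _ _ ((idx_injective (m₂ := m₂) (r := r)).ne hij) with
      ⟨k, -, -, hk⟩ | ⟨k, hki, hkj, hk⟩ | hp
    · exact Or.inl ⟨k, hk⟩
    · exact Or.inr (Or.inl ⟨k, fun e => hki (e ▸ rfl), fun e => hkj (e ▸ rfl), hk⟩)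
    · exact Or.inr (Or.inr hp)
  · intro i j
    rcases hpencil (Sum.inr (Sum.inr (Sum.inl i))) (idx m₁ m₂ r j)
      (by rcases j with _ | j <;> simp [idx]) with ⟨k, hki, -, hk⟩ | ⟨k, -, hkj, hk⟩ | hp
    · exact Or.inl ⟨k, fun e => hki (e ▸ rfl), hk⟩
    · exact Or.inr (Or.inl ⟨k, fun e => hkj (e ▸ rfl), hk⟩)
    · exact Or.inr (Or.inr hp)
  · refine le_trans (Set.ncard_le_ncard_of_injOn (fun j => Sum.inr (Sum.inl j)) ?_ ?_
      (Set.toFinite _)) h10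
    · rintro j ⟨c, d, hcd⟩
      refine ⟨lpoly c, lpoly d, isHomogeneous_lpoly c, isHomogeneous_lpoly d, ?_, ?_⟩
      · change Qs j ∈ _
        rw [hRQ]
        exact qpoly_mem_span_pair_of_vanish fun p h1 h2 => (hcd p h1 h2).1
      · rw [hRo]
        exact qpoly_mem_span_pair_of_vanish fun p h1 h2 => (hcd p h1 h2).2
    · intro i _ j _ hij
      simpa using hij

/-- The reduced equations of the members of the family: linear forms are not squared. -/
noncomputable def reducedFam (Qo : MvPolynomial (Fin n) ℂ)
    (Qs : Fin m₁ → MvPolynomial (Fin n) ℂ) (Ps : Fin m₂ → MvPolynomial (Fin n) ℂ)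
    (ls : Fin r → MvPolynomial (Fin n) ℂ) :
    Unit ⊕ Fin m₁ ⊕ Fin m₂ ⊕ Fin r → MvPolynomial (Fin n) ℂ :=
  Sum.elim (fun _ => Qo) (Sum.elim Qs (Sum.elim Ps ls))

lemma QoFam_eq_reducedFam (h : IsQoSet m₁ m₂ r Qo Qs Ps ls)
    (k : Unit ⊕ Fin m₁ ⊕ Fin m₂ ⊕ Fin r) :
    (QoFam Qo Qs Ps ls k = reducedFam Qo Qs Ps ls k ∧ (reducedFam Qo Qs Ps ls k).IsHomogeneous 2) ∨
    (QoFam Qo Qs Ps ls k = reducedFam Qo Qs Ps ls k ^ 2 ∧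
      (reducedFam Qo Qs Ps ls k).IsHomogeneous 1) := by
  have := h.isHomogeneous_QoFam k
  obtain ⟨-, -, -, h4, -⟩ := h
  rcases k with _ | j | i | t
  exacts [Or.inl ⟨rfl, this⟩, Or.inl ⟨rfl, this⟩, Or.inl ⟨rfl, this⟩, Or.inr ⟨rfl, h4 t⟩]

lemma irreducible_reducedFam (h : IsQoSet m₁ m₂ r Qo Qs Ps ls)
    (k : Unit ⊕ Fin m₁ ⊕ Fin m₂ ⊕ Fin r) : Irreducible (reducedFam Qo Qs Ps ls k) := by
  have hls := h.ls_ne_zero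
  obtain ⟨h1, h2, h3, h4, -⟩ := h
  rcases k with _ | j | i | t
  exacts [h1.2, (h2 j).2, (h3 i).2, irreducible_of_isHomogeneous_one (h4 t) (hls t)]

lemma not_reducedFam_dvd (h : IsQoSet m₁ m₂ r Qo Qs Ps ls)
    {k l : Unit ⊕ Fin m₁ ⊕ Fin m₂ ⊕ Fin r} (hkl : k ≠ l) :
    ¬ reducedFam Qo Qs Ps ls k ∣ reducedFam Qo Qs Ps ls l := by
  intro hdvd
  have hk := h.irreducible_reducedFam k
  have hl := h.irreducible_reducedFam l
  obtain ⟨u, hu⟩ := eq_C_mul_of_dvd hk hl hdvd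
  have hk' := h.QoFam_eq_reducedFam k
  have hl' := h.QoFam_eq_reducedFam l
  obtain ⟨-, -, -, -, h5, -⟩ := h
  have key : ∀ s : ℂ, QoFam Qo Qs Ps ls l ≠ s • QoFam Qo Qs Ps ls k := by
    intro s hs
    have := (LinearIndependent.pair_iff.1 (h5 k l hkl) (-s) 1 (by rw [hs]; module)).2
    exact one_ne_zero this
  have hhom : ∀ d, (reducedFam Qo Qs Ps ls k).IsHomogeneous d →
      (reducedFam Qo Qs Ps ls l).IsHomogeneous d := fun d hd => hu ▸ hd.C_mul u
  rcases hk' with ⟨hk1, hk2⟩ | ⟨hk1, hk2⟩ <;> rcases hl' with ⟨hl1, hl2⟩ | ⟨hl1, hl2⟩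
  · exact key u (by rw [hl1, hk1, hu, smul_eq_C_mul])
  · exact absurd ((hhom _ hk2).inj_right hl2 hl.ne_zero) (by norm_num)
  · exact absurd ((hhom _ hk2).inj_right hl2 hl.ne_zero) (by norm_num)
  · exact key (u ^ 2) (by rw [hl1, hk1, hu, smul_eq_C_mul, mul_pow, map_pow])

lemma exists_reducedFam_eval_eq_zero (h : IsQoSet m₁ m₂ r Qo Qs Ps ls)
    {i j : Unit ⊕ Fin m₁ ⊕ Fin m₂ ⊕ Fin r} (hij : i ≠ j) {p : Fin n → ℂ}
    (hi : eval p (reducedFam Qo Qs Ps ls i) = 0) (hj : eval p (reducedFam Qo Qs Ps ls j) = 0) :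
    ∃ k, k ≠ i ∧ k ≠ j ∧ eval p (reducedFam Qo Qs Ps ls k) = 0 := by
  have hiff : ∀ k, eval p (QoFam Qo Qs Ps ls k) = 0 ↔ eval p (reducedFam Qo Qs Ps ls k) = 0 := by
    intro k
    rcases h.QoFam_eq_reducedFam k with ⟨hk, -⟩ | ⟨hk, -⟩ <;> simp [hk]
  obtain ⟨-, -, -, -, -, h6, -⟩ := h
  obtain ⟨k, hk, hpk⟩ := exists_eval_eq_zero_of_prod_mem_radical (h6 i j hij)
    ((hiff i).2 hi) ((hiff j).2 hj)
  exact ⟨k, (Finset.mem_erase.1 (Finset.mem_erase.1 hk).2).1, (Finset.mem_erase.1 hk).1,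
    (hiff k).1 hpk⟩

lemma finrank_span_QoFam_le (h : IsQoSet m₁ m₂ r Qo Qs Ps ls) :
    finrank ℂ (Submodule.span ℂ (Set.range (QoFam Qo Qs Ps ls))) ≤ 39 * 39 + 1 := by
  obtain ⟨D, hQo, hQs, hPs⟩ := h.exists_qoForms
  refine D.finrank_span_le (h := reducedFam Qo Qs Ps ls) h.irreducible_reducedFam
    (fun k l => h.not_reducedFam_dvd)
    (fun i j hij p hi hj => h.exists_reducedFam_eval_eq_zero hij hi hj) fun k => ?_
  obtain ⟨-, -, -, h4, -⟩ := h
  rcases k with _ | j | i | t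
  · exact Or.inl ⟨none, hQo, rfl⟩
  · exact Or.inl ⟨some j, hQs j, rfl⟩
  · exact Or.inr (Or.inl ⟨i, hPs i, rfl⟩)
  · obtain ⟨l, hl⟩ := exists_eq_lpoly (h4 t)
    exact Or.inr (Or.inr ⟨l, hl, rfl⟩)

end IsQoSet

/-- Theorem 5.1 / 4.5 of the paper. There is a universal constant `c`
bounding the dimension of the span of every `(Q_o,m₁,m₂)`-set. -/
theorem statement12 :
    ∃ c : ℕ, ∀ (n m₁ m₂ r : ℕ) (Qo : MvPolynomial (Fin n) ℂ)
      (Qs : Fin m₁ → MvPolynomial (Fin n) ℂ) (Ps : Fin m₂ → MvPolynomial (Fin n) ℂ)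
      (ls : Fin r → MvPolynomial (Fin n) ℂ),
      IsQoSet m₁ m₂ r Qo Qs Ps ls →
      Module.finrank ℂ (Submodule.span ℂ (Set.range (QoFam Qo Qs Ps ls))) ≤ c :=
  ⟨39 * 39 + 1, fun _ _ _ _ _ _ _ _ h => h.finrank_span_QoFam_le⟩
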